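/- r₂(H) = 2 if and only if n has one of the following forms, where p, p₁, p₂ denote distinct primes ≡ 1 (mod 4), q, q₁, q₂ distinct primes ≡ 3 (mod 4), all coprime to l, and δ ∈ {1, 2}: (1) n = p₁p₂ with either (p₁/l) = (p₂/l) = −1, or ((p_i/l) = −(p_j/l) = −1 and (p_j/l)₄ ≠ (l/p_j)₄ for some ordering {i,j} = {1,2}); (2) n = p with (p/l) = 1 and (p/l)₄ = (l/p)₄; (3) n = 2p with (p/l) = −1 and (2/l)₄ ≠ (−1)^((l−1)/8); (4) n = 2 with (2/l)₄ = (−1)^((l−1)/8); (5) n = δ·q with (q/l) = 1; (6) n = q₁q₂ with (q₁/l) = (q₂/l) = 1; (7) n = δ·pq with (p/l) = (q/l) = −1; (8) n = p·q₁q₂ with (p/l) = −1 and ((q₁/l) = −1 or (q₂/l) = −1). -/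

import Mathlib

/-- `ε` is the fundamental unit of the real quadratic field `ℚ(√l)` (viewed inside `ℝ`):
it lies in `ℚ(√l)`, it is a unit of the ring of integers (both `ε` and `ε⁻¹` are
algebraic integers), `ε > 1`, and it is the smallest such unit. -/
def IsFundamentalUnit (l : ℕ) (ε : ℝ) : Prop :=
  1 < ε ∧ ε ∈ IntermediateField.adjoin ℚ ({Real.sqrt (l : ℝ)} : Set ℝ) ∧
    IsIntegral ℤ ε ∧ IsIntegral ℤ ε⁻¹ ∧
    ∀ x : ℝ, 1 < x → x ∈ IntermediateField.adjoin ℚ ({Real.sqrt (l : ℝ)} : Set ℝ) →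
      IsIntegral ℤ x → IsIntegral ℤ x⁻¹ → ε ≤ x

/-- The Legendre symbol `(a/p)`, via Euler's criterion (so that no `Fact p.Prime`
instance is needed): for an odd prime `p` it is `1` if `a` is a nonzero square mod `p`,
`0` if `p ∣ a`, and `-1` otherwise. -/
def legSym (p : ℕ) (a : ℤ) : ℤ :=
  if (a : ZMod p) ^ ((p - 1) / 2) = 1 then 1 else if (a : ZMod p) = 0 then 0 else -1

/-- The rational fourth power residue symbol `(a/p)₄ ∈ {±1}`, meaningful when
`(a/p) = 1`; it is determined by `(a/p)₄ ≡ a ^ ((p-1)/4) (mod p)`. -/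
def quartSym (p : ℕ) (a : ℤ) : ℤ :=
  if (a : ZMod p) ^ ((p - 1) / 4) = 1 then 1 else -1

/-- The cardinality of the 2-torsion subgroup of the class group of `K`.
For a number field `K` this equals `2 ^ r₂(H)`, where `r₂(H)` is the rank of the
2-class group `H` of `K` (i.e. `dim_{𝔽₂} Cl(K)/Cl(K)²`); in particular
`r₂(H) = r` iff this cardinality is `2 ^ r`. -/
noncomputable def twoTorsCard (K : IntermediateField ℚ ℝ) : ℕ :=
  Nat.card {x : ClassGroup (NumberField.RingOfIntegers K) // x ^ 2 = 1}

section

open IsDedekindDomain nonZeroDivisors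

namespace IsDedekindDomain.HeightOneSpectrum

section Ord

variable {R K : Type*} [CommRing R] [IsDedekindDomain R] [Field K] [Algebra R K]
  [IsFractionRing R K]

/-- The additive `v`-adic valuation on the fraction field, with the convention `ord 0 = 0`. -/
noncomputable def ord (v : HeightOneSpectrum R) (x : K) : ℤ := -(v.valuation K x).log

variable (v : HeightOneSpectrum R)

omit [IsDedekindDomain R] in
theorem val_ne_zero [IsDedekindDomain R] {x : K} (hx : x ≠ 0) : v.valuation K x ≠ 0 :=
  (Valuation.ne_zero_iff _).2 hx

theorem ord_mul {x y : K} (hx : x ≠ 0) (hy : y ≠ 0) : v.ord (x * y) = v.ord x + v.ord y := by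
  simp only [ord, map_mul]
  rw [WithZero.log_mul (v.val_ne_zero hx) (v.val_ne_zero hy)]
  ring

@[simp] theorem ord_zero : v.ord (0 : K) = 0 := by simp [ord]

@[simp] theorem ord_one : v.ord (1 : K) = 0 := by simp [ord]

theorem ord_inv (x : K) : v.ord x⁻¹ = -v.ord x := by simp [ord, WithZero.log_inv]

theorem ord_pow (x : K) (n : ℕ) : v.ord (x ^ n) = n * v.ord x := by
  simp [ord, WithZero.log_pow]

theorem ord_neg (x : K) : v.ord (-x) = v.ord x := by simp [ord, Valuation.map_neg]

theorem ord_div {x y : K} (hx : x ≠ 0) (hy : y ≠ 0) : v.ord (x / y) = v.ord x - v.ord y := by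
  rw [div_eq_mul_inv, ord_mul v hx (inv_ne_zero hy), ord_inv]; ring

theorem valuation_eq_exp {x : K} (hx : x ≠ 0) :
    v.valuation K x = WithZero.exp (-v.ord x) := by
  simp [ord, WithZero.exp_log (v.val_ne_zero hx)]

theorem ord_nonneg (r : R) : 0 ≤ v.ord (algebraMap R K r) := by
  by_cases hr : r = 0
  · simp [hr]
  have h := v.valuation_le_one (K := K) r
  rw [valuation_eq_exp v (by simpa using hr), ← WithZero.exp_zero, WithZero.exp_le_exp] at h
  linarith

theorem mem_pow_iff_ord {r : R} (hr : r ≠ 0) (n : ℕ) :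
    r ∈ v.asIdeal ^ n ↔ (n : ℤ) ≤ v.ord (algebraMap R K r) := by
  rw [← v.intValuation_le_pow_iff_mem, ← v.valuation_of_algebraMap (K := K),
    valuation_eq_exp v (by simpa using hr), WithZero.exp_le_exp]
  exact neg_le_neg_iff

theorem mem_iff_ord {r : R} (hr : r ≠ 0) :
    r ∈ v.asIdeal ↔ 1 ≤ v.ord (algebraMap R K r) := by
  simpa using v.mem_pow_iff_ord (K := K) hr 1

theorem ord_eq_zero_of_notMem {r : R} (hr : r ∉ v.asIdeal) : v.ord (algebraMap R K r) = 0 := by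
  have h0 : r ≠ 0 := fun h => hr (h ▸ v.asIdeal.zero_mem)
  have h1 := v.mem_iff_ord (K := K) h0
  have h2 := v.ord_nonneg (K := K) r
  by_contra h
  exact hr (h1.2 (by omega))

theorem ord_add {x y : K} (hxy : x + y ≠ 0) {m : ℤ} (hx : x = 0 ∨ m ≤ v.ord x)
    (hy : y = 0 ∨ m ≤ v.ord y) : m ≤ v.ord (x + y) := by
  have aux : ∀ z : K, z = 0 ∨ m ≤ v.ord z → v.valuation K z ≤ WithZero.exp (-m) := by
    rintro z (rfl | hz)
    · simp
    · by_cases hz0 : z = 0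
      · simp [hz0]
      · rw [valuation_eq_exp v hz0, WithZero.exp_le_exp]; exact neg_le_neg hz
  have h := (v.valuation K).map_add_le (aux x hx) (aux y hy)
  rw [valuation_eq_exp v hxy, WithZero.exp_le_exp] at h
  exact neg_le_neg_iff.1 h

theorem exists_algebraMap_eq_of_ord_nonneg {x : K} (hx : ∀ v : HeightOneSpectrum R, 0 ≤ v.ord x) :
    ∃ r : R, algebraMap R K r = x := by
  refine mem_integers_of_valuation_le_one K x fun v => ?_
  by_cases h0 : x = 0
  · simp [h0]
  · rw [valuation_eq_exp v h0, ← WithZero.exp_zero, WithZero.exp_le_exp]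
    exact neg_nonpos.2 (hx v)

theorem exists_unit_of_ord_eq_zero {x : K} (h0 : x ≠ 0)
    (hx : ∀ v : HeightOneSpectrum R, v.ord x = 0) :
    ∃ u : Rˣ, algebraMap R K u = x := by
  obtain ⟨r, hr⟩ := exists_algebraMap_eq_of_ord_nonneg (fun v => (hx v).ge)
  obtain ⟨s, hs⟩ := exists_algebraMap_eq_of_ord_nonneg (R := R) (x := x⁻¹)
    (fun v => by rw [ord_inv, hx v]; simp)
  have hrs : r * s = 1 := by
    apply IsFractionRing.injective R K
    rw [map_mul, hr, hs, map_one, mul_inv_cancel₀ h0]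
  exact ⟨⟨r, s, hrs, by rw [mul_comm, hrs]⟩, hr⟩

theorem ord_unit (u : Rˣ) : v.ord (algebraMap R K u) = 0 :=
  v.ord_eq_zero_of_notMem fun h => v.isPrime.ne_top (Ideal.eq_top_of_isUnit_mem _ h u.isUnit)

theorem count_spanSingleton {x : K} (hx : x ≠ 0) :
    FractionalIdeal.count K v (FractionalIdeal.spanSingleton R⁰ x) = v.ord x := by
  classical
  have aux : ∀ r : R, r ≠ 0 → FractionalIdeal.count K v
      (FractionalIdeal.spanSingleton R⁰ (algebraMap R K r)) = v.ord (algebraMap R K r) := by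
    intro r hr
    have h1 : Ideal.span {r} ≠ 0 := by simpa using hr
    rw [← FractionalIdeal.coeIdeal_span_singleton, FractionalIdeal.count_coe K v h1, ord,
      valuation_of_algebraMap, intValuation_if_neg v hr, WithZero.log_exp, neg_neg]
  obtain ⟨a, b, hb, rfl⟩ := IsFractionRing.div_surjective (A := R) x
  have hb0 : b ≠ 0 := nonZeroDivisors.ne_zero hb
  have ha0 : a ≠ 0 := by rintro rfl; simp at hx
  have ha' : algebraMap R K a ≠ 0 := by simpa using ha0
  have hb' : algebraMap R K b ≠ 0 := by simpa using hb0
  rw [div_eq_mul_inv, ← FractionalIdeal.spanSingleton_mul_spanSingleton,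
    FractionalIdeal.count_mul _ _ (FractionalIdeal.spanSingleton_ne_zero_iff.2 ha')
      (FractionalIdeal.spanSingleton_ne_zero_iff.2 (inv_ne_zero hb')),
    ← FractionalIdeal.spanSingleton_inv, FractionalIdeal.count_inv, aux a ha0, aux b hb0,
    ord_mul v ha' (inv_ne_zero hb'), ord_inv]

theorem ord_eventually_zero (x : K) :
    ∀ᶠ v : HeightOneSpectrum R in Filter.cofinite, v.ord x = 0 := by
  by_cases hx : x = 0
  · simp [hx]
  filter_upwards [FractionalIdeal.finite_factors (R := R)
    (FractionalIdeal.spanSingleton R⁰ x)] with v hv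
  rwa [count_spanSingleton v hx] at hv

theorem fractionalIdeal_ext {I J : FractionalIdeal R⁰ K} (hI : I ≠ 0) (hJ : J ≠ 0)
    (h : ∀ v, FractionalIdeal.count K v I = FractionalIdeal.count K v J) : I = J := by
  rw [← FractionalIdeal.finprod_heightOneSpectrum_factorization' K hI,
    ← FractionalIdeal.finprod_heightOneSpectrum_factorization' K hJ]
  simp_rw [h]

theorem exists_fractionalIdeal_count (e : HeightOneSpectrum R → ℤ)
    (he : ∀ᶠ v in Filter.cofinite, e v = 0) :
    ∃ J : (FractionalIdeal R⁰ K)ˣ, ∀ v, FractionalIdeal.count K v (J : FractionalIdeal R⁰ K) = e v := by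
  have h0 : (∏ᶠ v : HeightOneSpectrum R, (v.asIdeal : FractionalIdeal R⁰ K) ^ e v) ≠ 0 := by
    refine finprod_induction (fun I : FractionalIdeal R⁰ K => I ≠ 0) one_ne_zero
      (fun _ _ => mul_ne_zero) (fun v => zpow_ne_zero _ ?_)
    exact FractionalIdeal.coeIdeal_ne_zero.2 v.ne_bot
  exact ⟨Units.mk0 _ h0, fun v => FractionalIdeal.count_finprod K v e he⟩

/-- Over a ring whose class group has odd order, every system of exponents becomes that of an
element of the fraction field after multiplication by the class number. -/
theorem exists_ord_eq_mul [Finite (ClassGroup R)] (e : HeightOneSpectrum R → ℤ)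
    (he : ∀ᶠ v in Filter.cofinite, e v = 0) :
    ∃ c : K, c ≠ 0 ∧ ∀ v, v.ord c = Nat.card (ClassGroup R) * e v := by
  obtain ⟨J, hJ⟩ := exists_fractionalIdeal_count (K := K) e he
  have h1 : ClassGroup.mk (K := K) (J ^ Nat.card (ClassGroup R)) = 1 := by rw [map_pow, pow_card_eq_one']
  rw [ClassGroup.mk_eq_one_iff, FractionalIdeal.isPrincipal_iff] at h1
  obtain ⟨c, hc⟩ := h1
  have hc0 : c ≠ 0 := by
    rintro rfl
    simp only [FractionalIdeal.spanSingleton_zero] at hc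
    exact (J ^ Nat.card (ClassGroup R)).ne_zero hc
  refine ⟨c, hc0, fun v => ?_⟩
  rw [← count_spanSingleton v hc0, ← hc, Units.val_pow_eq_pow_val, FractionalIdeal.count_pow, hJ]

/-- If the class group has odd order, an element with even order everywhere is a unit times a
square. -/
theorem exists_unit_mul_sq [Finite (ClassGroup R)] (hodd : Odd (Nat.card (ClassGroup R))) {a : K}
    (ha : a ≠ 0) (h : ∀ v : HeightOneSpectrum R, Even (v.ord a)) :
    ∃ (u : Rˣ) (c : K), c ≠ 0 ∧ a = algebraMap R K u * c ^ 2 := by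
  obtain ⟨c, hc0, hc⟩ := exists_ord_eq_mul (K := K) (fun v : HeightOneSpectrum R => v.ord a / 2)
    ((ord_eventually_zero a).mono fun v hv => by simp [hv])
  obtain ⟨m, hm⟩ := hodd
  have hne : a ^ (2 * m + 1) / c ^ 2 ≠ 0 := div_ne_zero (pow_ne_zero _ ha) (pow_ne_zero _ hc0)
  obtain ⟨u, hu⟩ := exists_unit_of_ord_eq_zero (R := R) hne (fun v => by
    rw [ord_div v (pow_ne_zero _ ha) (pow_ne_zero _ hc0), ord_pow, ord_pow, hc, hm]
    obtain ⟨j, hj⟩ := h v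
    rw [hj]
    push_cast
    rw [← two_mul, Int.mul_ediv_cancel_left _ two_ne_zero]
    ring)
  refine ⟨u, c / a ^ m, div_ne_zero hc0 (pow_ne_zero _ ha), ?_⟩
  rw [hu]
  field_simp
  ring

end Ord

end IsDedekindDomain.HeightOneSpectrum

end

section

open IsDedekindDomain nonZeroDivisors NumberField Pointwise
set_option linter.unusedSectionVars false

namespace QuadExt

variable {k F : Type*} [Field k] [NumberField k] [Field F] [NumberField F] [Algebra k F]
  [Algebra.IsQuadraticExtension k F]

section Galois

variable {σ : Gal(F/k)} (hσ : σ ≠ 1)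

theorem card_gal : Nat.card Gal(F/k) = 2 := by
  rw [IsGalois.card_aut_eq_finrank, Algebra.IsQuadraticExtension.finrank_eq_two]

include hσ in
theorem gal_eq (τ : Gal(F/k)) : τ = 1 ∨ τ = σ := by
  classical
  by_contra! h
  have : Finset.card {1, σ, τ} = 3 := Finset.card_eq_three.2 ⟨1, σ, τ, hσ.symm, h.1.symm, h.2.symm, rfl⟩
  have h2 := Finset.card_le_univ ({1, σ, τ} : Finset Gal(F/k))
  rw [← Nat.card_eq_fintype_card, card_gal] at h2
  omega

include hσ in
theorem gal_involutive (x : F) : σ (σ x) = x := by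
  rcases gal_eq hσ (σ * σ) with h | h
  · exact congrArg (fun τ : Gal(F/k) => τ x) h
  · exact absurd (mul_eq_left.1 h) hσ

include hσ in
theorem algebraMap_norm (x : F) : algebraMap k F (Algebra.norm k x) = x * σ x := by
  classical
  rw [Algebra.norm_eq_prod_automorphisms]
  have : (Finset.univ : Finset Gal(F/k)) = {1, σ} := by
    ext τ; simpa using gal_eq hσ τ
  rw [this, Finset.prod_pair hσ.symm]
  simp

include hσ in
theorem mem_range_of_fixed {x : F} (hx : σ x = x) : ∃ a : k, algebraMap k F a = x := by
  refine (IsGalois.mem_range_algebraMap_iff_fixed x).2 fun τ => ?_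
  rcases gal_eq hσ τ with rfl | rfl
  · rfl
  · exact hx

include hσ in
theorem exists_anti : ∃ r : F, r ≠ 0 ∧ σ r = -r := by
  have : ∃ a, σ a ≠ a := by
    by_contra! h
    exact hσ (AlgEquiv.ext h)
  obtain ⟨a, ha⟩ := this
  exact ⟨a - σ a, sub_ne_zero.2 ha.symm, by rw [map_sub, gal_involutive hσ]; ring⟩

include hσ in
theorem hilbert90 {x : F} (hx : x * σ x = 1) : ∃ z : F, z ≠ 0 ∧ x * σ z = z := by
  by_cases h : x = -1
  · obtain ⟨r, h0, hr⟩ := exists_anti hσ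
    exact ⟨r, h0, by rw [h, hr]; ring⟩
  · refine ⟨1 + x, fun h0 => h (by linear_combination h0), ?_⟩
    rw [map_add, map_one]
    linear_combination hx

include hσ in
/-- The elements of `k` that are squares in `F = k(r)`, `r ^ 2 = d`. -/
theorem square_of_base {r : F} (hr0 : r ≠ 0) (hr : σ r = -r) {d : k} (hd : r ^ 2 = algebraMap k F d)
    {a : k} {x : F} (h : algebraMap k F a = x ^ 2) : (∃ c, a = c ^ 2) ∨ ∃ c, a = d * c ^ 2 := by
  have h1 : σ x ^ 2 = x ^ 2 := by rw [← map_pow, ← h, AlgEquiv.commutes]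
  have inj := (algebraMap k F).injective
  rcases sq_eq_sq_iff_eq_or_eq_neg.1 h1 with h2 | h2
  · obtain ⟨c, rfl⟩ := mem_range_of_fixed hσ h2
    exact Or.inl ⟨c, inj (by rw [h, map_pow])⟩
  · obtain ⟨c, hc⟩ := mem_range_of_fixed hσ (x := x / r) (by rw [map_div₀, h2, hr, neg_div_neg_eq])
    refine Or.inr ⟨c, inj ?_⟩
    rw [h, map_mul, map_pow, hc, ← hd]
    field_simp

end Galois

section Ramification

variable (F) in
/-- The common ramification index in `F` of the primes above `v`. -/
noncomputable def ram (v : HeightOneSpectrum (𝓞 k)) : ℕ := v.asIdeal.ramificationIdxIn (𝓞 F)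

theorem exists_over (v : HeightOneSpectrum (𝓞 k)) :
    ∃ w : HeightOneSpectrum (𝓞 F), w.asIdeal.LiesOver v.asIdeal := by
  obtain ⟨⟨P, hP, hPv⟩⟩ := v.asIdeal.nonempty_primesOver (S := 𝓞 F)
  exact ⟨⟨P, hP, Ideal.ne_bot_of_liesOver_of_ne_bot v.ne_bot P⟩, hPv⟩

theorem exists_under (w : HeightOneSpectrum (𝓞 F)) :
    ∃ v : HeightOneSpectrum (𝓞 k), w.asIdeal.LiesOver v.asIdeal :=
  ⟨w.under (𝓞 k), ⟨rfl⟩⟩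

theorem ord_algebraMap (v : HeightOneSpectrum (𝓞 k)) (w : HeightOneSpectrum (𝓞 F))
    [h : w.asIdeal.LiesOver v.asIdeal] (x : k) :
    w.ord (algebraMap k F x) = ram F v * v.ord x := by
  have h1 := HeightOneSpectrum.valuation_liesOver F v w x
  have := v.isPrime
  have := w.isPrime
  rw [Ideal.ramificationIdx'_eq_ramificationIdx _ _ v.ne_bot,
    ← Ideal.ramificationIdxIn_eq_ramificationIdx v.asIdeal w.asIdeal Gal(F/k)] at h1
  rw [HeightOneSpectrum.ord, ← h1, WithZero.log_pow, HeightOneSpectrum.ord, ram]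
  simp

theorem efg (v : HeightOneSpectrum (𝓞 k)) :
    (v.asIdeal.primesOver (𝓞 F)).ncard * (ram F v * v.asIdeal.inertiaDegIn (𝓞 F)) = 2 := by
  have := v.isPrime
  rw [ram, Ideal.ncard_primesOver_mul_ramificationIdxIn_mul_inertiaDegIn v.asIdeal (𝓞 F) Gal(F/k),
    card_gal]

theorem ram_eq_one_or_two (v : HeightOneSpectrum (𝓞 k)) : ram F v = 1 ∨ ram F v = 2 := by
  have h : ram F v ∣ 2 := by
    rw [← efg (F := F) v]
    exact Dvd.dvd.mul_left (Dvd.intro _ rfl) _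
  exact (Nat.dvd_prime Nat.prime_two).1 h

/-- The conjugate prime. -/
noncomputable def conj (σ : Gal(F/k)) (w : HeightOneSpectrum (𝓞 F)) : HeightOneSpectrum (𝓞 F) where
  asIdeal := σ • w.asIdeal
  isPrime := have := w.isPrime; inferInstance
  ne_bot h := w.ne_bot (by
    have := congrArg (σ⁻¹ • ·) h
    simpa using this)

theorem ord_conj (σ : Gal(F/k)) (w : HeightOneSpectrum (𝓞 F)) (x : F) :
    (conj σ w).ord (σ x) = w.ord x := by
  have aux : ∀ r : 𝓞 F, (conj σ w).ord (σ (algebraMap (𝓞 F) F r)) = w.ord (algebraMap (𝓞 F) F r) := by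
    intro r
    by_cases hr : r = 0
    · simp [hr]
    have hr' : σ • r ≠ 0 := (smul_ne_zero_iff_ne σ).2 hr
    have key : ∀ n : ℕ, (n : ℤ) ≤ (conj σ w).ord (algebraMap (𝓞 F) F (σ • r)) ↔
        (n : ℤ) ≤ w.ord (algebraMap (𝓞 F) F r) := fun n => by
      rw [← HeightOneSpectrum.mem_pow_iff_ord _ hr', ← HeightOneSpectrum.mem_pow_iff_ord _ hr, conj]
      change _ ∈ (σ • w.asIdeal) ^ n ↔ _
      rw [← smul_pow', Ideal.smul_mem_pointwise_smul_iff]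
    change (conj σ w).ord (algebraMap (𝓞 F) F (σ • r)) = _
    obtain ⟨a, ha⟩ := Int.eq_ofNat_of_zero_le ((conj σ w).ord_nonneg (K := F) (σ • r))
    obtain ⟨b, hb⟩ := Int.eq_ofNat_of_zero_le (w.ord_nonneg (K := F) r)
    exact le_antisymm (ha ▸ (key a).1 ha.ge) (hb ▸ (key b).2 hb.ge)
  obtain ⟨a, b, hb, rfl⟩ := IsFractionRing.div_surjective (A := 𝓞 F) x
  have hb0 : algebraMap (𝓞 F) F b ≠ 0 := by simpa using nonZeroDivisors.ne_zero hb
  by_cases ha : a = 0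
  · simp [ha]
  have ha0 : algebraMap (𝓞 F) F a ≠ 0 := by simpa using ha
  rw [map_div₀, HeightOneSpectrum.ord_div _ (by simpa using ha0) (by simpa using hb0),
    HeightOneSpectrum.ord_div _ ha0 hb0, aux, aux]

theorem conj_liesOver (σ : Gal(F/k)) (v : HeightOneSpectrum (𝓞 k)) (w : HeightOneSpectrum (𝓞 F))
    [h : w.asIdeal.LiesOver v.asIdeal] : (conj σ w).asIdeal.LiesOver v.asIdeal := by
  change (σ • w.asIdeal).LiesOver v.asIdeal
  infer_instance

theorem eq_or_eq_conj {σ : Gal(F/k)} (hσ : σ ≠ 1) (v : HeightOneSpectrum (𝓞 k))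
    (w w' : HeightOneSpectrum (𝓞 F)) [w.asIdeal.LiesOver v.asIdeal]
    [w'.asIdeal.LiesOver v.asIdeal] : w' = w ∨ w' = conj σ w := by
  have := w.isPrime
  have := w'.isPrime
  obtain ⟨τ, hτ⟩ := Ideal.exists_smul_eq_of_isGaloisGroup v.asIdeal w.asIdeal w'.asIdeal Gal(F/k)
  rcases gal_eq hσ τ with rfl | rfl
  · exact Or.inl (HeightOneSpectrum.ext (by simpa using hτ.symm))
  · exact Or.inr (HeightOneSpectrum.ext hτ.symm)

theorem ncard_eq_one_conj (σ : Gal(F/k)) (v : HeightOneSpectrum (𝓞 k)) (w : HeightOneSpectrum (𝓞 F))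
    [h : w.asIdeal.LiesOver v.asIdeal] (h1 : (v.asIdeal.primesOver (𝓞 F)).ncard = 1) :
    conj σ w = w := by
  obtain ⟨P, hP⟩ := Set.ncard_eq_one.1 h1
  have := conj_liesOver σ v w
  have a1 : w.asIdeal ∈ v.asIdeal.primesOver (𝓞 F) := ⟨w.isPrime, inferInstance⟩
  have a2 : (conj σ w).asIdeal ∈ v.asIdeal.primesOver (𝓞 F) := ⟨(conj σ w).isPrime, inferInstance⟩
  rw [hP] at a1 a2
  exact HeightOneSpectrum.ext (a2.trans a1.symm)

theorem conj_eq_of_ram (σ : Gal(F/k)) (v : HeightOneSpectrum (𝓞 k)) (w : HeightOneSpectrum (𝓞 F))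
    [h : w.asIdeal.LiesOver v.asIdeal] (h2 : ram F v = 2) : conj σ w = w := by
  have := efg (F := F) v
  rw [h2] at this
  have h3 : (v.asIdeal.primesOver (𝓞 F)).ncard * v.asIdeal.inertiaDegIn (𝓞 F) = 1 := by nlinarith
  exact ncard_eq_one_conj σ v w (Nat.eq_one_of_mul_eq_one_right h3)

theorem ram_of_odd {x : F} {d : k} (h : x ^ 2 = algebraMap k F d) (v : HeightOneSpectrum (𝓞 k))
    (hv : Odd (v.ord d)) : ram F v = 2 := by
  obtain ⟨w, hw⟩ := exists_over (F := F) v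
  rcases ram_eq_one_or_two (F := F) v with h1 | h1
  · have h2 := ord_algebraMap v w d
    rw [← h, HeightOneSpectrum.ord_pow, h1] at h2
    obtain ⟨m, hm⟩ := hv
    push_cast at h2
    omega
  · exact h1

theorem exists_congr_of_inertiaDeg_eq_one (v : HeightOneSpectrum (𝓞 k))
    (w : HeightOneSpectrum (𝓞 F)) [h : w.asIdeal.LiesOver v.asIdeal]
    (hf : v.asIdeal.inertiaDegIn (𝓞 F) = 1) (x : 𝓞 F) :
    ∃ c : 𝓞 k, x - algebraMap (𝓞 k) (𝓞 F) c ∈ w.asIdeal := by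
  have := v.isPrime
  have := w.isPrime
  have := v.isMaximal
  have := w.isMaximal
  rw [Ideal.inertiaDegIn_eq_inertiaDeg v.asIdeal w.asIdeal Gal(F/k),
    Ideal.inertiaDeg_eq_of_isMaximal v.asIdeal w.asIdeal] at hf
  let := Ideal.Quotient.field v.asIdeal
  have := (Ideal.Quotient.nontrivial_iff (I := w.asIdeal)).2 w.isPrime.ne_top
  obtain ⟨c, hc⟩ := (finrank_eq_one_iff_of_nonzero' (1 : 𝓞 F ⧸ w.asIdeal) one_ne_zero).1 hf
    (Ideal.Quotient.mk _ x)
  obtain ⟨c, rfl⟩ := Ideal.Quotient.mk_surjective c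
  refine ⟨c, ?_⟩
  rw [← Ideal.Quotient.eq, ← hc, Algebra.smul_def, mul_one]
  rfl

/-- An integer `w` with `(w - σ w) ^ 2` prime to `v` shows that `v` is unramified. -/
theorem ram_eq_one_of_disc (σ : Gal(F/k)) (x : 𝓞 F) (v : HeightOneSpectrum (𝓞 k)) (D : 𝓞 k)
    (hD : ((x : F) - σ x) ^ 2 = algebraMap k F D) (hv : D ∉ v.asIdeal) : ram F v = 1 := by
  rcases ram_eq_one_or_two (F := F) v with h1 | h1
  · exact h1
  exfalso
  obtain ⟨w, hw⟩ := exists_over (F := F) v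
  have hc := conj_eq_of_ram σ v w h1
  have hf : v.asIdeal.inertiaDegIn (𝓞 F) = 1 := by
    have := efg (F := F) v
    rw [h1] at this
    exact Nat.eq_one_of_mul_eq_one_left (by nlinarith :
      (v.asIdeal.primesOver (𝓞 F)).ncard * v.asIdeal.inertiaDegIn (𝓞 F) = 1)
  obtain ⟨c, hcw⟩ := exists_congr_of_inertiaDeg_eq_one v w hf x
  have h2 : σ • (x - algebraMap (𝓞 k) (𝓞 F) c) ∈ w.asIdeal := by
    have h3 : σ • (x - algebraMap (𝓞 k) (𝓞 F) c) ∈ (conj σ w).asIdeal :=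
      Ideal.smul_mem_pointwise_smul_iff.2 hcw
    rwa [hc] at h3
  have h3 : x - σ • x ∈ w.asIdeal := by
    have := w.asIdeal.sub_mem hcw h2
    rw [smul_sub, smul_algebraMap] at this
    simpa using this
  have h4 : algebraMap (𝓞 k) (𝓞 F) D ∈ w.asIdeal := by
    have h5 : algebraMap (𝓞 k) (𝓞 F) D = (x - σ • x) * (x - σ • x) := by
      apply RingOfIntegers.ext
      rw [← sq]
      exact hD.symm
    rw [h5]
    exact w.asIdeal.mul_mem_left _ h3
  exact hv (by
    rw [Ideal.LiesOver.over (p := v.asIdeal) (P := w.asIdeal)]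
    exact h4)

end Ramification

end QuadExt

end

section

open IsDedekindDomain nonZeroDivisors
set_option linter.unusedSectionVars false

namespace IsDedekindDomain.HeightOneSpectrum

section Selmer

variable (R K : Type*) [CommRing R] [IsDedekindDomain R] [Field K] [Algebra R K]
  [IsFractionRing R K]

/-- The elements of `Kˣ` whose order at every prime is even. -/
def evenUnits : Subgroup Kˣ where
  carrier := {a | ∀ v : HeightOneSpectrum R, Even (v.ord (a : K))}
  one_mem' := by simp
  mul_mem' {a b} ha hb v := by
    rw [Units.val_mul, ord_mul v a.ne_zero b.ne_zero]
    exact (ha v).add (hb v)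
  inv_mem' {a} ha v := by
    rw [Units.val_inv_eq_inv_val, ord_inv]
    exact (ha v).neg

/-- The subgroup of squares. -/
abbrev squares (G : Type*) [CommGroup G] : Subgroup G := (powMonoidHom 2 : G →* G).range

variable {R K} in
theorem mem_squares_units {a : Kˣ} : a ∈ squares Kˣ ↔ ∃ b : K, (a : K) = b ^ 2 := by
  constructor
  · rintro ⟨b, rfl⟩
    exact ⟨b, rfl⟩
  · rintro ⟨b, hb⟩
    have hb0 : b ≠ 0 := by
      rintro rfl
      simp at hb
    exact ⟨Units.mk0 b hb0, Units.ext hb.symm⟩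

theorem squares_le_evenUnits : squares Kˣ ≤ evenUnits R K := by
  rintro _ ⟨b, rfl⟩ v
  rw [powMonoidHom_apply, Units.val_pow_eq_pow_val, ord_pow]
  exact even_two_mul _

variable {R K} in
theorem exists_half (a : evenUnits R K) : ∃ J : (FractionalIdeal R⁰ K)ˣ,
    ∀ v, FractionalIdeal.count K v (J : FractionalIdeal R⁰ K) = v.ord ((a : Kˣ) : K) / 2 :=
  exists_fractionalIdeal_count _ ((ord_eventually_zero ((a : Kˣ) : K)).mono fun v hv => by simp [hv])

variable {R K} in
/-- A square root of the fractional ideal generated by an element with even orders. -/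
noncomputable def half (a : evenUnits R K) : (FractionalIdeal R⁰ K)ˣ := (exists_half a).choose

variable {R K} in
theorem two_mul_half (a : evenUnits R K) (v : HeightOneSpectrum R) :
    2 * FractionalIdeal.count K v (half a : FractionalIdeal R⁰ K) = v.ord ((a : Kˣ) : K) := by
  rw [half, (exists_half a).choose_spec v, Int.two_mul_ediv_two_of_even (a.2 v)]

theorem spanSingleton_unit_ne_zero (c : Kˣ) : FractionalIdeal.spanSingleton R⁰ (c : K) ≠ 0 :=
  FractionalIdeal.spanSingleton_ne_zero_iff.2 c.ne_zero

/-- The class of the square root of the ideal generated by an element with even orders. -/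
noncomputable def halfClass : evenUnits R K →* ClassGroup R :=
  (ClassGroup.mk (R := R) K).comp <| MonoidHom.mk' half fun a b => by
    refine Units.ext (fractionalIdeal_ext (Units.ne_zero _) (Units.ne_zero _) fun v => ?_)
    rw [Units.val_mul, FractionalIdeal.count_mul K v (Units.ne_zero _) (Units.ne_zero _)]
    have h1 := two_mul_half a v
    have h2 := two_mul_half b v
    have h3 := two_mul_half (a * b) v
    rw [Subgroup.coe_mul, Units.val_mul, ord_mul v (Units.ne_zero _) (Units.ne_zero _)] at h3
    omega

theorem halfClass_apply (a : evenUnits R K) :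
    halfClass R K a = ClassGroup.mk K (half a) := rfl

theorem halfClass_eq_one (a : evenUnits R K) : halfClass R K a = 1 ↔
    (a : Kˣ) ∈ (Units.map (algebraMap R K : R →* K)).range ⊔ squares Kˣ := by
  rw [halfClass_apply, ClassGroup.mk_eq_one_iff, FractionalIdeal.isPrincipal_iff, Subgroup.mem_sup]
  constructor
  · rintro ⟨c, hc⟩
    have hc0 : c ≠ 0 := by
      rintro rfl
      simp only [FractionalIdeal.spanSingleton_zero] at hc
      exact (half a).ne_zero hc
    have hne : ((a : Kˣ) : K) / c ^ 2 ≠ 0 := div_ne_zero (Units.ne_zero _) (pow_ne_zero _ hc0)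
    obtain ⟨u, hu⟩ := exists_unit_of_ord_eq_zero (R := R) hne fun v => by
      rw [ord_div v (Units.ne_zero _) (pow_ne_zero _ hc0), ord_pow, ← two_mul_half a v, hc,
        count_spanSingleton v hc0]
      ring
    refine ⟨_, ⟨u, rfl⟩, _, ⟨Units.mk0 c hc0, rfl⟩, Units.ext ?_⟩
    simp only [Units.val_mul, powMonoidHom_apply, Units.val_pow_eq_pow_val, Units.val_mk0,
      Units.coe_map, MonoidHom.coe_coe, hu]
    field_simp
  · rintro ⟨_, ⟨u, rfl⟩, _, ⟨c, rfl⟩, hc⟩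
    refine ⟨c, fractionalIdeal_ext (Units.ne_zero _) (spanSingleton_unit_ne_zero R K _) fun v => ?_⟩
    rw [count_spanSingleton v c.ne_zero]
    have h1 := two_mul_half a v
    have h2 : v.ord ((a : Kˣ) : K) = 2 * v.ord (c : K) := by
      rw [← hc, Units.val_mul, ord_mul v (Units.ne_zero _) (Units.ne_zero _), powMonoidHom_apply,
        Units.val_pow_eq_pow_val, ord_pow, Units.coe_map, MonoidHom.coe_coe, ord_unit, zero_add]
      rfl
    omega

theorem mem_range_halfClass (x : ClassGroup R) : x ∈ (halfClass R K).range ↔ x ^ 2 = 1 := by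
  constructor
  · rintro ⟨a, rfl⟩
    rw [halfClass_apply, ← map_pow, ClassGroup.mk_eq_one_iff, FractionalIdeal.isPrincipal_iff]
    refine ⟨((a : Kˣ) : K), fractionalIdeal_ext (Units.ne_zero _) (spanSingleton_unit_ne_zero R K _) fun v => ?_⟩
    · rw [count_spanSingleton v (Units.ne_zero _), ← two_mul_half a v, Units.val_pow_eq_pow_val,
        FractionalIdeal.count_pow]
      rfl
  · obtain ⟨I, rfl⟩ : ∃ I, ClassGroup.mk K I = x :=
      ClassGroup.induction K (P := fun x => ∃ I, ClassGroup.mk K I = x) (fun I => ⟨I, rfl⟩) x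
    rw [← map_pow, ClassGroup.mk_eq_one_iff, FractionalIdeal.isPrincipal_iff]
    rintro ⟨c, hc⟩
    have hc0 : c ≠ 0 := by
      rintro rfl
      simp only [FractionalIdeal.spanSingleton_zero] at hc
      exact (I ^ 2).ne_zero hc
    have key : ∀ v : HeightOneSpectrum R,
        v.ord c = 2 * FractionalIdeal.count K v (I : FractionalIdeal R⁰ K) := fun v => by
      rw [← count_spanSingleton v hc0, ← hc, Units.val_pow_eq_pow_val, FractionalIdeal.count_pow]
      rfl
    refine ⟨⟨Units.mk0 c hc0, fun v => by simp [key v]⟩, ?_⟩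
    rw [halfClass_apply]
    congr 1
    refine Units.ext (fractionalIdeal_ext (Units.ne_zero _) (Units.ne_zero _) fun v => ?_)
    have h1 := two_mul_half (R := R) (K := K) ⟨Units.mk0 c hc0, fun v => by simp [key v]⟩ v
    have h2 := key v
    simp only [Units.val_mk0] at h1
    omega

theorem comap_squares : (squares Kˣ).comap (Units.map (algebraMap R K : R →* K)) = squares Rˣ := by
  ext u
  rw [Subgroup.mem_comap, mem_squares_units]
  constructor
  · rintro ⟨b, hb⟩
    obtain ⟨r, rfl⟩ := IsIntegrallyClosed.exists_algebraMap_eq_of_isIntegral_pow (R := R) two_pos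
      (x := b) (hb ▸ isIntegral_algebraMap)
    have hr : (u : R) = r ^ 2 := by
      apply FaithfulSMul.algebraMap_injective R K
      rw [map_pow]
      exact hb
    have hu : IsUnit r := by
      rw [← isUnit_pow_iff two_ne_zero, ← hr]
      exact u.isUnit
    exact ⟨hu.unit, Units.ext hr.symm⟩
  · rintro ⟨b, rfl⟩
    exact ⟨algebraMap R K b, by simp⟩

theorem relIndex_squares_evenUnits : (squares Kˣ).relIndex (evenUnits R K) =
    (squares Rˣ).index * Nat.card {x : ClassGroup R // x ^ 2 = 1} := by
  set U := (Units.map (algebraMap R K : R →* K)).range with hU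
  have hUV : U ≤ evenUnits R K := by
    rintro _ ⟨u, rfl⟩ v
    simp [ord_unit]
  rw [← Subgroup.relIndex_mul_relIndex (squares Kˣ) (U ⊔ squares Kˣ) (evenUnits R K) le_sup_right
    (sup_le hUV (squares_le_evenUnits R K)), Subgroup.relIndex_sup_right]
  congr 1
  · rw [hU, MonoidHom.range_eq_map, ← Subgroup.relIndex_comap, Subgroup.relIndex_top_right]
    congr 1
    exact comap_squares R K
  · have : (U ⊔ squares Kˣ).subgroupOf (evenUnits R K) = (halfClass R K).ker := by
      ext a
      rw [MonoidHom.mem_ker, halfClass_eq_one]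
      rfl
    rw [Subgroup.relIndex, this, Subgroup.index_ker]
    exact Nat.card_congr (Equiv.subtypeEquivRight (mem_range_halfClass R K))

end Selmer

end IsDedekindDomain.HeightOneSpectrum

end

section

open IsDedekindDomain nonZeroDivisors NumberField Pointwise
open HeightOneSpectrum (squares evenUnits mem_squares_units ord_mul ord_pow)
set_option linter.unusedSectionVars false

namespace QuadExt

variable {k F : Type*} [Field k] [NumberField k] [Field F] [NumberField F] [Algebra k F]
  [Algebra.IsQuadraticExtension k F]

variable (k F) in
/-- Units of `k` that are norms of elements of `F`. -/
noncomputable def normUnits : Subgroup (𝓞 k)ˣ :=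
  ((Units.map (Algebra.norm k : F →* k)).range).comap (Units.map (algebraMap (𝓞 k) k : 𝓞 k →* k))

theorem mem_normUnits {u : (𝓞 k)ˣ} :
    u ∈ normUnits k F ↔ ∃ x : F, Algebra.norm k x = algebraMap (𝓞 k) k u := by
  constructor
  · rintro ⟨x, hx⟩
    exact ⟨x, congrArg Units.val hx⟩
  · rintro ⟨x, hx⟩
    have hx0 : x ≠ 0 := by
      rintro rfl
      rw [Algebra.norm_zero] at hx
      exact u.ne_zero (FaithfulSMul.algebraMap_injective (𝓞 k) k (by rw [← hx, map_zero]))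
    exact ⟨Units.mk0 x hx0, Units.ext hx⟩

variable (k F) in
/-- Elements of `kˣ` with even order at all primes not ramified in `F`. -/
def evenOutside : Subgroup kˣ where
  carrier := {a | ∀ v : HeightOneSpectrum (𝓞 k), ram F v = 1 → Even (v.ord (a : k))}
  one_mem' := by simp
  mul_mem' {a b} ha hb v hv := by
    rw [Units.val_mul, ord_mul v a.ne_zero b.ne_zero]
    exact (ha v hv).add (hb v hv)
  inv_mem' {a} ha v hv := by
    rw [Units.val_inv_eq_inv_val, HeightOneSpectrum.ord_inv]
    exact (ha v hv).neg

theorem relIndex_evenUnits_evenOutside (hodd : Odd (Nat.card (ClassGroup (𝓞 k))))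
    (T : Finset (HeightOneSpectrum (𝓞 k))) (hT : ∀ v, v ∈ T ↔ ram F v = 2) :
    (evenUnits (𝓞 k) k).relIndex (evenOutside k F) = 2 ^ T.card := by
  classical
  let g : evenOutside k F →* (T → Multiplicative (ZMod 2)) := MonoidHom.mk'
    (fun a v => Multiplicative.ofAdd ((v.1.ord ((a : kˣ) : k) : ℤ) : ZMod 2)) fun a b => by
      funext v
      simp only [Subgroup.coe_mul, Units.val_mul, Pi.mul_apply]
      rw [ord_mul _ (Units.ne_zero _) (Units.ne_zero _), Int.cast_add, ofAdd_add]
  have hker : (evenUnits (𝓞 k) k).subgroupOf (evenOutside k F) = g.ker := by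
    ext a
    rw [MonoidHom.mem_ker, Subgroup.mem_subgroupOf]
    constructor
    · intro h
      funext v
      exact (ZMod.intCast_zmod_eq_zero_iff_dvd _ 2).2 (h v.1).two_dvd
    · intro h v
      rcases ram_eq_one_or_two (F := F) v with hv | hv
      · exact a.2 v hv
      · have := congrFun h ⟨v, (hT v).2 hv⟩
        exact even_iff_two_dvd.2 ((ZMod.intCast_zmod_eq_zero_iff_dvd _ 2).1 this)
  have hsurj : Function.Surjective g := by
    intro f
    obtain ⟨c, hc0, hc⟩ := HeightOneSpectrum.exists_ord_eq_mul (R := 𝓞 k) (K := k)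
      (fun v => if hv : v ∈ T then ((Multiplicative.toAdd (f ⟨v, hv⟩)).val : ℤ) else 0)
      (by
        refine Filter.eventually_cofinite.2 (T.finite_toSet.subset fun v hv => ?_)
        by_contra h
        exact hv (dif_neg h))
    refine ⟨⟨Units.mk0 c hc0, fun v hv => ?_⟩, ?_⟩
    · have : v ∉ T := by rw [hT]; omega
      rw [Units.val_mk0, hc, dif_neg this]
      simp
    · funext v
      change Multiplicative.ofAdd ((v.1.ord c : ℤ) : ZMod 2) = _
      rw [hc, dif_pos v.2]
      obtain ⟨m, hm⟩ := hodd
      rw [hm]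
      push_cast
      have h2 : (2 : ZMod 2) = 0 := rfl
      rw [h2, ZMod.natCast_zmod_val]
      simp
  rw [Subgroup.relIndex, hker, Subgroup.index_ker, MonoidHom.range_eq_top.2 hsurj,
    Subgroup.card_top, Nat.card_eq_fintype_card, Fintype.card_fun]
  simp

section

variable {σ : Gal(F/k)} (hσ : σ ≠ 1)

include hσ in
theorem relIndex_squares_comap :
    (squares kˣ).relIndex ((squares Fˣ).comap (Units.map (algebraMap k F : k →* F))) = 2 := by
  obtain ⟨r, hr0, hr⟩ := exists_anti hσ
  obtain ⟨d, hd⟩ := mem_range_of_fixed hσ (x := r ^ 2) (by rw [map_pow, hr, neg_sq])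
  have hd0 : d ≠ 0 := by
    rintro rfl
    rw [map_zero] at hd
    exact pow_ne_zero 2 hr0 hd.symm
  rw [Subgroup.relIndex_eq_two_iff_exists_notMem_and]
  refine ⟨Units.mk0 d hd0, ?_, ?_, fun b hb => ?_⟩
  · rw [Subgroup.mem_comap, mem_squares_units]
    exact ⟨r, hd⟩
  · rw [mem_squares_units]
    rintro ⟨b, hb⟩
    rw [Units.val_mk0] at hb
    rw [hb, map_pow, eq_comm, sq_eq_sq_iff_eq_or_eq_neg] at hd
    have h2 : σ r = r := by
      rcases hd with h | h <;> rw [h] <;> simp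
    rw [hr] at h2
    exact hr0 (by linear_combination (-1/2 : F) * h2)
  · rw [Subgroup.mem_comap, mem_squares_units] at hb
    obtain ⟨x, hx⟩ := hb
    rcases square_of_base hσ hr0 hr hd.symm hx with ⟨c, hc⟩ | ⟨c, hc⟩
    · exact Or.inr (mem_squares_units.2 ⟨c, hc⟩)
    · refine Or.inl (mem_squares_units.2 ⟨d * c, ?_⟩)
      rw [Units.val_mul, hc, Units.val_mk0]
      ring

theorem comap_squares_le :
    (squares Fˣ).comap (Units.map (algebraMap k F : k →* F)) ≤ evenOutside k F := by
  intro a ha v hv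
  rw [Subgroup.mem_comap, mem_squares_units] at ha
  obtain ⟨x, hx⟩ := ha
  obtain ⟨w, hw⟩ := exists_over (F := F) v
  have h := ord_algebraMap v w (a : k)
  change algebraMap k F a = _ at hx
  rw [hx, ord_pow, hv, Nat.cast_one, one_mul] at h
  rw [← h]
  exact even_two_mul _

theorem map_evenOutside_le :
    (evenOutside k F).map (Units.map (algebraMap k F : k →* F)) ≤ evenUnits (𝓞 F) F := by
  rintro _ ⟨a, ha, rfl⟩ w
  obtain ⟨v, hv⟩ := exists_under (k := k) w
  change Even (w.ord (algebraMap k F a))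
  rw [ord_algebraMap v w]
  rcases ram_eq_one_or_two (F := F) v with h | h
  · exact (ha v h).mul_left _
  · rw [h]; exact even_two_mul _

include hσ in
theorem comap_norm_inf :
    (squares kˣ).comap (Units.map (Algebra.norm k : F →* k)) ⊓ evenUnits (𝓞 F) F =
      (evenOutside k F).map (Units.map (algebraMap k F : k →* F)) ⊔ squares Fˣ := by
  apply le_antisymm
  · rintro a ⟨ha, hav⟩
    obtain ⟨y, hy⟩ := mem_squares_units.1 (Subgroup.mem_comap.1 ha)
    change Algebra.norm k (a : F) = y ^ 2 at hy
    have ha0 := a.ne_zero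
    have hn := algebraMap_norm hσ (a : F)
    rw [hy, map_pow] at hn
    have hy0 : y ≠ 0 := by
      rintro rfl
      rw [zero_pow two_ne_zero] at hy
      exact ha0 (Algebra.norm_eq_zero_iff.1 hy)
    have hy0' : algebraMap k F y ≠ 0 := by simpa using hy0
    obtain ⟨z, hz0, hz⟩ := hilbert90 hσ (x := a / algebraMap k F y) (by
      rw [map_div₀, AlgEquiv.commutes]
      field_simp
      exact hn.symm)
    have hσz : σ z ≠ 0 := by simpa using hz0
    have hNz := algebraMap_norm hσ z
    have hNz0 : Algebra.norm k z ≠ 0 := by simpa using hz0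
    have key : (a : F) = algebraMap k F (y / Algebra.norm k z) * z ^ 2 := by
      rw [map_div₀, hNz]
      field_simp
      field_simp at hz
      linear_combination hz
    rw [Subgroup.mem_sup]
    refine ⟨_, ⟨Units.mk0 _ (div_ne_zero hy0 hNz0), fun v hv => ?_, rfl⟩, _,
      ⟨Units.mk0 z hz0, rfl⟩, Units.ext key.symm⟩
    obtain ⟨w, hw⟩ := exists_over (F := F) v
    have h1 := hav w
    rw [key, ord_mul w (by simp [hy0, hz0]) (pow_ne_zero _ hz0), ord_algebraMap v w, hv, ord_pow]
      at h1
    rw [Units.val_mk0]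
    have := Int.even_add.1 h1
    simpa using this
  · refine sup_le (le_inf ?_ map_evenOutside_le)
      (le_inf ?_ (HeightOneSpectrum.squares_le_evenUnits (𝓞 _) _))
    · rintro _ ⟨a, ha, rfl⟩
      refine mem_squares_units.2 ⟨a, ?_⟩
      change Algebra.norm k (algebraMap k F a) = _
      rw [Algebra.norm_algebraMap, Algebra.IsQuadraticExtension.finrank_eq_two]
    · rintro _ ⟨a, rfl⟩
      exact ⟨Units.map (Algebra.norm k : F →* k) a, by simp⟩

include hσ in
theorem ram_mul_ord_norm (v : HeightOneSpectrum (𝓞 k)) (w : HeightOneSpectrum (𝓞 F))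
    [w.asIdeal.LiesOver v.asIdeal] {x : F} (hx : x ≠ 0) :
    ram F v * v.ord (Algebra.norm k x) = w.ord x + (conj σ w).ord x := by
  have := conj_liesOver σ v w
  have hσx : σ x ≠ 0 := by simpa using hx
  rw [← ord_algebraMap v (conj σ w), algebraMap_norm hσ, ord_mul _ hx hσx, ord_conj, add_comm]

include hσ in
theorem map_norm_sup (hodd : Odd (Nat.card (ClassGroup (𝓞 k)))) :
    (evenUnits (𝓞 F) F).map (Units.map (Algebra.norm k : F →* k)) ⊔ squares kˣ =
      (normUnits k F).map (Units.map (algebraMap (𝓞 k) k : 𝓞 k →* k)) ⊔ squares kˣ := by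
  apply le_antisymm
  · refine sup_le ?_ le_sup_right
    rintro _ ⟨a, ha, rfl⟩
    have hN0 : Algebra.norm k (a : F) ≠ 0 := by simp
    obtain ⟨u, c, hc0, huc⟩ := HeightOneSpectrum.exists_unit_mul_sq hodd hN0 fun v => by
      obtain ⟨w, hw⟩ := exists_over (F := F) v
      have h1 := ram_mul_ord_norm hσ v w a.ne_zero
      rcases ram_eq_one_or_two (F := F) v with h | h
      · rw [h, Nat.cast_one, one_mul] at h1
        rw [h1]
        exact (ha w).add (ha _)
      · rw [h, conj_eq_of_ram σ v w h] at h1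
        have : v.ord (Algebra.norm k (a : F)) = w.ord (a : F) := by push_cast at h1; omega
        rw [this]
        exact ha w
    rw [Subgroup.mem_sup]
    refine ⟨_, ⟨u, mem_normUnits.2 ⟨a * algebraMap k F c⁻¹, ?_⟩, rfl⟩, _,
      ⟨Units.mk0 c hc0, rfl⟩, Units.ext huc.symm⟩
    rw [map_mul, Algebra.norm_algebraMap, Algebra.IsQuadraticExtension.finrank_eq_two,
      huc]
    field_simp
  · refine sup_le ?_ le_sup_right
    rintro _ ⟨u, hu, rfl⟩
    obtain ⟨x, hx⟩ := mem_normUnits.1 hu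
    have hx0 : x ≠ 0 := by
      rintro rfl
      rw [Algebra.norm_zero] at hx
      exact u.ne_zero (FaithfulSMul.algebraMap_injective (𝓞 k) k (by rw [← hx, map_zero]))
    choose w hw using exists_over (k := k) (F := F)
    have hwinj : Function.Injective w := fun v v' h => by
      have h1 := (hw v).over
      have h2 := (hw v').over
      rw [h, ← h2] at h1
      exact HeightOneSpectrum.ext h1
    have hsum : ∀ v, (w v).ord x + (conj σ (w v)).ord x = 0 := fun v => by
      have := hw v
      rw [← ram_mul_ord_norm hσ v (w v) hx0, hx, HeightOneSpectrum.ord_unit, mul_zero]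
    have hram : ∀ v, ram F v = 2 → (w v).ord x = 0 := fun v hv => by
      have := hw v
      have h1 := hsum v
      rw [conj_eq_of_ram σ v (w v) hv] at h1
      omega
    obtain ⟨c, hc0, hc⟩ := HeightOneSpectrum.exists_ord_eq_mul (R := 𝓞 k) (K := k)
      (fun v => (w v).ord x)
      (hwinj.tendsto_cofinite.eventually (HeightOneSpectrum.ord_eventually_zero x))
    have hc0' : algebraMap k F c ≠ 0 := by simpa using hc0
    obtain ⟨m, hm⟩ := hodd
    rw [Subgroup.mem_sup]
    refine ⟨_, ⟨Units.mk0 (x * algebraMap k F c) (mul_ne_zero hx0 hc0'), fun w' => ?_, rfl⟩, _,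
      ⟨(Units.mk0 c hc0)⁻¹, rfl⟩, Units.ext ?_⟩
    · obtain ⟨v, hv⟩ := exists_under (k := k) w'
      have := hw v
      have h1 := hsum v
      rw [Units.val_mk0, ord_mul _ hx0 hc0', ord_algebraMap v w', hc, hm]
      have h2 : w'.ord x = (w v).ord x ∨ w'.ord x = -(w v).ord x := by
        rcases eq_or_eq_conj hσ v (w v) w' with h | h <;> rw [h]
        · exact Or.inl rfl
        · exact Or.inr (by omega)
      rcases ram_eq_one_or_two (F := F) v with h | h
      · rw [h]
        rcases h2 with h2 | h2 <;> rw [h2]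
        · exact ⟨(w v).ord x * (m + 1), by push_cast; ring⟩
        · exact ⟨(w v).ord x * m, by push_cast; ring⟩
      · rw [hram v h] at h2 ⊢
        simp_all
    · simp only [Units.coe_map, Units.val_mul, Units.val_mk0, map_mul, hx,
        Algebra.norm_algebraMap, Algebra.IsQuadraticExtension.finrank_eq_two, powMonoidHom_apply,
        Units.val_pow_eq_pow_val, Units.val_inv_eq_inv_val, MonoidHom.coe_coe]
      field_simp

include hσ in
/-- The ambiguous class number formula over a base field of odd class number, in the form of a
formula for the number of ideal classes of order dividing two. -/
theorem card_twoTorsion_mul (hodd : Odd (Nat.card (ClassGroup (𝓞 k))))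
    (T : Finset (HeightOneSpectrum (𝓞 k))) (hT : ∀ v, v ∈ T ↔ ram F v = 2) :
    2 * ((squares (𝓞 F)ˣ).index * Nat.card {x : ClassGroup (𝓞 F) // x ^ 2 = 1}) =
      (squares (𝓞 k)ˣ).index * 2 ^ T.card * (squares (𝓞 k)ˣ).relIndex (normUnits k F) := by
  set ι := Units.map (algebraMap k F : k →* F)
  have hk : Nat.card {x : ClassGroup (𝓞 k) // x ^ 2 = 1} = 1 := by
    rw [Nat.card_eq_one_iff_unique]
    refine ⟨⟨fun x y => Subtype.ext ?_⟩, ⟨⟨1, one_pow 2⟩⟩⟩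
    have : ∀ x : ClassGroup (𝓞 k), x ^ 2 = 1 → x = 1 := fun x hx => by
      obtain ⟨m, hm⟩ := hodd
      have h1 : x ^ Nat.card (ClassGroup (𝓞 k)) = 1 := pow_card_eq_one'
      rwa [hm, pow_succ, pow_mul, hx, one_pow, one_mul] at h1
    rw [this x x.2, this y y.2]
  have h1 : (squares kˣ).relIndex (evenOutside k F) = (squares (𝓞 k)ˣ).index * 2 ^ T.card := by
    rw [← Subgroup.relIndex_mul_relIndex (squares kˣ) (evenUnits (𝓞 k) k) (evenOutside k F)
      (HeightOneSpectrum.squares_le_evenUnits (𝓞 _) _) (fun a ha v _ => ha v),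
      HeightOneSpectrum.relIndex_squares_evenUnits, hk, mul_one,
      relIndex_evenUnits_evenOutside hodd T hT]
  have h2 : (squares kˣ).relIndex (evenOutside k F) =
      2 * ((squares Fˣ).comap ι).relIndex (evenOutside k F) := by
    rw [← relIndex_squares_comap hσ, Subgroup.relIndex_mul_relIndex _ _ _ _ comap_squares_le]
    rintro _ ⟨a, rfl⟩
    exact ⟨ι a, by simp [ι]⟩
  have h3 : (squares Fˣ).relIndex (evenUnits (𝓞 F) F) =
      ((squares Fˣ).comap ι).relIndex (evenOutside k F) *
        (squares (𝓞 k)ˣ).relIndex (normUnits k F) := by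
    rw [← Subgroup.relIndex_mul_relIndex (squares Fˣ) ((evenOutside k F).map ι ⊔ squares Fˣ)
      (evenUnits (𝓞 F) F) le_sup_right
      (sup_le map_evenOutside_le (HeightOneSpectrum.squares_le_evenUnits (𝓞 _) _)),
      Subgroup.relIndex_sup_right, Subgroup.relIndex_comap _ ι, ← comap_norm_inf hσ,
      Subgroup.inf_relIndex_right, Subgroup.relIndex_comap,
      ← Subgroup.relIndex_sup_right _ (squares kˣ), map_norm_sup hσ hodd,
      Subgroup.relIndex_sup_right, ← Subgroup.relIndex_comap _ (Units.map (algebraMap (𝓞 k) k : 𝓞 k →* k)),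
      HeightOneSpectrum.comap_squares (𝓞 k) k]
  rw [← HeightOneSpectrum.relIndex_squares_evenUnits (𝓞 F) F, h3, ← h1, h2]
  ring

end

end QuadExt

namespace QuadExt

theorem index_squares_eq_card (G : Type*) [CommGroup G] [Finite G] :
    (squares G).index = Nat.card {x : G // x ^ 2 = 1} := by
  have h1 := (squares G).index_mul_card
  have h2 := (powMonoidHom 2 : G →* G).ker.index_mul_card
  rw [Subgroup.index_ker] at h2
  have h3 : Nat.card (squares G) ≠ 0 := Nat.card_pos.ne'
  have h4 : Nat.card (powMonoidHom 2 : G →* G).ker = Nat.card {x : G // x ^ 2 = 1} :=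
    Nat.card_congr (Equiv.subtypeEquivRight fun x => by simp [MonoidHom.mem_ker])
  rw [← h4]
  apply Nat.eq_of_mul_eq_mul_right (Nat.pos_of_ne_zero h3)
  rw [h1, ← h2, mul_comm]

variable {k F : Type*} [Field k] [NumberField k] [Field F] [NumberField F] [Algebra k F]
  [Algebra.IsQuadraticExtension k F] {σ : Gal(F/k)} (hσ : σ ≠ 1)

/-- `I` is a fractional ideal with `I * σ I = (α)`. -/
def IsIdealNorm (σ : Gal(F/k)) (α : k) (I : (FractionalIdeal (𝓞 F)⁰ F)ˣ) : Prop :=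
  ∀ (v : HeightOneSpectrum (𝓞 k)) (w : HeightOneSpectrum (𝓞 F)), w.asIdeal.LiesOver v.asIdeal →
    ram F v * v.ord α = FractionalIdeal.count F w (I : FractionalIdeal (𝓞 F)⁰ F) +
      FractionalIdeal.count F (conj σ w) (I : FractionalIdeal (𝓞 F)⁰ F)

theorem IsIdealNorm.mul {α β : k} (hα : α ≠ 0) (hβ : β ≠ 0) {I J : (FractionalIdeal (𝓞 F)⁰ F)ˣ}
    (hI : IsIdealNorm σ α I) (hJ : IsIdealNorm σ β J) : IsIdealNorm σ (α * β) (I * J) := by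
  intro v w hw
  rw [ord_mul v hα hβ, mul_add, hI v w hw, hJ v w hw, Units.val_mul,
    FractionalIdeal.count_mul _ _ I.ne_zero J.ne_zero,
    FractionalIdeal.count_mul _ _ I.ne_zero J.ne_zero]
  ring

include hσ in
theorem exists_isIdealNorm {α : k}
    (h : ∀ v : HeightOneSpectrum (𝓞 k), Odd (v.ord α) →
      ∃ z : F, z ≠ 0 ∧ Odd (v.ord (Algebra.norm k z))) :
    ∃ I : (FractionalIdeal (𝓞 F)⁰ F)ˣ, IsIdealNorm σ α I := by
  have h' : ∀ v : HeightOneSpectrum (𝓞 k), ∃ z : F, z ≠ 0 ∧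
      Even (v.ord α - v.ord (Algebra.norm k z)) ∧ (v.ord α = 0 → z = 1) := fun v => by
    by_cases hv : Odd (v.ord α)
    · obtain ⟨z, hz0, hz⟩ := h v hv
      refine ⟨z, hz0, hv.sub_odd hz, fun h0 => ?_⟩
      rw [h0] at hv
      simp at hv
    · refine ⟨1, one_ne_zero, ?_, fun _ => rfl⟩
      simpa using hv
  choose z hz0 hz hz1 using h'
  choose u hu using exists_under (k := k) (F := F)
  obtain ⟨I, hI⟩ := HeightOneSpectrum.exists_fractionalIdeal_count (R := 𝓞 F) (K := F)
    (fun w => w.ord (z (u w)) +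
      ram F (u w) * (((u w).ord α - (u w).ord (Algebra.norm k (z (u w)))) / 2))
    ((HeightOneSpectrum.ord_eventually_zero (algebraMap k F α)).mono fun w hw => by
      have := hu w
      rw [ord_algebraMap (u w) w] at hw
      have h1 : (u w).ord α = 0 := by
        rcases ram_eq_one_or_two (F := F) (u w) with h2 | h2 <;> rw [h2] at hw <;> simpa using hw
      rw [hz1 _ h1, h1]
      simp)
  refine ⟨I, fun v w hw => ?_⟩
  have huv : ∀ w : HeightOneSpectrum (𝓞 F), w.asIdeal.LiesOver v.asIdeal → u w = v := fun w hw => by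
    apply HeightOneSpectrum.ext
    rw [(hu w).over, hw.over]
  rw [hI, hI, huv w hw, huv _ (conj_liesOver σ v w)]
  have h1 := ram_mul_ord_norm hσ v w (hz0 v)
  obtain ⟨m, hm⟩ := (hz v).two_dvd
  rw [hm, Int.mul_ediv_cancel_left _ two_ne_zero]
  linear_combination h1 + (ram F v : ℤ) * hm

include hσ in
theorem exists_eq_unit_mul_norm (hodd : Odd (Nat.card (ClassGroup (𝓞 k)))) {α : k} (hα : α ≠ 0)
    {I : (FractionalIdeal (𝓞 F)⁰ F)ˣ} (hI : IsIdealNorm σ α I)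
    (hsq : ClassGroup.mk F I ∈ squares (ClassGroup (𝓞 F))) :
    ∃ (u : (𝓞 k)ˣ) (x : F), α = algebraMap (𝓞 k) k u * Algebra.norm k x := by
  obtain ⟨X, hX⟩ := hsq
  obtain ⟨B, rfl⟩ : ∃ I, ClassGroup.mk F I = X :=
    ClassGroup.induction F (P := fun x => ∃ I, ClassGroup.mk F I = x) (fun I => ⟨I, rfl⟩) X
  have h1 : ClassGroup.mk F (I * (B ^ 2)⁻¹) = 1 := by
    rw [map_mul, map_inv, map_pow, ← hX]
    simp
  rw [ClassGroup.mk_eq_one_iff, FractionalIdeal.isPrincipal_iff] at h1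
  obtain ⟨y, hy⟩ := h1
  have hy0 : y ≠ 0 := by
    rintro rfl
    rw [FractionalIdeal.spanSingleton_zero] at hy
    exact (I * (B ^ 2)⁻¹).ne_zero hy
  have hcount : ∀ w : HeightOneSpectrum (𝓞 F),
      FractionalIdeal.count F w (I : FractionalIdeal (𝓞 F)⁰ F) =
        w.ord y + 2 * FractionalIdeal.count F w (B : FractionalIdeal (𝓞 F)⁰ F) := fun w => by
    rw [← HeightOneSpectrum.count_spanSingleton w hy0, ← hy, Units.val_mul,
      FractionalIdeal.count_mul _ _ I.ne_zero (Units.ne_zero _), Units.val_inv_eq_inv_val,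
      FractionalIdeal.count_inv, Units.val_pow_eq_pow_val, FractionalIdeal.count_pow]
    push_cast
    ring
  have hN0 : Algebra.norm k y ≠ 0 := by simpa using hy0
  obtain ⟨u, c, -, hc⟩ := HeightOneSpectrum.exists_unit_mul_sq hodd (div_ne_zero hα hN0) fun v => by
    obtain ⟨w, hw⟩ := exists_over (F := F) v
    have h2 := ram_mul_ord_norm hσ v w hy0
    have h3 := hI v w hw
    rw [hcount, hcount] at h3
    rw [HeightOneSpectrum.ord_div v hα hN0]
    rcases ram_eq_one_or_two (F := F) v with h | h
    · rw [h] at h2 h3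
      exact ⟨FractionalIdeal.count F w (B : FractionalIdeal (𝓞 F)⁰ F) +
        FractionalIdeal.count F (conj σ w) (B : FractionalIdeal (𝓞 F)⁰ F), by
          push_cast at h2 h3; linarith⟩
    · rw [h] at h2 h3
      rw [conj_eq_of_ram σ v w h] at h2 h3
      exact ⟨FractionalIdeal.count F w (B : FractionalIdeal (𝓞 F)⁰ F), by
          push_cast at h2 h3; linarith⟩
  refine ⟨u, algebraMap k F c * y, ?_⟩
  rw [map_mul, Algebra.norm_algebraMap, Algebra.IsQuadraticExtension.finrank_eq_two, ← mul_assoc,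
    ← hc, div_mul_cancel₀ _ hN0]

include hσ in
theorem exists_eq_unit_mul_norm_of_card_eq_one (hodd : Odd (Nat.card (ClassGroup (𝓞 k))))
    (hF : Nat.card {x : ClassGroup (𝓞 F) // x ^ 2 = 1} = 1) {α : k} (hα : α ≠ 0)
    (h : ∀ v : HeightOneSpectrum (𝓞 k), Odd (v.ord α) →
      ∃ z : F, z ≠ 0 ∧ Odd (v.ord (Algebra.norm k z))) :
    ∃ (u : (𝓞 k)ˣ) (x : F), α = algebraMap (𝓞 k) k u * Algebra.norm k x := by
  obtain ⟨I, hI⟩ := exists_isIdealNorm hσ h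
  rw [← index_squares_eq_card, Subgroup.index_eq_one] at hF
  exact exists_eq_unit_mul_norm hσ hodd hα hI (by rw [hF]; trivial)

include hσ in
theorem exists_eq_unit_mul_norm_of_card_le_two (hodd : Odd (Nat.card (ClassGroup (𝓞 k))))
    (hF : Nat.card {x : ClassGroup (𝓞 F) // x ^ 2 = 1} ≤ 2) {α β : k} (hα : α ≠ 0) (hβ : β ≠ 0)
    (h : ∀ v : HeightOneSpectrum (𝓞 k), Odd (v.ord α) →
      ∃ z : F, z ≠ 0 ∧ Odd (v.ord (Algebra.norm k z)))
    (h' : ∀ v : HeightOneSpectrum (𝓞 k), Odd (v.ord β) →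
      ∃ z : F, z ≠ 0 ∧ Odd (v.ord (Algebra.norm k z))) :
    (∃ (u : (𝓞 k)ˣ) (x : F), α = algebraMap (𝓞 k) k u * Algebra.norm k x) ∨
    (∃ (u : (𝓞 k)ˣ) (x : F), β = algebraMap (𝓞 k) k u * Algebra.norm k x) ∨
    (∃ (u : (𝓞 k)ˣ) (x : F), α * β = algebraMap (𝓞 k) k u * Algebra.norm k x) := by
  obtain ⟨I, hI⟩ := exists_isIdealNorm hσ h
  obtain ⟨J, hJ⟩ := exists_isIdealNorm hσ h'
  rw [← index_squares_eq_card] at hF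
  have hpos : (squares (ClassGroup (𝓞 F))).index ≠ 0 := Subgroup.index_ne_zero_of_finite
  by_cases h1 : ClassGroup.mk F I ∈ squares (ClassGroup (𝓞 F))
  · exact Or.inl (exists_eq_unit_mul_norm hσ hodd hα hI h1)
  by_cases h2 : ClassGroup.mk F J ∈ squares (ClassGroup (𝓞 F))
  · exact Or.inr (Or.inl (exists_eq_unit_mul_norm hσ hodd hβ hJ h2))
  have hi : (squares (ClassGroup (𝓞 F))).index = 2 := by
    have : (squares (ClassGroup (𝓞 F))).index ≠ 1 := fun h => by
      rw [Subgroup.index_eq_one] at h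
      exact h1 (by rw [h]; trivial)
    omega
  refine Or.inr (Or.inr (exists_eq_unit_mul_norm hσ hodd (mul_ne_zero hα hβ) (hI.mul hα hβ hJ) ?_))
  rw [map_mul, Subgroup.mul_mem_iff_of_index_two hi]
  tauto

end QuadExt

end

section

open IsDedekindDomain nonZeroDivisors NumberField Pointwise
open HeightOneSpectrum (squares evenUnits mem_squares_units ord_mul ord_pow)

namespace NumberField.Units

theorem card_sq_eq_one (K : Type*) [Field K] [NumberField K] :
    Nat.card {x : torsion K // x ^ 2 = 1} = 2 := by
  rw [Nat.card_eq_two_iff]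
  have hneg : (-1 : (𝓞 K)ˣ) ∈ torsion K :=
    (CommGroup.mem_torsion _).2 (isOfFinOrder_iff_pow_eq_one.2 ⟨2, two_pos, by simp⟩)
  refine ⟨⟨1, one_pow 2⟩, ⟨⟨-1, hneg⟩, by ext; simp⟩, ?_, ?_⟩
  · intro h
    have h2 : ((1 : (𝓞 K)ˣ) : K) = ((-1 : (𝓞 K)ˣ) : K) := by
      have : (1 : (𝓞 K)ˣ) = -1 := congrArg (fun x : {x : torsion K // x ^ 2 = 1} => ((x : torsion K) : (𝓞 K)ˣ)) h
      exact congrArg (fun x : (𝓞 K)ˣ => ((x : 𝓞 K) : K)) this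
    rw [coe_one, coe_neg_one] at h2
    norm_num at h2
  · refine Set.eq_univ_of_forall fun x => ?_
    have h1 : ((x : torsion K) : (𝓞 K)ˣ) ^ 2 = 1 := congrArg Subtype.val x.2
    have h2 : (((x : torsion K) : (𝓞 K)ˣ) : 𝓞 K) ^ 2 = 1 := by
      rw [← Units.val_pow_eq_pow_val, h1, Units.val_one]
    rcases sq_eq_one_iff.1 h2 with h | h
    · left
      exact Subtype.ext (Subtype.ext (Units.ext h))
    · right
      exact Subtype.ext (Subtype.ext (Units.ext h))

theorem index_squares (K : Type*) [Field K] [NumberField K] :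
    (squares (𝓞 K)ˣ).index = 2 ^ (rank K + 1) := by
  choose c hc huniq using exist_unique_eq_mul_prod K
  have hprod : ∀ e f : Fin (rank K) → ℤ, ∏ i, fundSystem K i ^ (e i + f i) =
      (∏ i, fundSystem K i ^ e i) * ∏ i, fundSystem K i ^ f i := fun e f => by
    simp_rw [zpow_add, Finset.prod_mul_distrib]
  let co : (𝓞 K)ˣ → Fin (rank K) → ℤ := fun x => (c x).2
  have hco' : ∀ (x : (𝓞 K)ˣ) (ζ : torsion K) (e : Fin (rank K) → ℤ),
      x = ζ * ∏ i, fundSystem K i ^ e i → co x = e :=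
    fun x ζ e h => (congrArg Prod.snd (huniq x (ζ, e) h)).symm
  have hco : ∀ x y, co (x * y) = co x + co y := fun x y =>
    hco' _ ((c x).1 * (c y).1) _ <| by
      simp only [Pi.add_apply, hprod, co]
      conv_lhs => rw [hc x, hc y]
      rw [Subgroup.coe_mul]
      exact mul_mul_mul_comm _ _ _ _
  let g : (𝓞 K)ˣ →* (Fin (rank K) → Multiplicative (ZMod 2)) := MonoidHom.mk'
    (fun x i => Multiplicative.ofAdd ((co x i : ℤ) : ZMod 2)) fun x y => by
      funext i
      simp only [hco, Pi.add_apply, Int.cast_add, ofAdd_add, Pi.mul_apply]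
  have hsurj : Function.Surjective g := fun f => by
    refine ⟨∏ i, fundSystem K i ^ ((Multiplicative.toAdd (f i)).val : ℤ), funext fun i => ?_⟩
    change Multiplicative.ofAdd ((co _ i : ℤ) : ZMod 2) = f i
    rw [hco' _ 1 (fun i => ((Multiplicative.toAdd (f i)).val : ℤ)) (one_mul _).symm]
    simp
  have hker : g.ker = squares (𝓞 K)ˣ ⊔ torsion K := by
    apply le_antisymm
    · intro x hx
      have heven : ∀ i, Even (co x i) := fun i => by
        have := congrFun hx i
        exact even_iff_two_dvd.2 ((ZMod.intCast_zmod_eq_zero_iff_dvd _ 2).1 this)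
      choose e he using heven
      rw [Subgroup.mem_sup]
      refine ⟨_, ⟨∏ i, fundSystem K i ^ e i, rfl⟩, (c x).1, (c x).1.2, ?_⟩
      conv_rhs => rw [hc x, mul_comm]
      congr 1
      rw [powMonoidHom_apply, ← Finset.prod_pow]
      refine Finset.prod_congr rfl fun i _ => ?_
      rw [show (c x).2 i = e i + e i from he i, zpow_add, sq]
    · refine sup_le ?_ ?_
      · rintro _ ⟨x, rfl⟩
        rw [MonoidHom.mem_ker, powMonoidHom_apply, map_pow]
        funext i
        have : ∀ y : Multiplicative (ZMod 2), y ^ 2 = 1 := by decide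
        exact this _
      · intro x hx
        funext i
        change Multiplicative.ofAdd ((co _ i : ℤ) : ZMod 2) = _
        rw [hco' x ⟨x, hx⟩ 0 (by simp)]
        simp
  have h1 : (squares (𝓞 K)ˣ ⊔ torsion K).index = 2 ^ rank K := by
    rw [← hker, Subgroup.index_ker, MonoidHom.range_eq_top.2 hsurj, Subgroup.card_top,
      Nat.card_eq_fintype_card, Fintype.card_fun]
    simp
  have h2 : (squares (𝓞 K)ˣ).subgroupOf (torsion K) = squares (torsion K) := by
    ext x
    rw [Subgroup.mem_subgroupOf]
    constructor
    · rintro ⟨y, hy⟩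
      have hyt : y ∈ torsion K := by
        have : IsOfFinOrder (y ^ 2) := by
          rw [powMonoidHom_apply] at hy
          rw [hy]
          exact (CommGroup.mem_torsion _).1 x.2
        exact (CommGroup.mem_torsion _).2 (this.of_pow two_ne_zero)
      exact ⟨⟨y, hyt⟩, Subtype.ext hy⟩
    · rintro ⟨y, rfl⟩
      exact ⟨y, rfl⟩
  rw [← Subgroup.relIndex_mul_index (le_sup_left : squares (𝓞 K)ˣ ≤ squares (𝓞 K)ˣ ⊔ torsion K), h1,
    sup_comm, Subgroup.relIndex_sup_right, Subgroup.relIndex, h2, QuadExt.index_squares_eq_card,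
    card_sq_eq_one, pow_succ']

end NumberField.Units

end

section

open IsDedekindDomain nonZeroDivisors NumberField Pointwise
open HeightOneSpectrum (squares evenUnits mem_squares_units ord_mul ord_pow)
set_option linter.unusedSectionVars false

namespace Rat.HeightOneSpectrum

theorem intCast_mem_iff (v : HeightOneSpectrum (𝓞 ℚ)) (m : ℤ) :
    (m : 𝓞 ℚ) ∈ v.asIdeal ↔ (natGenerator v : ℤ) ∣ m := by
  rw [← Ideal.mem_span_singleton, span_natGenerator]
  have := Ideal.apply_mem_of_equiv_iff (I := v.asIdeal) (f := IsIntegralClosure.intEquiv (𝓞 ℚ))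
    (x := (m : 𝓞 ℚ))
  rwa [map_intCast, Int.cast_id, iff_comm] at this

theorem ord_natGenerator (v : HeightOneSpectrum (𝓞 ℚ)) : v.ord (natGenerator v : ℚ) = 1 := by
  have hp := prime_natGenerator v
  have h0 : ((natGenerator v : ℤ) : 𝓞 ℚ) ≠ 0 := by exact_mod_cast hp.ne_zero
  have hspan : v.asIdeal = Ideal.span {((natGenerator v : ℤ) : 𝓞 ℚ)} := by
    refine le_antisymm (fun x hx => ?_) ?_
    · obtain ⟨m, rfl⟩ := (IsIntegralClosure.intEquiv (𝓞 ℚ)).symm.surjective x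
      rw [← Int.cast_id (n := m), map_intCast] at hx ⊢
      obtain ⟨c, hc⟩ := (intCast_mem_iff v m).1 hx
      rw [Ideal.mem_span_singleton, hc]
      exact ⟨c, by push_cast; rfl⟩
    · rw [Ideal.span_singleton_le_iff_mem]
      exact (intCast_mem_iff v _).2 dvd_rfl
  have h1 := (v.mem_pow_iff_ord (K := ℚ) h0 1)
  have h2 := (v.mem_pow_iff_ord (K := ℚ) h0 2)
  rw [pow_one] at h1
  have h3 : ((natGenerator v : ℤ) : 𝓞 ℚ) ∈ v.asIdeal := (intCast_mem_iff v _).2 dvd_rfl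
  have h4 : ((natGenerator v : ℤ) : 𝓞 ℚ) ∉ v.asIdeal ^ 2 := by
    rw [hspan, Ideal.span_singleton_pow, Ideal.mem_span_singleton, ← Int.cast_pow]
    rintro ⟨c, hc⟩
    obtain ⟨m, rfl⟩ := (IsIntegralClosure.intEquiv (𝓞 ℚ)).symm.surjective c
    rw [← Int.cast_id (n := m), map_intCast, ← Int.cast_mul] at hc
    have h5 : (natGenerator v : ℤ) = (natGenerator v : ℤ) ^ 2 * m := by exact_mod_cast hc
    have h6 := hp.two_le
    have h7 : (natGenerator v : ℤ) * m = 1 := by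
      have : (natGenerator v : ℤ) ≠ 0 := by exact_mod_cast hp.ne_zero
      apply mul_left_cancel₀ this
      linear_combination -h5
    have := Int.eq_one_or_neg_one_of_mul_eq_one h7
    omega
  rw [map_intCast, Int.cast_natCast] at h1 h2
  have := h1.1 h3
  have := mt h2.2 h4
  push_cast at *
  omega

end Rat.HeightOneSpectrum

namespace QuadExt

theorem exists_primes_mem {F : Type*} [Field F] [NumberField F] (w : HeightOneSpectrum (𝓞 F)) :
    ∃ p : ℕ, p.Prime ∧ ∀ m : ℤ, (m : 𝓞 F) ∈ w.asIdeal ↔ (p : ℤ) ∣ m := by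
  refine ⟨Rat.HeightOneSpectrum.natGenerator (w.under (𝓞 ℚ)),
    Rat.HeightOneSpectrum.prime_natGenerator _, fun m => ?_⟩
  rw [← Rat.HeightOneSpectrum.intCast_mem_iff, ← map_intCast (algebraMap (𝓞 ℚ) (𝓞 F))]
  rfl

end QuadExt

variable {k : Type*} [Field k] [NumberField k]

/-- `s` is a square root of a prime `l ≡ 1 (mod 8)`. -/
structure SqrtPrime (l : ℕ) (s : 𝓞 k) : Prop where
  prime : l.Prime
  mod : l % 8 = 1
  sq : s ^ 2 = l

/-- `v` lies above the rational prime `p`. -/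
def Above (v : HeightOneSpectrum (𝓞 k)) (p : ℕ) : Prop := ∀ m : ℤ, (m : 𝓞 k) ∈ v.asIdeal ↔ (p : ℤ) ∣ m

namespace Above

theorem exists_of_prime (v : HeightOneSpectrum (𝓞 k)) : ∃ p : ℕ, p.Prime ∧ Above v p :=
  QuadExt.exists_primes_mem v

theorem natCast {v : HeightOneSpectrum (𝓞 k)} {p : ℕ} (h : Above v p) (m : ℕ) :
    (m : 𝓞 k) ∈ v.asIdeal ↔ p ∣ m := by
  have := h m
  rw [Int.cast_natCast] at this
  rw [this, Int.natCast_dvd_natCast]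

theorem self_mem {v : HeightOneSpectrum (𝓞 k)} {p : ℕ} (h : Above v p) : (p : 𝓞 k) ∈ v.asIdeal :=
  (h.natCast p).2 dvd_rfl

theorem of_mem {v : HeightOneSpectrum (𝓞 k)} {p : ℕ} (hp : p.Prime) (h : (p : 𝓞 k) ∈ v.asIdeal) :
    Above v p := by
  obtain ⟨q, hq, hv⟩ := exists_of_prime v
  rwa [(Nat.prime_dvd_prime_iff_eq hq hp).1 ((hv.natCast p).1 h)] at hv

theorem unique {v : HeightOneSpectrum (𝓞 k)} {p q : ℕ} (h : Above v p) (h' : Above v q) : p = q :=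
  Nat.dvd_antisymm ((h.natCast q).1 h'.self_mem) ((h'.natCast p).1 h.self_mem)

theorem liesOver {v : HeightOneSpectrum (𝓞 k)} {p : ℕ} (h : Above v p) (w : HeightOneSpectrum (𝓞 ℚ))
    (hw : Rat.HeightOneSpectrum.natGenerator w = p) : v.asIdeal.LiesOver w.asIdeal := by
  have : w = v.under (𝓞 ℚ) := by
    apply Rat.HeightOneSpectrum.primesEquiv.injective
    apply Subtype.ext
    change Rat.HeightOneSpectrum.natGenerator w = Rat.HeightOneSpectrum.natGenerator (v.under (𝓞 ℚ))
    rw [hw]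
    apply h.unique
    intro m
    rw [← Rat.HeightOneSpectrum.intCast_mem_iff, ← map_intCast (algebraMap (𝓞 ℚ) (𝓞 k))]
    rfl
  rw [this]
  exact ⟨rfl⟩

theorem exists_rat {p : ℕ} (hp : p.Prime) :
    ∃ w : HeightOneSpectrum (𝓞 ℚ), Rat.HeightOneSpectrum.natGenerator w = p :=
  ⟨Rat.HeightOneSpectrum.primesEquiv.symm ⟨p, hp⟩,
    congrArg Subtype.val (Rat.HeightOneSpectrum.primesEquiv.apply_symm_apply ⟨p, hp⟩)⟩

end Above

open QuadExt

theorem QuadExt.exists_gal {k F : Type*} [Field k] [NumberField k] [Field F] [NumberField F]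
    [Algebra k F] [Algebra.IsQuadraticExtension k F] : ∃ σ : Gal(F/k), σ ≠ 1 := by
  have : Nontrivial Gal(F/k) := by
    rw [← Finite.one_lt_card_iff_nontrivial, card_gal]
    norm_num
  exact exists_ne 1

theorem QuadExt.ord_rat [Algebra.IsQuadraticExtension ℚ k] {v : HeightOneSpectrum (𝓞 k)} {p : ℕ}
    (hv : Above v p) {w : HeightOneSpectrum (𝓞 ℚ)}
    (hw : Rat.HeightOneSpectrum.natGenerator w = p) : v.ord (p : k) = ram k w := by
  have := hv.liesOver w hw
  have h := ord_algebraMap w v (p : ℚ)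
  have h2 := Rat.HeightOneSpectrum.ord_natGenerator w
  rw [hw] at h2
  rw [h2, mul_one, map_natCast] at h
  exact h

theorem RingOfIntegers.exists_int_of_eq_rat {F : Type*} [Field F] [NumberField F] (x : 𝓞 F) (a : ℚ)
    (h : (x : F) = a) : ∃ m : ℤ, x = m := by
  have h1 : IsIntegral ℤ (algebraMap ℚ F a) := by
    rw [eq_ratCast, ← h]
    exact x.2
  obtain ⟨m, hm⟩ := IsIntegrallyClosed.isIntegral_iff.1
    ((isIntegral_algebraMap_iff (algebraMap ℚ F).injective).1 h1)
  refine ⟨m, RingOfIntegers.ext ?_⟩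
  rw [h, ← hm]
  simp

namespace SqrtPrime

variable [Algebra.IsQuadraticExtension ℚ k] {l : ℕ} {s : 𝓞 k} (h : SqrtPrime l s)
  {τ : Gal(k/ℚ)} (hτ : τ ≠ 1)
include h

theorem sq' : (s : k) ^ 2 = l := by
  have := congrArg (fun x : 𝓞 k => (x : k)) h.sq
  simpa using this

theorem s_ne_zero : (s : k) ≠ 0 := by
  intro h0
  have := h.sq'
  rw [h0] at this
  have h2 : l = 0 := by exact_mod_cast (by simpa using this.symm : (l : k) = 0)
  exact h.prime.ne_zero h2

theorem s_ne_rat (a : ℚ) : (s : k) ≠ a := by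
  intro ha
  have h1 := h.sq'
  rw [ha] at h1
  have h2 : a ^ 2 = l := by exact_mod_cast h1
  have h3 : IsSquare ((l : ℕ) : ℚ) := ⟨a, by rw [← h2, pow_two]⟩
  rw [Rat.isSquare_natCast_iff] at h3
  exact h.prime.prime.not_isSquare h3

include hτ in
theorem conj_s : τ (s : k) = -s := by
  have h1 : (τ (s : k)) ^ 2 = (s : k) ^ 2 := by rw [← map_pow, h.sq', map_natCast]
  rcases sq_eq_sq_iff_eq_or_eq_neg.1 h1 with h2 | h2
  · obtain ⟨a, ha⟩ := mem_range_of_fixed hτ h2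
    exact absurd ha.symm (h.s_ne_rat a)
  · exact h2

include hτ in
theorem conj_s' : τ • s = -s := RingOfIntegers.ext (h.conj_s hτ)

include hτ in
theorem smul_mem_conj (v : HeightOneSpectrum (𝓞 k)) (x : 𝓞 k) :
    τ • x ∈ (conj τ v).asIdeal ↔ x ∈ v.asIdeal :=
  Ideal.smul_mem_pointwise_smul_iff

include hτ in
/-- Integrality in coordinates. -/
theorem exists_coords (x : 𝓞 k) : ∃ A B : ℤ, 2 * x = A + B * s ∧ (2 : ℤ) ∣ A - B := by
  have hs := h.conj_s hτ
  obtain ⟨a, ha⟩ := mem_range_of_fixed hτ (x := (x : k) + τ x)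
    (by rw [map_add, gal_involutive hτ]; ring)
  obtain ⟨A, hA⟩ := RingOfIntegers.exists_int_of_eq_rat (x + τ • x) a ha.symm
  obtain ⟨b, hb⟩ := mem_range_of_fixed hτ (x := ((x : k) - τ x) * s)
    (by rw [map_mul, map_sub, gal_involutive hτ, hs]; ring)
  obtain ⟨R, hR⟩ := RingOfIntegers.exists_int_of_eq_rat ((x - τ • x) * s) b hb.symm
  obtain ⟨c, hc⟩ := mem_range_of_fixed hτ (x := ((x : k) - τ x) ^ 2)
    (by rw [map_pow, map_sub, gal_involutive hτ]; ring)
  obtain ⟨D, hD⟩ := RingOfIntegers.exists_int_of_eq_rat ((x - τ • x) ^ 2) c hc.symm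
  have hRD : R ^ 2 = l * D := by
    have : ((R ^ 2 : ℤ) : 𝓞 k) = ((l * D : ℤ) : 𝓞 k) := by
      push_cast
      rw [← hR, ← hD, mul_pow, h.sq]
      ring
    exact_mod_cast this
  have hl0 : (l : ℤ) ≠ 0 := by exact_mod_cast h.prime.ne_zero
  obtain ⟨B, hB⟩ : (l : ℤ) ∣ R :=
    Prime.dvd_of_dvd_pow (Nat.prime_iff_prime_int.1 h.prime) (n := 2) ⟨D, hRD⟩
  have hs0 : s ≠ 0 := fun h0 => h.s_ne_zero (by rw [h0]; simp)
  have hBs : x - τ • x = B * s := by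
    apply mul_right_cancel₀ hs0
    rw [hR, hB, mul_assoc, ← pow_two, h.sq]
    push_cast
    ring
  have h2x : 2 * x = A + B * s := by linear_combination hA + hBs
  refine ⟨A, B, h2x, ?_⟩
  obtain ⟨e, he⟩ := mem_range_of_fixed hτ (x := (x : k) * τ x)
    (by rw [map_mul, gal_involutive hτ]; ring)
  obtain ⟨N, hN⟩ := RingOfIntegers.exists_int_of_eq_rat (x * τ • x) e he.symm
  have h4 : 4 * N = A ^ 2 - l * B ^ 2 := by
    have : ((4 * N : ℤ) : 𝓞 k) = ((A ^ 2 - l * B ^ 2 : ℤ) : 𝓞 k) := by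
      push_cast
      rw [← hN, ← h.sq]
      linear_combination (2 * (τ • x)) * h2x + (A + B * s) * (2 * hA - h2x)
    exact_mod_cast this
  have h5 : (2 : ℤ) ∣ A ^ 2 - B ^ 2 := by
    have hl := h.mod
    obtain ⟨m, hm⟩ : ∃ m : ℕ, l = 8 * m + 1 := ⟨l / 8, by omega⟩
    refine ⟨2 * N + 4 * m * B ^ 2, ?_⟩
    rw [hm] at h4
    push_cast at h4
    linear_combination -h4
  rw [← even_iff_two_dvd] at h5 ⊢
  simpa [Int.even_sub, Int.even_pow] using h5

theorem not_mem_of_above {v : HeightOneSpectrum (𝓞 k)} {p : ℕ} (hp : p.Prime) (hpl : p ≠ l) (hv : Above v p) :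
    (l : 𝓞 k) ∉ v.asIdeal := fun hm =>
  hpl ((Nat.prime_dvd_prime_iff_eq hp h.prime).1 ((hv.natCast l).1 hm))

/-- The integer `(1 + s) / 2`. -/
theorem exists_half : ∃ θ : 𝓞 k, 2 * θ = 1 + s := by
  have hl := h.mod
  obtain ⟨m, hm⟩ : ∃ m : ℕ, l = 4 * m + 1 := ⟨l / 4, by omega⟩
  have hs := h.sq'
  have hInt : IsIntegral ℤ ((1 + (s : k)) / 2) := by
    refine ⟨.X ^ 2 - .X - .C (m : ℤ), by monicity!, ?_⟩
    simp
    rw [hm] at hs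
    push_cast at hs
    linear_combination hs / 4
  obtain ⟨θ, hθ⟩ : ∃ θ : 𝓞 k, algebraMap (𝓞 k) k θ = (1 + algebraMap (𝓞 k) k s) / 2 :=
    ⟨⟨_, hInt⟩, rfl⟩
  exact ⟨θ, FaithfulSMul.algebraMap_injective (𝓞 k) k (by
    rw [map_mul, map_add, map_one, map_ofNat, hθ]
    ring)⟩

include hτ in
theorem ram_rat_eq_one {w : HeightOneSpectrum (𝓞 ℚ)}
    (hw : Rat.HeightOneSpectrum.natGenerator w ≠ l) : ram k w = 1 := by
  obtain ⟨θ, hθ⟩ := h.exists_half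
  have hs := h.conj_s hτ
  refine ram_eq_one_of_disc τ θ w (l : 𝓞 ℚ) ?_ ?_
  · have h1 : 2 * (θ : k) = 1 + s := by
      have := congrArg (algebraMap (𝓞 k) k) hθ
      rwa [map_mul, map_add, map_one, map_ofNat] at this
    have h2 : 2 * τ (θ : k) = 1 - s := by
      have := congrArg τ h1
      rw [map_mul, map_add, hs, map_one, map_ofNat] at this
      rw [this]; ring
    have h3 : (θ : k) - τ θ = s := by linear_combination (h1 - h2) / 2
    rw [h3, h.sq']
    simp
  · have := Rat.HeightOneSpectrum.intCast_mem_iff w l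
    rw [Int.cast_natCast] at this
    rw [this, Int.natCast_dvd_natCast,
      Nat.prime_dvd_prime_iff_eq (Rat.HeightOneSpectrum.prime_natGenerator w) h.prime]
    exact hw

theorem ram_rat_eq_two {w : HeightOneSpectrum (𝓞 ℚ)}
    (hw : Rat.HeightOneSpectrum.natGenerator w = l) : ram k w = 2 := by
  refine ram_of_odd (x := (s : k)) (d := (l : ℚ)) (by rw [h.sq']; simp) w ?_
  have := Rat.HeightOneSpectrum.ord_natGenerator w
  rw [hw] at this
  rw [this]
  exact odd_one

theorem ord_prime {v : HeightOneSpectrum (𝓞 k)} {p : ℕ} (hp : p.Prime) (hpl : p ≠ l)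
    (hv : Above v p) : v.ord (p : k) = 1 := by
  obtain ⟨τ, hτ⟩ := exists_gal (k := ℚ) (F := k)
  obtain ⟨w, hw⟩ := Above.exists_rat hp
  rw [ord_rat hv hw, h.ram_rat_eq_one hτ (hw ▸ hpl), Nat.cast_one]

theorem ord_s {v : HeightOneSpectrum (𝓞 k)} (hv : Above v l) : v.ord (s : k) = 1 := by
  obtain ⟨w, hw⟩ := Above.exists_rat h.prime
  have h1 := ord_rat hv hw
  rw [h.ram_rat_eq_two hw, ← h.sq', ord_pow] at h1
  push_cast at h1
  omega

theorem ord_s_of_ne {v : HeightOneSpectrum (𝓞 k)} {p : ℕ} (hp : p.Prime) (hpl : p ≠ l)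
    (hv : Above v p) : v.ord (s : k) = 0 := by
  refine v.ord_eq_zero_of_notMem fun hm => h.not_mem_of_above hp hpl hv ?_
  rw [← h.sq]
  exact v.asIdeal.pow_mem_of_mem hm 2 two_pos

omit h in
include hτ in
theorem eq_or_eq_conj {v v' : HeightOneSpectrum (𝓞 k)} {p : ℕ} (hp : p.Prime) (hv : Above v p)
    (hv' : Above v' p) : v' = v ∨ v' = conj τ v := by
  obtain ⟨w, hw⟩ := Above.exists_rat hp
  have := hv.liesOver w hw
  have := hv'.liesOver w hw
  exact QuadExt.eq_or_eq_conj hτ w v v'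

omit h [Algebra.IsQuadraticExtension ℚ k] in
theorem conj_above {v : HeightOneSpectrum (𝓞 k)} {p : ℕ} (hv : Above v p) : Above (conj τ v) p := by
  intro m
  rw [← hv m]
  have h1 : τ • (m : 𝓞 k) = m := RingOfIntegers.ext (by
    change τ ((m : 𝓞 k) : k) = _
    simp)
  have h2 : τ • (m : 𝓞 k) ∈ (conj τ v).asIdeal ↔ (m : 𝓞 k) ∈ v.asIdeal :=
    Ideal.smul_mem_pointwise_smul_iff
  rwa [h1] at h2

theorem eq_of_above_l {v v' : HeightOneSpectrum (𝓞 k)} (hv : Above v l) (hv' : Above v' l) :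
    v' = v := by
  obtain ⟨τ, hτ⟩ := exists_gal (k := ℚ) (F := k)
  obtain ⟨w, hw⟩ := Above.exists_rat h.prime
  have := hv.liesOver w hw
  rcases eq_or_eq_conj hτ h.prime hv hv' with h1 | h1
  · exact h1
  · rw [h1, conj_eq_of_ram τ w v (h.ram_rat_eq_two hw)]

omit h [Algebra.IsQuadraticExtension ℚ k] in
theorem exists_above {p : ℕ} (hp : p.Prime) : ∃ v : HeightOneSpectrum (𝓞 k), Above v p := by
  obtain ⟨I, hI, hp'⟩ := Ideal.exists_le_maximal (Ideal.span {(p : 𝓞 k)}) (by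
    intro htop
    rw [Ideal.span_singleton_eq_top, isUnit_iff_exists_inv] at htop
    obtain ⟨b, hb⟩ := htop
    have : (b : k) = ((p : ℚ)⁻¹ : ℚ) := by
      have h2 : (p : k) * b = 1 := by simpa using congrArg (fun x : 𝓞 k => (x : k)) hb
      push_cast
      exact eq_inv_of_mul_eq_one_right h2
    obtain ⟨m, rfl⟩ := RingOfIntegers.exists_int_of_eq_rat b _ this
    have h3 : (p : ℤ) * m = 1 := by exact_mod_cast hb
    have := Int.eq_one_or_neg_one_of_mul_eq_one h3
    have := hp.two_le
    omega)
  have hm : (p : 𝓞 k) ∈ I := hp' (Ideal.mem_span_singleton_self _)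
  refine ⟨⟨I, hI.isPrime, fun h0 => ?_⟩, Above.of_mem hp hm⟩
  rw [h0, Ideal.mem_bot] at hm
  exact hp.ne_zero (by exact_mod_cast hm)

end SqrtPrime

end

section

open IsDedekindDomain nonZeroDivisors NumberField Pointwise
open HeightOneSpectrum (squares evenUnits mem_squares_units ord_mul ord_pow)
set_option linter.unusedSectionVars false
open QuadExt

section

namespace Subgroup

variable {G : Type*} [CommGroup G] {H N : Subgroup G} {a b : G}

theorem cosets_of_index_four (hH : H.index = 4) (ha : a ∉ H) (hb : b ∉ H) (hab : a * b ∉ H)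
    (ha2 : a ^ 2 ∈ H) (g : G) : g ∈ H ∨ a * g ∈ H ∨ b * g ∈ H ∨ a * b * g ∈ H := by
  classical
  have hfin : Finite (G ⧸ H) := by
    rw [← Subgroup.finiteIndex_iff_finite_quotient]
    exact ⟨by omega⟩
  have := Fintype.ofFinite (G ⧸ H)
  have hcard : Fintype.card (G ⧸ H) = 4 := by rw [← Nat.card_eq_fintype_card, ← hH]; rfl
  by_contra! hg
  obtain ⟨h1, h2, h3, h4⟩ := hg
  let f₀ : Fin 5 → G := ![1, a⁻¹, b⁻¹, (a * b)⁻¹, g]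
  let f : Fin 5 → G ⧸ H := fun i => f₀ i
  have hf : ¬ Function.Injective f := fun hf => by
    have := Fintype.card_le_of_injective f hf
    simp [hcard] at this
  have key : ∀ i j, i < j → f i ≠ f j := by
    have hinv : ∀ x, x ∉ H → x⁻¹ ∉ H := fun x hx hx' => hx (inv_mem_iff.1 hx')
    have hA : a * b⁻¹ ∉ H := fun hm => hab (by
      have : a * b = a ^ 2 * (a * b⁻¹)⁻¹ := by
        rw [mul_inv_rev, inv_inv, mul_comm b, ← mul_assoc, pow_two, mul_inv_cancel_right]
      rw [this]
      exact H.mul_mem ha2 (H.inv_mem hm))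
    intro i j hij he
    have := QuotientGroup.eq.1 he
    fin_cases i <;> fin_cases j <;> simp [f₀] at hij this <;>
      first
      | contradiction
      | exact hab (by rwa [← mul_inv_rev, inv_mem_iff] at this)
  obtain ⟨i, j, he, hne⟩ : ∃ i j, f i = f j ∧ i ≠ j := by simpa [Function.Injective] using hf
  rcases lt_or_gt_of_ne hne with h | h
  · exact key i j h he
  · exact key j i h he.symm

theorem relIndex_eq_four (hH : H.index = 4) (hHN : H ≤ N) (ha : a ∉ H) (hb : b ∉ H) (hab : a * b ∉ H)
    (ha2 : a ^ 2 ∈ H) (haN : a ∈ N) (hbN : b ∈ N) : H.relIndex N = 4 := by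
  have : N = ⊤ := by
    rw [eq_top_iff]
    intro g _
    rcases cosets_of_index_four hH ha hb hab ha2 g with h | h | h | h
    · exact hHN h
    · exact (N.mul_mem_cancel_left haN).1 (hHN h)
    · exact (N.mul_mem_cancel_left hbN).1 (hHN h)
    · exact (N.mul_mem_cancel_left (N.mul_mem haN hbN)).1 (hHN h)
  rw [this, relIndex_top_right, hH]

theorem relIndex_eq_one_of (hH : H.index = 4) (ha : a ∉ H) (hb : b ∉ H) (hab : a * b ∉ H)
    (ha2 : a ^ 2 ∈ H) (hHN : H ≤ N) (haN : a ∉ N) (hbN : b ∉ N) (habN : a * b ∉ N) :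
    H.relIndex N = 1 := by
  rw [relIndex_eq_one]
  intro g hg
  rcases cosets_of_index_four hH ha hb hab ha2 g with h | h | h | h
  · exact h
  · exact absurd ((N.mul_mem_cancel_right hg).1 (hHN h)) haN
  · exact absurd ((N.mul_mem_cancel_right hg).1 (hHN h)) hbN
  · exact absurd ((N.mul_mem_cancel_right hg).1 (hHN h)) habN

theorem relIndex_eq_two_of (hH : H.index = 4) (hHN : H ≤ N) {x y : G} (hx : x ∈ N) (hx' : x ∉ H)
    (hy : y ∉ N) : H.relIndex N = 2 := by
  have h1 := relIndex_mul_index hHN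
  have h2 : H.relIndex N ≠ 1 := fun h => hx' (relIndex_eq_one.1 h hx)
  have h3 : N.index ≠ 1 := fun h => hy (index_eq_one.1 h ▸ mem_top y)
  rw [hH] at h1
  have h4 : H.relIndex N ∣ 4 := ⟨_, h1.symm⟩
  have h5 := Nat.le_of_dvd (by norm_num) h4
  interval_cases H.relIndex N <;> omega

end Subgroup

theorem NumberField.Units.rank_of_isTotallyReal (F : Type*) [Field F] [NumberField F]
    [IsTotallyReal F] : Units.rank F = Module.finrank ℚ F - 1 := by
  rw [Units.rank, IsTotallyReal.finrank, InfinitePlace.card_eq_nrRealPlaces_add_nrComplexPlaces,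
    IsTotallyReal.nrComplexPlaces_eq_zero, add_zero]

theorem odd_card_of_card_twoTorsion {G : Type*} [CommGroup G] [Finite G]
    (h : Nat.card {x : G // x ^ 2 = 1} = 1) : Odd (Nat.card G) := by
  rw [← Nat.not_even_iff_odd, even_iff_two_dvd]
  intro h2
  obtain ⟨x, hx⟩ := exists_prime_orderOf_dvd_card' 2 h2
  rw [Nat.card_eq_one_iff_unique] at h
  have := h.1.elim ⟨x, by rw [← hx, pow_orderOf_eq_one]⟩ ⟨1, one_pow 2⟩
  have h3 : x = 1 := congrArg Subtype.val this
  rw [h3, orderOf_one] at hx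
  omega

/-- `u + v s` is a unit of norm `-1` with `u, v > 0`. -/
structure NegPell (l : ℕ) (u v : ℤ) : Prop where
  u_pos : 0 < u
  v_pos : 0 < v
  eq : u ^ 2 + 1 = l * v ^ 2

namespace NegPell

variable {l : ℕ} {u v : ℤ} (hl : l % 8 = 1) (h : NegPell l u v)
include h

theorem mul_eq_one {R : Type*} [CommRing R] {s : R} (hs : s ^ 2 = l) : ((u : R) + v * s) * (-u + v * s) = 1 := by
  have : ((u ^ 2 + 1 : ℤ) : R) = ((l * v ^ 2 : ℤ) : R) := by rw [h.eq]
  push_cast at this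
  rw [← hs] at this
  linear_combination -this

include hl

theorem four_dvd_u : (4 : ℤ) ∣ u := by
  have h1 := h.eq
  obtain ⟨m, hm⟩ : ∃ m : ℕ, l = 8 * m + 1 := ⟨l / 8, by omega⟩
  have h2 : u ^ 2 + 1 = 8 * (m * v ^ 2) + v ^ 2 := by rw [h1, hm]; push_cast; ring
  have hu : u % 8 = 0 ∨ u % 8 = 1 ∨ u % 8 = 2 ∨ u % 8 = 3 ∨ u % 8 = 4 ∨ u % 8 = 5 ∨ u % 8 = 6 ∨
    u % 8 = 7 := by omega
  have hv : v % 8 = 0 ∨ v % 8 = 1 ∨ v % 8 = 2 ∨ v % 8 = 3 ∨ v % 8 = 4 ∨ v % 8 = 5 ∨ v % 8 = 6 ∨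
    v % 8 = 7 := by omega
  have hu2 : u ^ 2 % 8 = (u % 8) ^ 2 % 8 := by simp [pow_two, Int.mul_emod]
  have hv2 : v ^ 2 % 8 = (v % 8) ^ 2 % 8 := by simp [pow_two, Int.mul_emod]
  rcases hu with a | a | a | a | a | a | a | a <;> rcases hv with b | b | b | b | b | b | b | b <;>
    rw [a] at hu2 <;> rw [b] at hv2 <;> norm_num at hu2 hv2 <;> omega

theorem v_odd : v % 2 = 1 := by
  have h1 := h.eq
  obtain ⟨m, hm⟩ := h.four_dvd_u hl
  by_contra hv
  obtain ⟨w, hw⟩ : ∃ w, v = 2 * w := ⟨v / 2, by omega⟩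
  rw [hm, hw] at h1
  have : 16 * m ^ 2 + 1 = 4 * (l * w ^ 2) := by linear_combination h1
  omega

omit hl in
theorem isSquare_neg_one_v : IsSquare (-1 : ZMod v.natAbs) := by
  refine ⟨u, ?_⟩
  have h2 : ((u ^ 2 + 1 : ℤ) : ZMod v.natAbs) = ((l * v ^ 2 : ℤ) : ZMod v.natAbs) := by rw [h.eq]
  push_cast at h2
  rw [(ZMod.intCast_zmod_eq_zero_iff_dvd v v.natAbs).2 Int.natAbs_dvd_self] at h2
  linear_combination -h2

omit hl in
theorem v_eq_sq_add_sq : ∃ a b : ℤ, v = a ^ 2 + b ^ 2 := by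
  obtain ⟨a, b, hab⟩ := Nat.eq_sq_add_sq_of_isSquare_mod_neg_one h.isSquare_neg_one_v
  refine ⟨a, b, ?_⟩
  have h0 := h.v_pos
  have : (v.natAbs : ℤ) = v := by omega
  rw [← this, hab]
  push_cast
  ring

theorem v_mod : v % 4 = 1 := by
  have h0 := h.v_pos
  have h1 := h.v_odd hl
  obtain ⟨a, b, hab⟩ := h.v_eq_sq_add_sq
  rw [hab] at h1 ⊢
  rcases Int.even_or_odd' a with ⟨c, rfl | rfl⟩ <;> rcases Int.even_or_odd' b with ⟨d, rfl | rfl⟩ <;>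
    ring_nf at h1 ⊢ <;> omega

end NegPell

variable {k : Type*} [Field k] [NumberField k]

theorem Above.of_two_mem {v : HeightOneSpectrum (𝓞 k)} (h2 : (2 : 𝓞 k) ∈ v.asIdeal) : Above v 2 :=
  Above.of_mem Nat.prime_two (by exact_mod_cast h2)

namespace SqrtPrime

variable [Algebra.IsQuadraticExtension ℚ k] {l : ℕ} {s : 𝓞 k} (h : SqrtPrime l s)
  {τ : Gal(k/ℚ)} (hτ : τ ≠ 1)
include h

include hτ in
theorem conj_ne_of_dvd {v : HeightOneSpectrum (𝓞 k)} {p : ℕ} (hp : p.Prime) (hp2 : p ≠ 2) (hpl : p ≠ l)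
    (hv : Above v p) {c : ℤ} (hc : (p : ℤ) ∣ l - c ^ 2) : conj τ v ≠ v := by
  intro hcv
  have h1 : (s - c) * (s + c) ∈ v.asIdeal := by
    have := (hv _).2 hc
    push_cast at this
    rw [← h.sq] at this
    rwa [show (s - c) * (s + c) = s ^ 2 - c ^ 2 by ring]
  have h2 : ∀ x, τ • x ∈ v.asIdeal ↔ x ∈ v.asIdeal := fun x => by
    have := smul_mem_conj h hτ v x
    rwa [hcv] at this
  have h3 : τ • (s - c) = -(s + c) := by
    have h4 : τ • (c : 𝓞 k) = c := RingOfIntegers.ext (by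
      change τ ((c : 𝓞 k) : k) = _
      simp)
    rw [smul_sub, h.conj_s' hτ, h4]
    ring
  have h5 : s - c ∈ v.asIdeal ∧ s + c ∈ v.asIdeal := by
    have h6 := h2 (s - c)
    rw [h3, neg_mem_iff] at h6
    rcases v.isPrime.mem_or_mem h1 with h7 | h7
    · exact ⟨h7, h6.2 h7⟩
    · exact ⟨h6.1 h7, h7⟩
  have h6 : ((2 * c : ℤ) : 𝓞 k) ∈ v.asIdeal := by
    have := v.asIdeal.sub_mem h5.2 h5.1
    push_cast
    rwa [show s + c - (s - c) = 2 * (c : 𝓞 k) by ring] at this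
  rw [hv] at h6
  have hpz := Nat.prime_iff_prime_int.1 hp
  have h7 : ¬ (p : ℤ) ∣ 2 := fun h8 =>
    hp2 ((Nat.prime_dvd_prime_iff_eq hp Nat.prime_two).1 (by exact_mod_cast h8))
  have h8 := (hpz.dvd_mul.1 h6).resolve_left h7
  have h9 : (p : ℤ) ∣ l := by
    have := dvd_add hc (dvd_pow h8 two_ne_zero)
    simpa using this
  exact hpl ((Nat.prime_dvd_prime_iff_eq hp h.prime).1 (by exact_mod_cast h9))

include hτ in
theorem conj_ne_of_two {v : HeightOneSpectrum (𝓞 k)} (hv : Above v 2) : conj τ v ≠ v := by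
  intro hcv
  obtain ⟨θ, hθ⟩ := h.exists_half
  have h2 : ∀ x, τ • x ∈ v.asIdeal ↔ x ∈ v.asIdeal := fun x => by
    have := smul_mem_conj h hτ v x
    rwa [hcv] at this
  have h20 : (2 : 𝓞 k) ≠ 0 := two_ne_zero
  have h3 : τ • θ = 1 - θ := by
    apply mul_left_cancel₀ h20
    have h4 : τ • (2 * θ) = 1 - s := by
      rw [hθ, smul_add, h.conj_s' hτ, smul_one]
      ring
    have h5 : τ • (2 * θ) = 2 * τ • θ := by rw [two_mul, smul_add, two_mul]
    rw [← h5, h4]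
    linear_combination hθ
  obtain ⟨m, hm⟩ : ∃ m : ℕ, l = 8 * m + 1 := ⟨l / 8, by have := h.mod; omega⟩
  have h4 : θ * (1 - θ) = 2 * (-m) := by
    apply mul_left_cancel₀ (mul_ne_zero h20 h20)
    have h5 := h.sq
    rw [hm] at h5
    push_cast at h5
    linear_combination 2 * (1 - θ) * hθ - (1 + s) * hθ - h5
  have h5 : θ * (1 - θ) ∈ v.asIdeal := by
    rw [h4]
    exact v.asIdeal.mul_mem_right _ (by exact_mod_cast hv.self_mem)
  have h6 := h2 θ
  rw [h3] at h6
  have h7 : θ ∈ v.asIdeal ∧ 1 - θ ∈ v.asIdeal := by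
    rcases v.isPrime.mem_or_mem h5 with h7 | h7
    · exact ⟨h7, h6.2 h7⟩
    · exact ⟨h6.1 h7, h7⟩
  exact v.isPrime.ne_top ((Ideal.eq_top_iff_one _).2 (by
    have := v.asIdeal.add_mem h7.1 h7.2
    rwa [add_sub_cancel] at this))

omit h in
theorem exists_int_of_inertiaDeg {v : HeightOneSpectrum (𝓞 k)} {p : ℕ} (hp : p.Prime) (hv : Above v p)
    (hf : ∀ w : HeightOneSpectrum (𝓞 ℚ), Rat.HeightOneSpectrum.natGenerator w = p →
      w.asIdeal.inertiaDegIn (𝓞 k) = 1) (x : 𝓞 k) : ∃ m : ℤ, x - m ∈ v.asIdeal := by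
  obtain ⟨w, hw⟩ := Above.exists_rat hp
  have := hv.liesOver w hw
  obtain ⟨c, hc⟩ := exists_congr_of_inertiaDeg_eq_one w v (hf w hw) x
  obtain ⟨m, rfl⟩ := Rat.ringOfIntegersEquiv.symm.surjective c
  refine ⟨m, ?_⟩
  rwa [← Int.cast_id (n := m), map_intCast, map_intCast] at hc

omit h in
/-- At a split prime the residue field is the prime field. -/
theorem exists_int_of_conj_ne {v : HeightOneSpectrum (𝓞 k)} {p : ℕ} (hp : p.Prime) (hv : Above v p)
    (hc : conj τ v ≠ v) (x : 𝓞 k) : ∃ m : ℤ, x - m ∈ v.asIdeal := by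
  refine exists_int_of_inertiaDeg hp hv (fun w hw => ?_) x
  have := hv.liesOver w hw
  have h1 := efg (F := k) w
  have h2 : (w.asIdeal.primesOver (𝓞 k)).ncard ≠ 1 := fun h2 => hc (ncard_eq_one_conj τ w v h2)
  have h3 : (w.asIdeal.primesOver (𝓞 k)).ncard ∣ 2 := ⟨_, h1.symm⟩
  rw [((Nat.dvd_prime Nat.prime_two).1 h3).resolve_left h2] at h1
  exact Nat.eq_one_of_mul_eq_one_left (m := ram k w) (by omega)

include hτ in
theorem conj_ne_iff {v : HeightOneSpectrum (𝓞 k)} {p : ℕ} (hp : p.Prime) (hp2 : p ≠ 2) (hpl : p ≠ l)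
    (hv : Above v p) : conj τ v ≠ v ↔ IsSquare (l : ZMod p) := by
  constructor
  · intro hc
    obtain ⟨m, hm⟩ := exists_int_of_conj_ne hp hv hc s
    refine ⟨m, ?_⟩
    have h1 : ((l - m ^ 2 : ℤ) : 𝓞 k) ∈ v.asIdeal := by
      push_cast
      rw [← h.sq, show s ^ 2 - (m : 𝓞 k) ^ 2 = (s - m) * (s + m) by ring]
      exact v.asIdeal.mul_mem_right _ hm
    rw [hv, ← ZMod.intCast_zmod_eq_zero_iff_dvd] at h1
    push_cast at h1
    linear_combination h1
  · rintro ⟨c, hc⟩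
    obtain ⟨c, rfl⟩ := ZMod.intCast_surjective c
    refine h.conj_ne_of_dvd hτ hp hp2 hpl hv (c := c) ?_
    rw [← ZMod.intCast_zmod_eq_zero_iff_dvd]
    push_cast
    linear_combination hc

end SqrtPrime

end

section

theorem Complex.conj_eq_of_sq_eq {z : ℂ} {r : ℝ} (hr : 0 ≤ r) (h : z ^ 2 = r) :
    (starRingEnd ℂ) z = z := by
  have h1 : z ^ 2 = ((Real.sqrt r : ℝ) : ℂ) ^ 2 := by
    rw [h]
    exact_mod_cast (Real.sq_sqrt hr).symm
  rcases sq_eq_sq_iff_eq_or_eq_neg.1 h1 with h2 | h2 <;> rw [h2] <;> simp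

theorem NumberField.isTotallyReal_of_conj {F : Type*} [Field F] [NumberField F]
    (h : ∀ (φ : F →+* ℂ) x, (starRingEnd ℂ) (φ x) = φ x) : IsTotallyReal F where
  isReal w := by
    rw [InfinitePlace.isReal_iff, ComplexEmbedding.isReal_iff]
    exact RingHom.ext fun x => h _ x

variable {k : Type*} [Field k] [NumberField k]

theorem Rat.ringOfIntegers_unit (w : (𝓞 ℚ)ˣ) : w = 1 ∨ w = -1 := by
  rcases Int.units_eq_one_or (Units.map (Rat.ringOfIntegersEquiv : 𝓞 ℚ →* ℤ) w) with h | h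
  · left
    apply Units.ext
    apply Rat.ringOfIntegersEquiv.injective
    rw [Units.val_one, map_one]
    exact congrArg Units.val h
  · right
    apply Units.ext
    apply Rat.ringOfIntegersEquiv.injective
    rw [Units.val_neg, Units.val_one, map_neg, map_one]
    exact congrArg Units.val h

theorem Rat.card_classGroup : Nat.card (ClassGroup (𝓞 ℚ)) = 1 := by
  have : IsPrincipalIdealRing (𝓞 ℚ) :=
    IsPrincipalIdealRing.of_surjective (Rat.ringOfIntegersEquiv.symm : ℤ →+* 𝓞 ℚ)
      Rat.ringOfIntegersEquiv.symm.surjective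
  rw [Nat.card_eq_fintype_card]
  convert card_classGroup_eq_one (R := 𝓞 ℚ)

namespace SqrtPrime

variable [Algebra.IsQuadraticExtension ℚ k] {l : ℕ} {s : 𝓞 k} (h : SqrtPrime l s)
  {τ : Gal(k/ℚ)} (hτ : τ ≠ 1)
include h

theorem exists_rat_coords (x : k) : ∃ a b : ℚ, x = a + b * s := by
  obtain ⟨τ, hτ⟩ := exists_gal (k := ℚ) (F := k)
  have hs := h.conj_s hτ
  obtain ⟨a, ha⟩ := mem_range_of_fixed hτ (x := (x : k) + τ x)
    (by rw [map_add, gal_involutive hτ]; ring)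
  obtain ⟨b, hb⟩ := mem_range_of_fixed hτ (x := ((x : k) - τ x) * s)
    (by rw [map_mul, map_sub, gal_involutive hτ, hs]; ring)
  refine ⟨a / 2, b / (2 * l), ?_⟩
  have h1 := h.s_ne_zero
  have h2 := h.sq'
  rw [eq_ratCast] at ha hb
  push_cast
  rw [← h2, ha, hb]
  field_simp
  ring

theorem isTotallyReal : IsTotallyReal k := by
  refine isTotallyReal_of_conj fun φ x => ?_
  obtain ⟨a, b, rfl⟩ := h.exists_rat_coords x
  have h1 : (φ (s : k)) ^ 2 = ((l : ℝ) : ℂ) := by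
    rw [← map_pow, h.sq', map_natCast, Complex.ofReal_natCast]
  simp only [map_add, map_mul, map_ratCast, Complex.conj_eq_of_sq_eq (Nat.cast_nonneg l) h1]

theorem index_squares_units : (squares (𝓞 k)ˣ).index = 4 := by
  have := h.isTotallyReal
  rw [Units.index_squares, Units.rank_of_isTotallyReal,
    Algebra.IsQuadraticExtension.finrank_eq_two]
  rfl

theorem norm_eq (a b : ℚ) : Algebra.norm ℚ ((a : k) + b * s) = a ^ 2 - l * b ^ 2 := by
  obtain ⟨τ, hτ⟩ := exists_gal (k := ℚ) (F := k)
  apply (algebraMap ℚ k).injective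
  rw [algebraMap_norm hτ, map_add, map_mul, map_ratCast, map_ratCast, h.conj_s hτ, eq_ratCast]
  push_cast
  rw [← h.sq']
  ring

variable {u v : ℤ} (hN : NegPell l u v)

include hN in
theorem norm_unit : Algebra.norm ℚ ((u : k) + v * s) = -1 := by
  have h1 := h.norm_eq u v
  push_cast at h1
  rw [h1]
  have := hN.eq
  have h2 : (u : ℚ) ^ 2 + 1 = l * v ^ 2 := by exact_mod_cast this
  linear_combination h2

include hN in
theorem odd_classNumber : Odd (Nat.card (ClassGroup (𝓞 k))) := by
  obtain ⟨τ, hτ⟩ := exists_gal (k := ℚ) (F := k)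
  obtain ⟨w, hw⟩ := Above.exists_rat h.prime
  have hT : ∀ w' : HeightOneSpectrum (𝓞 ℚ), w' ∈ ({w} : Finset _) ↔ ram k w' = 2 := by
    intro w'
    rw [Finset.mem_singleton]
    constructor
    · rintro rfl
      exact h.ram_rat_eq_two hw
    · intro h2
      by_contra hne
      have h3 : Rat.HeightOneSpectrum.natGenerator w' ≠ l := fun h4 =>
        hne (Rat.HeightOneSpectrum.primesEquiv.injective (Subtype.ext (h4.trans hw.symm)))
      rw [h.ram_rat_eq_one hτ h3] at h2
      omega
  have key := card_twoTorsion_mul hτ (by rw [Rat.card_classGroup]; exact odd_one) _ hT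
  have hreal : IsTotallyReal ℚ := isTotallyReal_of_conj fun φ x => by
    rw [eq_ratCast, Complex.conj_eq_iff_real]
    exact ⟨x, by simp⟩
  have hQ : (squares (𝓞 ℚ)ˣ).index = 2 := by
    rw [Units.index_squares, Units.rank_of_isTotallyReal, Module.finrank_self]
    rfl
  have hnorm : normUnits ℚ k = ⊤ := by
    rw [eq_top_iff]
    intro w _
    rcases Rat.ringOfIntegers_unit w with rfl | rfl
    · exact one_mem _
    · rw [mem_normUnits]
      exact ⟨_, (h.norm_unit hN).trans (by simp)⟩
  rw [hnorm, Subgroup.relIndex_top_right, hQ, h.index_squares_units, Finset.card_singleton] at key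
  exact odd_card_of_card_twoTorsion (by omega)

/-- The unit `u + v s`. -/
noncomputable def unit : (𝓞 k)ˣ := Units.mkOfMulEqOne ((u : 𝓞 k) + v * s) _ (hN.mul_eq_one h.sq)

theorem coe_unit : ((h.unit hN : (𝓞 k)ˣ) : 𝓞 k) = u + v * s := rfl

theorem coe_unit' : (((h.unit hN : (𝓞 k)ˣ) : 𝓞 k) : k) = u + v * s := by
  rw [h.coe_unit hN]
  simp

theorem neg_one_not_square : (-1 : (𝓞 k)ˣ) ∉ squares (𝓞 k)ˣ := by
  rintro ⟨x, hx⟩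
  have hx' : (((x : 𝓞 k) : k)) ^ 2 = -1 := by
    have := congrArg (fun y : (𝓞 k)ˣ => algebraMap (𝓞 k) k y) hx
    simpa using this
  have := h.isTotallyReal
  let φ := (InfinitePlace.embedding (Classical.arbitrary (InfinitePlace k)))
  obtain ⟨r, hr⟩ := Complex.conj_eq_iff_real.1 (RingHom.congr_fun
    (ComplexEmbedding.isReal_iff.1 (IsTotallyReal.complexEmbedding_isReal φ)) ((x : 𝓞 k) : k))
  have h2 := congrArg φ hx'
  rw [map_pow, hr, map_neg, map_one] at h2
  have h3 : r ^ 2 = -1 := by exact_mod_cast h2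
  nlinarith [sq_nonneg r]

theorem unit_not_square : h.unit hN ∉ squares (𝓞 k)ˣ := by
  rintro ⟨x, hx⟩
  have hx' : (((x : 𝓞 k) : k)) ^ 2 = u + v * s := by
    rw [← h.coe_unit' hN, ← hx]
    simp
  have h1 := h.norm_unit hN
  rw [← hx', map_pow] at h1
  nlinarith [sq_nonneg (Algebra.norm ℚ ((x : 𝓞 k) : k))]

theorem neg_unit_not_square : -1 * h.unit hN ∉ squares (𝓞 k)ˣ := by
  rintro ⟨x, hx⟩
  have hx' : (((x : 𝓞 k) : k)) ^ 2 = algebraMap ℚ k (-1) * ((u : k) + v * s) := by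
    rw [← h.coe_unit' hN, map_neg, map_one, neg_one_mul]
    have := congrArg (fun y : (𝓞 k)ˣ => algebraMap (𝓞 k) k y) hx
    simpa using this
  have h1 := congrArg (Algebra.norm ℚ) hx'
  rw [map_mul, Algebra.norm_algebraMap, h.norm_unit hN, map_pow, Algebra.IsQuadraticExtension.finrank_eq_two] at h1
  nlinarith [sq_nonneg (Algebra.norm ℚ ((x : 𝓞 k) : k))]

/-- Every unit is `±1` or `±ε` times a square. -/
theorem unit_cases (w : (𝓞 k)ˣ) : ∃ x : (𝓞 k)ˣ, w = x ^ 2 ∨ w = -x ^ 2 ∨ w = h.unit hN * x ^ 2 ∨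
    w = -(h.unit hN * x ^ 2) := by
  rcases Subgroup.cosets_of_index_four h.index_squares_units h.neg_one_not_square
    (h.unit_not_square hN) (h.neg_unit_not_square hN) ⟨1, by simp⟩ w with ⟨x, hx⟩ | ⟨x, hx⟩ | ⟨x, hx⟩ | ⟨x, hx⟩
  · exact ⟨x, Or.inl hx.symm⟩
  · refine ⟨x, Or.inr (Or.inl ?_)⟩
    rw [powMonoidHom_apply] at hx
    rw [hx]; simp
  · refine ⟨(h.unit hN)⁻¹ * x, Or.inr (Or.inr (Or.inl ?_))⟩
    rw [powMonoidHom_apply] at hx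
    rw [mul_pow, hx]
    simp only [pow_two, mul_assoc, inv_mul_cancel_left, mul_inv_cancel_left]
  · refine ⟨(h.unit hN)⁻¹ * x, Or.inr (Or.inr (Or.inr ?_))⟩
    rw [powMonoidHom_apply] at hx
    rw [mul_pow, hx]
    simp only [neg_mul, one_mul, mul_neg, neg_neg, pow_two, mul_assoc, inv_mul_cancel_left,
      mul_inv_cancel_left]

end SqrtPrime

end

theorem quartSym_eq_legendreSym {p : ℕ} [Fact p.Prime] (hp : p % 4 = 1) {a x : ℤ} {h : ℕ} (hh : Odd h)
    (hx : (x : ZMod p) ≠ 0) (hax : (a : ZMod p) ^ h = (x : ZMod p) ^ 2) :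
    quartSym p a = legendreSym p x := by
  have hx0 : ((x : ℤ) : ZMod p) ≠ 0 := hx
  have hp2 : (2 : ZMod p) ≠ 0 := by
    intro h2
    have : (p : ℕ) ∣ 2 := (ZMod.natCast_eq_zero_iff 2 p).1 (by exact_mod_cast h2)
    have := Nat.le_of_dvd two_pos this
    have := (Fact.out : p.Prime).two_le
    omega
  have h11 : (1 : ZMod p) ≠ -1 := fun h1 => hp2 (by linear_combination h1)
  have ha0 : (a : ZMod p) ≠ 0 := by
    intro h0
    rw [h0, zero_pow hh.pos.ne'] at hax
    exact pow_ne_zero 2 hx hax.symm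
  have hleg : (legendreSym p x : ZMod p) = ((a : ZMod p) ^ ((p - 1) / 4)) ^ h := by
    rw [legendreSym.eq_pow, ← pow_mul, mul_comm, pow_mul, hax, ← pow_mul]
    congr 1
    omega
  have hsq : ((a : ZMod p) ^ ((p - 1) / 4)) ^ 2 = 1 := by
    obtain ⟨m, rfl⟩ := hh
    have h1 : (((a : ZMod p) ^ ((p - 1) / 4)) ^ 2) ^ (2 * m + 1) = 1 := by
      rw [← pow_mul, mul_comm, pow_mul, ← hleg]
      rcases legendreSym.eq_one_or_neg_one p hx with h | h <;> rw [h] <;> simp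
    have h2 : (((a : ZMod p) ^ ((p - 1) / 4)) ^ 2) ^ 2 = 1 := by
      rw [← pow_mul, ← pow_mul, show (p - 1) / 4 * (2 * 2) = p - 1 by omega]
      exact ZMod.pow_card_sub_one_eq_one ha0
    rwa [pow_succ, pow_mul, h2, one_pow, one_mul] at h1
  unfold quartSym
  rcases (sq_eq_sq_iff_eq_or_eq_neg.1 (hsq.trans (one_pow 2).symm)) with h1 | h1
  · rw [h1, one_pow] at hleg
    rw [if_pos h1]
    rcases legendreSym.eq_one_or_neg_one p hx with h | h
    · exact h.symm
    · rw [h] at hleg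
      exact absurd (by simpa using hleg.symm) h11
  · rw [h1, hh.neg_one_pow] at hleg
    rw [if_neg (by rw [h1]; exact h11.symm)]
    rcases legendreSym.eq_one_or_neg_one p hx with h | h
    · rw [h] at hleg
      exact absurd (by simpa using hleg) h11
    · exact h.symm

open scoped NumberTheorySymbols in
theorem jacobiSym_eq_one_of_dvd {a w y : ℤ} {b : ℕ} (hw : IsCoprime w (b : ℤ)) (h : (b : ℤ) ∣ w ^ 2 - a * y ^ 2) :
    J(a | b) = 1 := by
  have h1 : J(a * y ^ 2 | b) = J(w ^ 2 | b) :=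
    jacobiSym.mod_left' (Int.modEq_iff_dvd.2 h)
  rw [jacobiSym.mul_left, jacobiSym.pow_left, jacobiSym.sq_one' (Int.isCoprime_iff_gcd_eq_one.1 hw)] at h1
  rcases jacobiSym.trichotomy a b with h2 | h2 | h2 <;> rw [h2] at h1 ⊢ <;> nlinarith [sq_nonneg J(y | b)]

theorem Int.sq_mod_sixteen {w : ℤ} (hw : w % 2 = 1) :
    (w ^ 2 % 16 = 1 ∧ (w % 8 = 1 ∨ w % 8 = 7)) ∨ (w ^ 2 % 16 = 9 ∧ (w % 8 = 3 ∨ w % 8 = 5)) := by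
  have hw8 : w % 8 = 1 ∨ w % 8 = 3 ∨ w % 8 = 5 ∨ w % 8 = 7 := by omega
  rcases hw8 with h | h | h | h <;>
    obtain ⟨q, hq⟩ : ∃ q, w = 8 * q + w % 8 := ⟨w / 8, by omega⟩ <;> rw [h] at hq <;> rw [hq] <;> ring_nf <;>
    omega

theorem Int.mod_eight_mul {y z t : ℤ} (hy : y % 2 = 1) (h : (8 : ℤ) ∣ z * y + t) (ht : t % 2 = 1) :
    (z % 8 = 1 ∨ z % 8 = 7) ↔ ((y % 8 = 1 ∨ y % 8 = 7) ↔ (t % 8 = 1 ∨ t % 8 = 7)) := by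
  have hy8 : y % 8 = 1 ∨ y % 8 = 3 ∨ y % 8 = 5 ∨ y % 8 = 7 := by omega
  obtain ⟨q, hq⟩ : ∃ q, y = 8 * q + y % 8 := ⟨y / 8, by omega⟩
  generalize y % 8 = r at hy8 hq
  subst hq
  rw [show z * (8 * q + r) = 8 * (z * q) + z * r by ring] at h
  generalize z * q = w at h
  rcases hy8 with rfl | rfl | rfl | rfl <;> omega

namespace NegPell

variable {l : ℕ} {u v : ℤ} (h : NegPell l u v)
include h

theorem sub_pos {x y m : ℤ} (hx : 0 < x) (hm : 0 < m) (hxy : x ^ 2 - l * y ^ 2 = m) :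
    0 < v * x - u * y := by
  have hu := h.u_pos
  have hv := h.v_pos
  have h0 := h.eq
  have h1 : (u * y) ^ 2 < (v * x) ^ 2 := by
    have : (v * x) ^ 2 - (u * y) ^ 2 = y ^ 2 + v ^ 2 * m := by
      rw [← hxy]; linear_combination -y ^ 2 * h0
    have : 0 < v ^ 2 * m := by positivity
    nlinarith [sq_nonneg y]
  have h2 := abs_lt_of_sq_lt_sq h1 (by positivity)
  linarith [(abs_lt.1 h2).2]

/-- The norm of `(x + y s) (-u + v s)`. -/
theorem norm_eq {x y m : ℤ} (hxy : x ^ 2 - l * y ^ 2 = m) :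
    (u * x - l * v * y) ^ 2 - l * (v * x - u * y) ^ 2 = - m := by
  rw [← hxy]; linear_combination (x ^ 2 - l * y ^ 2) * h.eq

theorem not_dvd {p : ℕ} (hp : p.Prime) {c : ℤ} (hc : (p : ℤ) ∣ l - c ^ 2) : ¬ (p : ℤ) ∣ u + v * c := by
  intro h1
  have h2 : (p : ℤ) ∣ 1 := by
    have h3 := dvd_add (dvd_mul_of_dvd_left h1 (-u + v * c)) (dvd_mul_of_dvd_right hc (v ^ 2))
    rwa [show (u + v * c) * (-u + v * c) + v ^ 2 * (l - c ^ 2) = 1 by linear_combination -h.eq] at h3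
  exact hp.one_lt.ne' (by exact_mod_cast Int.eq_one_of_dvd_one (by positivity) h2)

open scoped NumberTheorySymbols in
theorem isSquare_iff_of_pos (hl : l.Prime) (hl8 : l % 8 = 1) {p : ℕ} (hp : p.Prime) (hp4 : p % 4 = 1)
    (hpl : p ≠ l) {r : ℕ} (hr : Odd r) {x y c : ℤ} (hx : 0 < x) (hxy : x ^ 2 - l * y ^ 2 = p ^ r) (hy : ¬ (p : ℤ) ∣ y)
    (hc : (p : ℤ) ∣ x + y * c) : IsSquare ((u + v * c : ℤ) : ZMod p) ↔ quartSym l p = quartSym p l := by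
  have := Fact.mk hp
  have := Fact.mk hl
  have hpp : Prime (p : ℤ) := Nat.prime_iff_prime_int.1 hp
  have hlp : Prime (l : ℤ) := Nat.prime_iff_prime_int.1 hl
  have hp0 : (0 : ℤ) < p ^ r := by have := hp.pos; positivity
  have hpr : (p : ℤ) ∣ p ^ r := dvd_pow_self _ hr.pos.ne'
  obtain ⟨m, rfl⟩ := hr
  have hpr4 : (p : ℤ) ^ (2 * m + 1) % 4 = 1 := by
    have : (p : ℤ) ≡ 1 [ZMOD 4] := by rw [Int.ModEq]; omega
    exact (this.pow (2 * m + 1)).trans (by rw [one_pow])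
  have hxy2 : x % 2 = 1 ∧ y % 2 = 0 := by
    have hl4 : (l : ℤ) = 4 * (l / 4) + 1 := by omega
    rw [← hxy, hl4] at hpr4
    rcases Int.even_or_odd' x with ⟨a, rfl | rfl⟩ <;> rcases Int.even_or_odd' y with ⟨b, rfl | rfl⟩ <;>
      ring_nf at hpr4 ⊢ <;> omega
  have hpl' : ¬ (p : ℤ) ∣ l := fun h1 =>
    hpl ((Nat.prime_dvd_prime_iff_eq hp hl).1 (Int.natCast_dvd_natCast.1 h1))
  have hxl : ¬ (l : ℤ) ∣ x := by
    intro h1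
    have h2 : (l : ℤ) ∣ p ^ (2 * m + 1) := by
      rw [← hxy]
      exact dvd_sub (dvd_pow h1 two_ne_zero) (dvd_mul_right _ _)
    exact hpl ((Nat.prime_dvd_prime_iff_eq hl hp).1 (Int.natCast_dvd_natCast.1 (hlp.dvd_of_dvd_pow h2))).symm
  have hpx : ¬ (p : ℤ) ∣ x := by
    intro h1
    have h2 : (p : ℤ) ∣ l * y ^ 2 := by
      rw [show l * y ^ 2 = x ^ 2 - p ^ (2 * m + 1) by rw [← hxy]; ring]
      exact dvd_sub (dvd_pow h1 two_ne_zero) hpr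
    rcases hpp.dvd_or_dvd h2 with h3 | h3
    · exact hpl' h3
    · exact hy (hpp.dvd_of_dvd_pow h3)
  have hcl : (p : ℤ) ∣ l - c ^ 2 := by
    have h2 : (p : ℤ) ∣ y ^ 2 * (l - c ^ 2) := by
      rw [show y ^ 2 * (l - c ^ 2) = (x + y * c) * (x - y * c) - p ^ (2 * m + 1) by rw [← hxy]; ring]
      exact dvd_sub (dvd_mul_of_dvd_left hc _) hpr
    rcases hpp.dvd_or_dvd h2 with h3 | h3
    · exact absurd (hpp.dvd_of_dvd_pow h3) hy
    · exact h3
  have hc0 : ¬ (p : ℤ) ∣ c := fun h1 => hpx ((dvd_add_left (dvd_mul_of_dvd_right h1 y)).1 hc)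
  have hz := h.not_dvd hp hcl
  have ht0 := h.sub_pos hx hp0 hxy
  have hnorm := h.norm_eq hxy
  obtain ⟨t, ht⟩ := Int.eq_ofNat_of_zero_le ht0.le
  obtain ⟨X, rfl⟩ := Int.eq_ofNat_of_zero_le hx.le
  rw [ht] at hnorm
  have hpt : ¬ (p : ℤ) ∣ t := by
    intro h1
    rw [← ht, show v * X - u * y = v * (X + y * c) - (u + v * c) * y by ring] at h1
    rcases hpp.dvd_or_dvd ((dvd_sub_right (dvd_mul_of_dvd_right hc v)).1 h1) with h3 | h3
    exacts [hz h3, hy h3]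
  have hcop : ∀ {b : ℕ}, ¬ (p : ℤ) ∣ b → ∀ j, IsCoprime ((p : ℤ) ^ j) b := fun h1 j =>
    ((hpp.coprime_iff_not_dvd).2 h1).pow_left
  obtain ⟨u', hu'⟩ := h.four_dvd_u hl8
  have hv4 := h.v_mod hl8
  have htX : (t : ℤ) % 4 = X % 4 := by
    rw [← ht, hu', show v = 4 * (v / 4) + 1 by omega]
    ring_nf
    omega
  have hXo : Odd X := Nat.odd_iff.2 (by omega)
  have hto : Odd t := Nat.odd_iff.2 (by omega)
  have e1 : J(-p | t) = 1 := by
    refine jacobiSym_eq_one_of_dvd (w := u * X - l * v * y) (y := p ^ m) ?_ ⟨l * t, by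
      linear_combination hnorm⟩
    refine (IsCoprime.pow_left_iff two_pos).1 ?_
    rw [show (u * X - l * v * y) ^ 2 = -(p : ℤ) ^ (2 * m + 1) + t * (l * t) by linear_combination hnorm]
    exact (hcop hpt _).neg_left.add_mul_left_left _
  have e2 : J(-(p * l) | X) = 1 := by
    refine jacobiSym_eq_one_of_dvd (w := p ^ (m + 1)) (y := y) (hcop hpx _) ⟨p * X, by
      linear_combination -p * hxy⟩
  have e3 : J(-1 | t) = J(-1 | X) := by
    rw [jacobiSym.at_neg_one hto, jacobiSym.at_neg_one hXo, ZMod.χ₄_nat_mod_four,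
      ZMod.χ₄_nat_mod_four X, show t % 4 = X % 4 by omega]
  have hl4 : l % 4 = 1 := by omega
  rw [neg_eq_neg_one_mul, jacobiSym.mul_left, e3, jacobiSym.quadratic_reciprocity_one_mod_four hp4 hto] at e1
  rw [neg_eq_neg_one_mul, jacobiSym.mul_left, jacobiSym.mul_left,
    jacobiSym.quadratic_reciprocity_one_mod_four hp4 hXo,
    jacobiSym.quadratic_reciprocity_one_mod_four hl4 hXo] at e2
  have em : J(-1 | p) = 1 := by
    rw [jacobiSym.at_neg_one (Nat.odd_iff.2 (by omega)), ZMod.χ₄_nat_one_mod_four hp4]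
  have e4 : J(u + v * c | p) * J(y | p) = J(t | p) := by
    rw [← jacobiSym.mul_left, ← one_mul J((t : ℤ) | p), ← em, ← jacobiSym.mul_left]
    refine jacobiSym.mod_left' (Int.modEq_iff_dvd.2 ?_)
    rw [← ht]
    obtain ⟨d, hd⟩ := hc
    exact ⟨-v * d, by linear_combination -v * hd⟩
  have e5 : J(c | p) * J(y | p) = J(X | p) := by
    rw [← jacobiSym.mul_left, ← one_mul J((X : ℤ) | p), ← em, ← jacobiSym.mul_left]
    refine jacobiSym.mod_left' (Int.modEq_iff_dvd.2 ?_)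
    obtain ⟨d, hd⟩ := hc
    exact ⟨-d, by linear_combination -hd⟩
  have hne : ∀ {q : ℕ} {z : ℤ}, ¬ (q : ℤ) ∣ z → (z : ZMod q) ≠ 0 := fun h1 h2 =>
    h1 ((ZMod.intCast_zmod_eq_zero_iff_dvd _ _).1 h2)
  have q1 : quartSym l p = J(X | l) := by
    rw [quartSym_eq_legendreSym hl4 ⟨m, rfl⟩ (hne hxl), jacobiSym.legendreSym.to_jacobiSym]
    have := congrArg (Int.cast : ℤ → ZMod l) hxy
    push_cast at this ⊢
    rw [← this, ZMod.natCast_self]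
    ring
  have q2 : quartSym p l = J(c | p) := by
    rw [quartSym_eq_legendreSym hp4 odd_one (hne hc0), jacobiSym.legendreSym.to_jacobiSym]
    have := (ZMod.intCast_zmod_eq_zero_iff_dvd _ _).2 hcl
    push_cast at this ⊢
    linear_combination this
  rw [q1, q2, ← legendreSym.eq_one_iff p (hne hz), jacobiSym.legendreSym.to_jacobiSym]
  have tri : ∀ a : ℤ, J(a | p) = 0 ∨ J(a | p) = 1 ∨ J(a | p) = -1 := fun a => jacobiSym.trichotomy a p
  have hyy : J(y | p) = 1 ∨ J(y | p) = -1 := by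
    rw [← jacobiSym.legendreSym.to_jacobiSym]
    exact legendreSym.eq_one_or_neg_one p (hne hy)
  rcases hyy with h1 | h1 <;> rw [h1] at e4 e5 <;>
    rcases jacobiSym.trichotomy (-1) X with h2 | h2 | h2 <;> rw [h2] at e1 e2 <;>
    rcases tri c with h3 | h3 | h3 <;> rw [h3] at e5 ⊢ <;> rw [← e5] at e2 <;> rw [← e4] at e1 <;>
    constructor <;> intro <;> linarith

theorem isSquare_iff (hl : l.Prime) (hl8 : l % 8 = 1) {p : ℕ} (hp : p.Prime) (hp4 : p % 4 = 1)
    (hpl : p ≠ l) {r : ℕ} (hr : Odd r) {x y c : ℤ} (hxy : x ^ 2 - l * y ^ 2 = p ^ r) (hy : ¬ (p : ℤ) ∣ y)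
    (hc : (p : ℤ) ∣ x + y * c) : IsSquare ((u + v * c : ℤ) : ZMod p) ↔ quartSym l p = quartSym p l := by
  have hp0 : (0 : ℤ) < p ^ r := by have := hp.pos; positivity
  rcases lt_trichotomy x 0 with hx | rfl | hx
  · refine h.isSquare_iff_of_pos hl hl8 hp hp4 hpl hr (x := -x) (y := -y) (by linarith)
      (by rw [← hxy]; ring) (by rwa [dvd_neg]) ?_
    rw [show -x + -y * c = -(x + y * c) by ring]
    rwa [dvd_neg]
  · have : (0 : ℤ) ≤ l * y ^ 2 := by positivity
    linarith
  · exact h.isSquare_iff_of_pos hl hl8 hp hp4 hpl hr hx hxy hy hc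

open scoped NumberTheorySymbols in
set_option maxHeartbeats 1000000 in
theorem mod_eight_iff_of_pos (hl : l.Prime) (hl8 : l % 8 = 1) {m : ℕ} {x y c : ℤ} (hx : 0 < x)
    (hxo : x % 2 = 1) (hyo : y % 2 = 1) (hxy : x ^ 2 - l * y ^ 2 = 2 ^ (2 * m + 5))
    (hc : (8 : ℤ) ∣ x + y * c) :
    ((u + v * c) % 8 = 1 ∨ (u + v * c) % 8 = 7) ↔ quartSym l 2 = (-1) ^ ((l - 1) / 8) := by
  have := Fact.mk hl
  have hlp : Prime (l : ℤ) := Nat.prime_iff_prime_int.1 hl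
  have hl4 : l % 4 = 1 := by omega
  have hl2 : ¬ l ∣ 2 := fun h1 => by have := Nat.le_of_dvd two_pos h1; have := hl.two_le; omega
  have ht0 := h.sub_pos hx (by positivity) hxy
  have hnorm := h.norm_eq hxy
  obtain ⟨t, ht⟩ := Int.eq_ofNat_of_zero_le ht0.le
  obtain ⟨X, rfl⟩ := Int.eq_ofNat_of_zero_le hx.le
  rw [ht] at hnorm
  have hxl : ¬ (l : ℤ) ∣ X := by
    intro h1
    have h2 : (l : ℤ) ∣ 2 ^ (2 * m + 5) := by
      rw [← hxy]
      exact dvd_sub (dvd_pow h1 two_ne_zero) (dvd_mul_right _ _)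
    exact hl2 (Int.natCast_dvd_natCast.1 (hlp.dvd_of_dvd_pow h2))
  obtain ⟨u', hu'⟩ := h.four_dvd_u hl8
  have hv4 := h.v_mod hl8
  have htX : (t : ℤ) % 4 = X % 4 := by
    rw [← ht, hu', show v = 4 * (v / 4) + 1 by omega]
    ring_nf
    omega
  have hXo : Odd X := Nat.odd_iff.2 (by omega)
  have hto : Odd t := Nat.odd_iff.2 (by omega)
  have hcop : ∀ {b : ℕ}, Odd b → ∀ j, IsCoprime ((2 : ℤ) ^ j) b := fun h1 j => by
    refine IsCoprime.pow_left ?_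
    exact_mod_cast Nat.isCoprime_iff_coprime.2 (Nat.coprime_two_left.2 h1)
  have e1 : J(-2 | t) = 1 := by
    refine jacobiSym_eq_one_of_dvd (w := u * X - l * v * y) (y := 2 ^ (m + 2)) ?_ ⟨l * t, by
      linear_combination hnorm⟩
    refine (IsCoprime.pow_left_iff two_pos).1 ?_
    rw [show (u * X - l * v * y) ^ 2 = -(2 : ℤ) ^ (2 * m + 5) + t * (l * t) by linear_combination hnorm]
    exact (hcop hto _).neg_left.add_mul_left_left _
  have e2 : J(-2 * l | X) = 1 := by
    refine jacobiSym_eq_one_of_dvd (w := 2 ^ (m + 3)) (y := y) (hcop hXo _) ⟨2 * X, by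
      linear_combination -2 * hxy⟩
  rw [jacobiSym.mul_left, jacobiSym.quadratic_reciprocity_one_mod_four hl4 hXo, jacobiSym.at_neg_two hXo] at e2
  rw [jacobiSym.at_neg_two hto] at e1
  have q1 : quartSym l 2 = J(X | l) := by
    rw [quartSym_eq_legendreSym (h := 2 * m + 5) hl4 ⟨m + 2, by ring⟩ (x := X)
      (fun h1 => hxl ((ZMod.intCast_zmod_eq_zero_iff_dvd _ _).1 h1)), jacobiSym.legendreSym.to_jacobiSym]
    have := congrArg (Int.cast : ℤ → ZMod l) hxy
    push_cast at this ⊢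
    rw [← this, ZMod.natCast_self]
    ring
  rw [q1]
  have f0 : (t % 8 = 1 ∨ t % 8 = 3) := by
    rw [ZMod.χ₈'_nat_eq_if_mod_eight] at e1
    rw [if_neg (by omega)] at e1
    by_contra h1
    rw [if_neg h1] at e1
    linarith
  have f1 : J(X | l) = if X % 8 = 1 ∨ X % 8 = 3 then 1 else -1 := by
    rw [ZMod.χ₈'_nat_eq_if_mod_eight, if_neg (by omega)] at e2
    split_ifs at e2 ⊢ <;> linarith
  have f2 : l % 16 = 1 ↔ ((X % 8 = 1 ∨ X % 8 = 7) ↔ (y % 8 = 1 ∨ y % 8 = 7)) := by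
    have h1 : ((X : ℤ) ^ 2 - l * y ^ 2) % 16 = 0 := by
      rw [hxy]
      exact Int.emod_eq_zero_of_dvd ⟨2 ^ (2 * m + 1), by ring⟩
    obtain ⟨L, hL⟩ : ∃ L : ℤ, (l : ℤ) = 8 * L + 1 := ⟨l / 8, by omega⟩
    have hL2 : L % 2 = 0 ∨ L % 2 = 1 := by omega
    obtain ⟨w, hw⟩ : ∃ w, y ^ 2 = 2 * w + 1 := by
      rcases Int.sq_mod_sixteen hyo with h | h <;> exact ⟨y ^ 2 / 2, by omega⟩
    have h2 : (l : ℤ) * y ^ 2 = 16 * (L * w) + 8 * L + y ^ 2 := by rw [hL]; linear_combination 8 * L * hw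
    rw [h2] at h1
    have hX := Int.sq_mod_sixteen hxo
    have hy := Int.sq_mod_sixteen hyo
    generalize (X : ℤ) ^ 2 = A at *
    generalize y ^ 2 = B at *
    generalize L * w = C at *
    rcases hX with ⟨hX, hX'⟩ | ⟨hX, hX'⟩ <;> rcases hy with ⟨hy, hy'⟩ | ⟨hy, hy'⟩ <;> omega
  have f3 : ((u + v * c) % 8 = 1 ∨ (u + v * c) % 8 = 7) ↔ ((y % 8 = 1 ∨ y % 8 = 7) ↔ (t % 8 = 1 ∨ t % 8 = 7)) := by
    have h1 : (8 : ℤ) ∣ (u + v * c) * y + t := by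
      rw [← ht, show (u + v * c) * y + (v * X - u * y) = v * (X + y * c) by ring]
      exact dvd_mul_of_dvd_right hc v
    have h2 := Int.mod_eight_mul hyo h1 (by omega)
    omega
  have f4 : ((-1 : ℤ) ^ ((l - 1) / 8)) = if l % 16 = 1 then 1 else -1 := by
    split_ifs with h1
    · exact Even.neg_one_pow (Nat.even_iff.2 (by omega))
    · exact Odd.neg_one_pow (Nat.odd_iff.2 (by omega))
  rw [f3, f1, f4]
  have h3 : t % 4 = X % 4 := by omega
  have h4 : X % 2 = 1 := by omega
  clear * - f0 f2 h3 h4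
  by_cases hY : y % 8 = 1 ∨ y % 8 = 7 <;> simp only [hY, iff_true, iff_false, true_iff, false_iff] at f2 ⊢ <;>
    split_ifs with h1 h2 h2 <;> simp <;> omega

theorem mod_eight_iff (hl : l.Prime) (hl8 : l % 8 = 1) {m : ℕ} {x y c : ℤ}
    (hxo : x % 2 = 1) (hyo : y % 2 = 1) (hxy : x ^ 2 - l * y ^ 2 = 2 ^ (2 * m + 5))
    (hc : (8 : ℤ) ∣ x + y * c) :
    ((u + v * c) % 8 = 1 ∨ (u + v * c) % 8 = 7) ↔ quartSym l 2 = (-1) ^ ((l - 1) / 8) := by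
  rcases lt_trichotomy x 0 with hx | rfl | hx
  · refine h.mod_eight_iff_of_pos hl hl8 (x := -x) (y := -y) (m := m) (by linarith) (by omega) (by omega)
      (by rw [← hxy]; ring) ?_
    rw [show -x + -y * c = -(x + y * c) by ring]
    rwa [dvd_neg]
  · omega
  · exact h.mod_eight_iff_of_pos hl hl8 hx hxo hyo hxy hc

end NegPell

theorem legSym_eq_one_iff {l p : ℕ} (hl : l.Prime) (hl8 : l % 8 = 1) (hp : p.Prime) (hp2 : p ≠ 2) (hpl : p ≠ l) :
    legSym l p = 1 ↔ IsSquare (l : ZMod p) := by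
  have := Fact.mk hl
  have := Fact.mk hp
  rw [← ZMod.exists_sq_eq_prime_iff_of_mod_four_eq_one (p := l) (q := p) (by omega) hp2]
  have h0 : (p : ZMod l) ≠ 0 := fun h0 =>
    hpl ((Nat.prime_dvd_prime_iff_eq hl hp).1 ((ZMod.natCast_eq_zero_iff _ _).1 h0)).symm
  rw [ZMod.euler_criterion l h0, legSym, show l / 2 = (l - 1) / 2 by omega]
  push_cast
  split_ifs <;> simp_all

theorem legSym_eq_neg_one_iff {l p : ℕ} (hl : l.Prime) (hl8 : l % 8 = 1) (hp : p.Prime) (hp2 : p ≠ 2)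
    (hpl : p ≠ l) : legSym l p = -1 ↔ ¬ IsSquare (l : ZMod p) := by
  rw [← legSym_eq_one_iff hl hl8 hp hp2 hpl]
  have h0 : (p : ZMod l) ≠ 0 := fun h0 =>
    hpl ((Nat.prime_dvd_prime_iff_eq hl hp).1 ((ZMod.natCast_eq_zero_iff _ _).1 h0)).symm
  unfold legSym
  push_cast
  split_ifs <;> simp_all

namespace IsDedekindDomain.HeightOneSpectrum

variable {R K : Type*} [CommRing R] [IsDedekindDomain R] [Field K] [Algebra R K] [IsFractionRing R K]
  (v : HeightOneSpectrum R)

/-- The elements of order at least `j` at `v`. -/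
noncomputable def ball (j : ℤ) : AddSubgroup K where
  carrier := {x | x = 0 ∨ j ≤ v.ord x}
  zero_mem' := Or.inl rfl
  add_mem' {x y} hx hy := by
    by_cases h : x + y = 0
    · exact Or.inl h
    · exact Or.inr (v.ord_add h hx hy)
  neg_mem' {x} hx := by
    rcases hx with rfl | hx
    · exact Or.inl neg_zero
    · exact Or.inr (by rwa [ord_neg])

variable {v}

theorem mem_ball {j : ℤ} {x : K} : x ∈ v.ball j ↔ x = 0 ∨ j ≤ v.ord x := Iff.rfl

theorem mem_ball' {j : ℤ} {x : K} (hx : x ≠ 0) : x ∈ v.ball j ↔ j ≤ v.ord x := by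
  rw [mem_ball]; simp [hx]

theorem ball_mono {i j : ℤ} (h : i ≤ j) {x : K} (hx : x ∈ v.ball j) : x ∈ v.ball i :=
  hx.imp_right h.trans

theorem mul_mem_ball {i j : ℤ} {x y : K} (hx : x ∈ v.ball i) (hy : y ∈ v.ball j) : x * y ∈ v.ball (i + j) := by
  by_cases hx0 : x = 0
  · exact Or.inl (by rw [hx0, zero_mul])
  by_cases hy0 : y = 0
  · exact Or.inl (by rw [hy0, mul_zero])
  rw [mem_ball' hx0] at hx
  rw [mem_ball' hy0] at hy
  exact Or.inr (by rw [v.ord_mul hx0 hy0]; linarith)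

theorem mul_mem_ball_left {j : ℤ} {x y : K} (hx : x ∈ v.ball 0) (hy : y ∈ v.ball j) : x * y ∈ v.ball j := by
  simpa using mul_mem_ball hx hy

theorem algebraMap_mem_ball (r : R) : algebraMap R K r ∈ v.ball (K := K) 0 :=
  (Or.inr (v.ord_nonneg (K := K) r) : algebraMap R K r = 0 ∨ _)

theorem algebraMap_mem_ball_iff {r : R} (n : ℕ) : algebraMap R K r ∈ v.ball (K := K) (n : ℤ) ↔ r ∈ v.asIdeal ^ n := by
  by_cases hr : r = 0
  · rw [hr, map_zero]; simp
  · rw [mem_ball' (by simpa using hr), v.mem_pow_iff_ord (K := K) hr]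

theorem algebraMap_mem_ball_one {r : R} : algebraMap R K r ∈ v.ball 1 ↔ r ∈ v.asIdeal := by
  have := algebraMap_mem_ball_iff (v := v) (K := K) (r := r) 1
  rwa [pow_one] at this

theorem intCast_mem_ball (m : ℤ) : (m : K) ∈ v.ball 0 := by
  rw [← map_intCast (algebraMap R K)]
  exact algebraMap_mem_ball _

/-- Elements integral at `v` are congruent to integral elements. -/
theorem exists_sub_mem_ball {x : K} (hx : x ∈ v.ball 0) : ∃ r : R, x - algebraMap R K r ∈ v.ball 1 := by
  by_cases hx0 : x = 0
  · exact ⟨0, Or.inl (by simp [hx0])⟩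
  obtain ⟨a, b, hb, rfl⟩ := IsFractionRing.div_surjective (A := R) x
  have hb0 : b ≠ 0 := nonZeroDivisors.ne_zero hb
  have ha0 : a ≠ 0 := fun h => hx0 (by rw [h, map_zero, zero_div])
  have ha0' : algebraMap R K a ≠ 0 := by simpa using ha0
  have hb0' : algebraMap R K b ≠ 0 := by simpa using hb0
  rw [mem_ball' hx0, v.ord_div ha0' hb0'] at hx
  obtain ⟨n, hn⟩ := Int.eq_ofNat_of_zero_le (v.ord_nonneg (K := K) b)
  obtain ⟨r, e, he, h⟩ := Ideal.exists_mul_add_mem_pow_succ (P := v.asIdeal) v.ne_bot (i := n) b a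
    ((v.mem_pow_iff_ord (K := K) hb0 n).2 hn.ge)
    (fun h => by have := (v.mem_pow_iff_ord (K := K) hb0 (n + 1)).1 h; push_cast at this; omega)
    ((v.mem_pow_iff_ord (K := K) ha0 n).2 (by omega))
  refine ⟨r, ?_⟩
  have h1 : algebraMap R K a / algebraMap R K b - algebraMap R K r = (algebraMap R K b)⁻¹ * algebraMap R K e := by
    rw [← h, map_add, map_mul]; field_simp; ring
  rw [h1]
  have h2 : (algebraMap R K b)⁻¹ ∈ v.ball (-n) := Or.inr (by rw [ord_inv, hn])
  have h3 := mul_mem_ball h2 ((algebraMap_mem_ball_iff (K := K) (n + 1)).2 he)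
  simpa using h3

/-- If a `v`-unit is a value of `x ^ 2 - d y ^ 2` and `d` has odd order, then `x` and `y` are
integral at `v`. -/
theorem mem_ball_of_sq_sub {w d a b : K} (hd : Odd (v.ord d)) (hd0 : d ≠ 0) (hw : w ∈ v.ball 0)
    (h : w = a ^ 2 - d * b ^ 2) : a ∈ v.ball 0 ∧ d * b ^ 2 ∈ v.ball 0 := by
  by_cases ha : a = 0
  · refine ⟨Or.inl ha, ?_⟩
    rw [ha] at h
    rw [show d * b ^ 2 = -w by rw [h]; ring]
    exact neg_mem hw
  by_cases hb : b = 0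
  · refine ⟨?_, by rw [hb]; simp⟩
    rw [hb] at h
    rw [mem_ball' ha]
    rw [h, show a ^ 2 - d * 0 ^ 2 = a ^ 2 by ring, mem_ball' (pow_ne_zero 2 ha), ord_pow] at hw
    push_cast at hw
    linarith
  have hdb0 : d * b ^ 2 ≠ 0 := mul_ne_zero hd0 (pow_ne_zero 2 hb)
  have hab : v.ord (a ^ 2) = 2 * v.ord a := by rw [ord_pow]; norm_num
  have hdb : v.ord (d * b ^ 2) = v.ord d + 2 * v.ord b := by rw [ord_mul v hd0 (pow_ne_zero 2 hb), ord_pow]; norm_num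
  obtain ⟨m, hm⟩ := hd
  have h1 : 0 ≤ v.ord (a ^ 2) := by
    by_contra! hneg
    rcases lt_trichotomy (v.ord (a ^ 2)) (v.ord (d * b ^ 2)) with h2 | h2 | h2
    · have h3 : a ^ 2 ∈ v.ball (v.ord (a ^ 2) + 1) := by
        have := add_mem (ball_mono (by omega : v.ord (a ^ 2) + 1 ≤ 0) hw)
          ((mem_ball' hdb0).2 (by omega : v.ord (a ^ 2) + 1 ≤ _))
        rwa [show w + d * b ^ 2 = a ^ 2 by rw [h]; ring] at this
      rw [mem_ball' (pow_ne_zero 2 ha)] at h3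
      omega
    · omega
    · have h3 : d * b ^ 2 ∈ v.ball (v.ord (d * b ^ 2) + 1) := by
        have := sub_mem ((mem_ball' (pow_ne_zero 2 ha)).2 (by omega : v.ord (d * b ^ 2) + 1 ≤ _))
          (ball_mono (by omega : v.ord (d * b ^ 2) + 1 ≤ 0) hw)
        rwa [show a ^ 2 - w = d * b ^ 2 by rw [h]; ring] at this
      rw [mem_ball' hdb0] at h3
      omega
  refine ⟨(mem_ball' ha).2 (by omega), ?_⟩
  rw [show d * b ^ 2 = a ^ 2 - w by rw [h]; ring]
  exact sub_mem (Or.inr h1) hw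

theorem mem_ball_one_of_sq_sub {w d a b : K} (hd : v.ord d = 1) (hd0 : d ≠ 0) (hw : w ∈ v.ball 0)
    (h : w = a ^ 2 - d * b ^ 2) : a ∈ v.ball 0 ∧ b ∈ v.ball 0 := by
  obtain ⟨h1, h2⟩ := mem_ball_of_sq_sub (hd ▸ odd_one) hd0 hw h
  refine ⟨h1, ?_⟩
  by_cases hb : b = 0
  · exact Or.inl hb
  rw [mem_ball' (mul_ne_zero hd0 (pow_ne_zero 2 hb)), ord_mul v hd0 (pow_ne_zero 2 hb), ord_pow, hd] at h2
  rw [mem_ball' hb]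
  push_cast at h2
  omega

theorem exists_sq_congr {w : R} {d a b : K} (hd : v.ord d = 1) (hd0 : d ≠ 0)
    (h : algebraMap R K w = a ^ 2 - d * b ^ 2) : ∃ A : R, w - A ^ 2 ∈ v.asIdeal := by
  obtain ⟨ha, hb⟩ := mem_ball_one_of_sq_sub hd hd0 (algebraMap_mem_ball w) h
  obtain ⟨A, hA⟩ := exists_sub_mem_ball ha
  refine ⟨A, ?_⟩
  rw [← algebraMap_mem_ball_one (K := K), map_sub, map_pow, h]
  have h1 : d * b ^ 2 ∈ v.ball 1 := by
    rw [mul_comm, pow_two]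
    exact mul_mem_ball_left (mul_mem_ball_left hb hb) ((mem_ball' hd0).2 hd.ge)
  have h2 := sub_mem (mul_mem_ball_left (add_mem ha (algebraMap_mem_ball A)) hA) h1
  convert h2 using 1
  ring

end IsDedekindDomain.HeightOneSpectrum

namespace QuadExt

variable {k F : Type*} [Field k] [NumberField k] [Field F] [NumberField F] [Algebra k F]
  [Algebra.IsQuadraticExtension k F]

/-- `r` is a square root of `d` generating `F` over `k`, and `σ` is the conjugation. -/
structure Gen (σ : Gal(F/k)) (r : F) (d : 𝓞 k) : Prop where
  sq : r ^ 2 = algebraMap k F d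
  conj_r : σ r = -r
  ne : r ≠ 0

namespace Gen

theorem exists_of_not_isSquare {r : F} {d : 𝓞 k} (hr : r ^ 2 = algebraMap k F d)
    (hd : ∀ x : k, x ^ 2 ≠ d) : ∃ σ : Gal(F/k), Gen σ r d := by
  obtain ⟨σ, hσ⟩ := exists_gal (k := k) (F := F)
  refine ⟨σ, hr, ?_, ?_⟩
  · have h1 : (σ r) ^ 2 = r ^ 2 := by rw [← map_pow, hr, AlgEquiv.commutes]
    rcases sq_eq_sq_iff_eq_or_eq_neg.1 h1 with h | h
    · obtain ⟨a, ha⟩ := mem_range_of_fixed hσ h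
      exact (hd a ((algebraMap k F).injective (by rw [map_pow, ha, hr]))).elim
    · exact h
  · rintro rfl
    refine hd 0 ((algebraMap k F).injective ?_)
    rw [← hr, map_pow, map_zero]

variable {σ : Gal(F/k)} {r : F} {d : 𝓞 k} (h : Gen σ r d)
include h

theorem ne_one : σ ≠ 1 := by
  rintro rfl
  have h1 : r = -r := h.conj_r
  exact h.ne (self_eq_neg.1 h1)

theorem exists_coords (x : F) : ∃ a b : k, x = algebraMap k F a + algebraMap k F b * r := by
  obtain ⟨a, ha⟩ := mem_range_of_fixed h.ne_one (x := (x + σ x) / 2)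
    (by rw [map_div₀, map_add, gal_involutive h.ne_one, map_ofNat, add_comm])
  obtain ⟨b, hb⟩ := mem_range_of_fixed h.ne_one (x := (x - σ x) / (2 * r))
    (by
      rw [map_div₀, map_sub, gal_involutive h.ne_one, map_mul, map_ofNat, h.conj_r]
      rw [mul_neg, div_neg, ← neg_div, neg_sub])
  refine ⟨a, b, ?_⟩
  rw [ha, hb]
  have := h.ne
  field_simp
  ring

theorem norm_eq (a b : k) : Algebra.norm k (algebraMap k F a + algebraMap k F b * r) = a ^ 2 - d * b ^ 2 := by
  apply (algebraMap k F).injective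
  rw [algebraMap_norm h.ne_one, map_add, map_mul, AlgEquiv.commutes, AlgEquiv.commutes, h.conj_r,
    map_sub, map_mul, map_pow, map_pow, ← h.sq]
  ring

theorem norm_iff {c : k} : (∃ x : F, Algebra.norm k x = c) ↔ ∃ a b : k, c = a ^ 2 - d * b ^ 2 := by
  constructor
  · rintro ⟨x, rfl⟩
    obtain ⟨a, b, rfl⟩ := h.exists_coords x
    exact ⟨a, b, h.norm_eq a b⟩
  · rintro ⟨a, b, rfl⟩
    exact ⟨_, h.norm_eq a b⟩

theorem mem_normUnits_iff {w : (𝓞 k)ˣ} : w ∈ normUnits k F ↔ ∃ a b : k, ((w : 𝓞 k) : k) = a ^ 2 - d * b ^ 2 := by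
  rw [mem_normUnits]
  exact h.norm_iff

theorem isIntegral : IsIntegral ℤ r :=
  IsIntegral.of_pow two_pos (by
    rw [h.sq]
    exact (RingOfIntegers.isIntegral_coe d).algebraMap)

theorem ram_eq_one_of_odd {v : HeightOneSpectrum (𝓞 k)} (hd : d ∉ v.asIdeal) (h2 : (2 : 𝓞 k) ∉ v.asIdeal) :
    ram F v = 1 := by
  refine ram_eq_one_of_disc σ (⟨r, h.isIntegral⟩ : 𝓞 F) v (2 ^ 2 * d) ?_ ?_
  · change (r - σ r) ^ 2 = _
    rw [h.conj_r]
    change _ = algebraMap k F (algebraMap (𝓞 k) k (2 ^ 2 * d))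
    rw [map_mul, map_mul, map_pow, map_pow, map_ofNat, map_ofNat]
    change _ = 2 ^ 2 * algebraMap k F (d : k)
    rw [← h.sq]
    ring
  · intro hmem
    rcases v.isPrime.mem_or_mem hmem with h1 | h1
    · exact h2 (v.isPrime.mem_of_pow_mem _ h1)
    · exact hd h1

theorem ram_eq_one_of_quadratic {v : HeightOneSpectrum (𝓞 k)} {t e : 𝓞 k} (ht : t ∉ v.asIdeal)
    (hd : d ∉ v.asIdeal) (he : t ^ 2 * (1 - d) = 4 * e) : ram F v = 1 := by
  have he' : algebraMap k F t ^ 2 * (1 - r ^ 2) = 4 * algebraMap k F e := by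
    have := congrArg (fun x : 𝓞 k => algebraMap k F (algebraMap (𝓞 k) k x)) he
    simp only [map_mul, map_sub, map_pow, map_one, map_ofNat] at this
    rw [h.sq]
    exact this
  have hInt : IsIntegral ℤ (algebraMap k F t * (1 + r) / 2) := by
    have htI : IsIntegral ℤ (algebraMap k F t) := (RingOfIntegers.isIntegral_coe t).algebraMap
    have heI : IsIntegral ℤ (algebraMap k F e) := (RingOfIntegers.isIntegral_coe e).algebraMap
    have hI : IsIntegral (𝓞 k) (algebraMap k F t * (1 + r) / 2) := by
      refine ⟨Polynomial.X ^ 2 + (Polynomial.C (-t) * Polynomial.X + Polynomial.C e), ?_, ?_⟩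
      · monicity!
      · simp only [Polynomial.eval₂_add, Polynomial.eval₂_mul, Polynomial.eval₂_pow, Polynomial.eval₂_X,
          Polynomial.eval₂_C]
        have h1 : algebraMap (𝓞 k) F (-t) = - algebraMap k F t := by
          rw [map_neg]; rfl
        have h2 : algebraMap (𝓞 k) F e = algebraMap k F e := rfl
        rw [h1, h2]
        linear_combination (-1/4 : F) * he'
    exact isIntegral_trans (R := ℤ) (A := 𝓞 k) _ hI
  refine ram_eq_one_of_disc σ (⟨_, hInt⟩ : 𝓞 F) v (t ^ 2 * d) ?_ ?_
  · change (_ - σ (algebraMap k F t * (1 + r) / 2)) ^ 2 = algebraMap k F (algebraMap (𝓞 k) k (t ^ 2 * d))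
    rw [map_div₀, map_mul, map_add, map_one, map_ofNat, h.conj_r, AlgEquiv.commutes, map_mul, map_mul, map_pow, map_pow]
    change (algebraMap k F t * (1 + r) / 2 - _) ^ 2 = (algebraMap k F t) ^ 2 * algebraMap k F (d : k)
    rw [← h.sq]
    ring
  · intro hmem
    rcases v.isPrime.mem_or_mem hmem with h1 | h1
    · exact ht (v.isPrime.mem_of_pow_mem _ h1)
    · exact hd h1

theorem ram_eq_two_of {v : HeightOneSpectrum (𝓞 k)} (h2 : (2 : 𝓞 k) ∈ v.asIdeal)
    (hv : v.ord (1 - d : k) = 1) : ram F v = 2 := by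
  refine (ram_eq_one_or_two v).resolve_left fun h1 => ?_
  obtain ⟨w, hw⟩ := exists_over (F := F) v
  set z : 𝓞 F := ⟨1 + r, isIntegral_one.add h.isIntegral⟩ with hz
  have hzn : Algebra.norm k (z : F) = 1 - d := by
    have := h.norm_eq 1 1
    rw [map_one, one_mul, one_pow, mul_one] at this
    exact this
  have hz0 : (z : F) ≠ 0 := fun h0 => by
    rw [h0, Algebra.norm_zero] at hzn
    rw [← hzn, HeightOneSpectrum.ord_zero] at hv
    omega
  have h3 := ram_mul_ord_norm h.ne_one v w hz0
  rw [h1, hzn, hv] at h3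
  have h4 : (conj σ w).ord (σ (σ (z : F))) = w.ord (σ (z : F)) := ord_conj σ w _
  rw [gal_involutive h.ne_one] at h4
  set z' : 𝓞 F := ⟨1 - r, isIntegral_one.sub h.isIntegral⟩ with hz'
  have hzz : σ (z : F) = z' := by
    change σ (1 + r) = 1 - r
    rw [map_add, map_one, h.conj_r]
    ring
  have h2w : (2 : 𝓞 F) ∈ w.asIdeal := by
    have : (2 : 𝓞 k) ∈ w.asIdeal.under (𝓞 k) := by rwa [← hw.over]
    rw [Ideal.mem_comap, map_ofNat] at this
    exact this
  have hsub : z - z' ∈ w.asIdeal := by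
    obtain ⟨ρ, hρ⟩ : ∃ ρ : 𝓞 F, algebraMap (𝓞 F) F ρ = r := ⟨⟨r, h.isIntegral⟩, rfl⟩
    have : z - z' = 2 * ρ := by
      apply FaithfulSMul.algebraMap_injective (𝓞 F) F
      rw [map_mul, map_ofNat, hρ, map_sub]
      change (1 + r) - (1 - r) = _
      ring
    rw [this]
    exact w.asIdeal.mul_mem_right _ h2w
  have hiff : z ∈ w.asIdeal ↔ z' ∈ w.asIdeal :=
    ⟨fun h => by simpa using sub_mem h hsub, fun h => by simpa using add_mem h hsub⟩
  have hz0' : z ≠ 0 := fun h0 => hz0 (by rw [h0]; rfl)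
  have hz'0 : z' ≠ 0 := fun h0 => by
    rw [h0] at hzz
    exact hz0 (σ.injective (by rw [hzz, map_zero]; rfl))
  rw [HeightOneSpectrum.mem_iff_ord (K := F) w hz0', HeightOneSpectrum.mem_iff_ord (K := F) w hz'0] at hiff
  have e1 := HeightOneSpectrum.ord_nonneg (K := F) w z
  have e2 := HeightOneSpectrum.ord_nonneg (K := F) w z'
  rw [hzz] at h4
  have h5 : w.ord (z : F) = w.ord (algebraMap (𝓞 F) F z) := rfl
  have h6 : w.ord (z' : F) = w.ord (algebraMap (𝓞 F) F z') := rfl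
  rw [h4, h5, h6] at h3
  push_cast at h3
  omega

end Gen

/-- A quadratic extension generated by a given square root. -/
theorem exists_quadExt.{u} {k : Type u} [Field k] [NumberField k] (d : 𝓞 k) (hd : ∀ x : k, x ^ 2 ≠ d) :
    ∃ (F : Type u) (_ : Field F) (_ : NumberField F) (_ : Algebra k F) (_ : Algebra.IsQuadraticExtension k F)
      (σ : Gal(F/k)) (r : F), Gen σ r d := by
  have hirr : Irreducible (Polynomial.X ^ 2 - Polynomial.C (d : k)) := by
    rw [X_pow_sub_C_irreducible_iff_of_prime Nat.prime_two]
    exact hd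
  have : Fact (Irreducible (Polynomial.X ^ 2 - Polynomial.C (d : k))) := ⟨hirr⟩
  set f := (Polynomial.X ^ 2 - Polynomial.C (d : k)) with hf
  have hdeg : f.natDegree = 2 := Polynomial.natDegree_X_pow_sub_C
  have hfin : Module.finrank k (AdjoinRoot f) = 2 := by
    rw [(AdjoinRoot.powerBasis hirr.ne_zero).finrank, AdjoinRoot.powerBasis_dim, hdeg]
  have : FiniteDimensional k (AdjoinRoot f) := Module.finite_of_finrank_pos (by omega)
  have : CharZero (AdjoinRoot f) := charZero_of_injective_algebraMap (algebraMap k (AdjoinRoot f)).injective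
  have : NumberField (AdjoinRoot f) := { to_charZero := inferInstance, to_finiteDimensional := Module.Finite.trans k _ }
  have : Algebra.IsQuadraticExtension k (AdjoinRoot f) := { finrank_eq_two' := hfin }
  have hr : (AdjoinRoot.root f) ^ 2 = algebraMap k (AdjoinRoot f) d := by
    have := AdjoinRoot.eval₂_root f
    rw [hf, Polynomial.eval₂_sub, Polynomial.eval₂_pow, Polynomial.eval₂_X, Polynomial.eval₂_C, sub_eq_zero] at this
    exact this
  obtain ⟨σ, hσ⟩ := Gen.exists_of_not_isSquare hr hd
  exact ⟨AdjoinRoot f, inferInstance, inferInstance, inferInstance, inferInstance, σ, _, hσ⟩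

end QuadExt

section

namespace IsDedekindDomain.HeightOneSpectrum

variable {k : Type*} [Field k] [NumberField k]

/-- An unramified prime of degree one above `p`. -/
structure IsDegOne (v : HeightOneSpectrum (𝓞 k)) (p : ℕ) : Prop where
  prime : p.Prime
  above : Above v p
  ord : v.ord (p : k) = 1
  exists_int : ∀ x : 𝓞 k, ∃ m : ℤ, x - m ∈ v.asIdeal

theorem intCast_mem_ball_iff {v : HeightOneSpectrum (𝓞 k)} {p : ℕ} (hp : p.Prime) (hv : Above v p)
    (ho : v.ord (p : k) = 1) {z : ℤ} (j : ℕ) : (z : k) ∈ v.ball (j : ℤ) ↔ (p : ℤ) ^ j ∣ z := by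
  by_cases hz : z = 0
  · simp [hz]
  obtain ⟨m, z', hz', rfl⟩ := WfDvdMonoid.max_power_factor hz (Nat.prime_iff_prime_int.1 hp).irreducible
  have hz0 : z' ≠ 0 := fun h => hz' (h ▸ dvd_zero _)
  have hp0 : (p : k) ≠ 0 := by exact_mod_cast hp.ne_zero
  have h1 : v.ord ((z' : ℤ) : k) = 0 := by
    have := ord_eq_zero_of_notMem (K := k) (v := v) (r := (z' : 𝓞 k)) (fun h => hz' ((hv z').1 h))
    simpa using this
  rw [mem_ball' (by exact_mod_cast hz)]
  push_cast
  rw [ord_mul v (pow_ne_zero _ hp0) (by exact_mod_cast hz0), ord_pow, ho, h1]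
  have hp0' : (p : ℤ) ≠ 0 := by exact_mod_cast hp.ne_zero
  constructor
  · intro h
    exact (pow_dvd_pow _ (by omega)).mul_right _
  · intro h
    by_contra! hlt
    have hlt' : m < j := by omega
    obtain ⟨i, rfl⟩ := Nat.exists_eq_add_of_lt hlt'
    rw [add_assoc, pow_add, mul_dvd_mul_iff_left (pow_ne_zero _ hp0'), pow_succ'] at h
    exact hz' ((dvd_mul_right _ _).trans h)

namespace IsDegOne

variable {v : HeightOneSpectrum (𝓞 k)} {p : ℕ} (hv : v.IsDegOne p)
include hv

theorem intCast_mem_iff {z : ℤ} (j : ℕ) : (z : k) ∈ v.ball (j : ℤ) ↔ (p : ℤ) ^ j ∣ z :=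
  intCast_mem_ball_iff hv.prime hv.above hv.ord j

theorem exists_int_sub_mem {x : k} (hx : x ∈ v.ball 0) (j : ℕ) : ∃ z : ℤ, x - z ∈ v.ball (j : ℤ) := by
  induction j with
  | zero => exact ⟨0, by simpa using hx⟩
  | succ j ih =>
    obtain ⟨z, hz⟩ := ih
    have hp0 : (p : k) ≠ 0 := by exact_mod_cast hv.prime.ne_zero
    have h1 : ((p : k) ^ j)⁻¹ ∈ v.ball (-j) := Or.inr (by rw [ord_inv, ord_pow, hv.ord, mul_one])
    have h2 := mul_mem_ball h1 hz
    rw [neg_add_cancel] at h2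
    obtain ⟨r, hr⟩ := exists_sub_mem_ball h2
    obtain ⟨m, hm⟩ := hv.exists_int r
    have h3 := add_mem hr ((algebraMap_mem_ball_one (K := k)).2 hm)
    have h4 : (p : k) ^ j ∈ v.ball (j : ℤ) := Or.inr (by rw [ord_pow, hv.ord, mul_one])
    have h5 := mul_mem_ball h4 h3
    refine ⟨z + p ^ j * m, ?_⟩
    push_cast
    convert h5 using 1
    rw [map_sub, map_intCast]
    field_simp
    ring

end IsDegOne

end IsDedekindDomain.HeightOneSpectrum

open HeightOneSpectrum

namespace SqrtPrime

variable {k : Type*} [Field k] [NumberField k] [Algebra.IsQuadraticExtension ℚ k] {l : ℕ} {s : 𝓞 k}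
  (h : SqrtPrime l s) {τ : Gal(k/ℚ)} (hτ : τ ≠ 1)

include h in
theorem isDegOne {v : HeightOneSpectrum (𝓞 k)} {p : ℕ} (hp : p.Prime) (hpl : p ≠ l)
    (hv : Above v p) (hc : conj τ v ≠ v) : v.IsDegOne p :=
  ⟨hp, hv, h.ord_prime hp hpl hv, exists_int_of_conj_ne hp hv hc⟩

variable {u w : ℤ} (hN : NegPell l u w)

include h hτ hN in
/-- A power of a split prime has a generator of positive norm. -/
theorem exists_coords_of_split {v : HeightOneSpectrum (𝓞 k)} {p : ℕ} (hp : p.Prime) (hpl : p ≠ l)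
    (hv : Above v p) (hc : conj τ v ≠ v) (e : ℕ) :
    ∃ (α : 𝓞 k) (A B : ℤ), 2 * α = A + B * s ∧ (2 : ℤ) ∣ A - B ∧
      A ^ 2 - l * B ^ 2 = 4 * p ^ (Nat.card (ClassGroup (𝓞 k)) * e) ∧
      α ∈ v.asIdeal ^ (Nat.card (ClassGroup (𝓞 k)) * e) ∧ α ∉ (conj τ v).asIdeal := by
  classical
  set H := Nat.card (ClassGroup (𝓞 k)) with hH
  obtain ⟨c, hc0, hcv⟩ := exists_ord_eq_mul (R := 𝓞 k) (K := k) (fun w => if w = v then (e : ℤ) else 0) (by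
    rw [Filter.eventually_cofinite]
    refine (Set.finite_singleton v).subset fun x hx => ?_
    by_contra hne
    exact hx (if_neg hne))
  obtain ⟨α, rfl⟩ := exists_algebraMap_eq_of_ord_nonneg (R := 𝓞 k) (x := c) (fun w => by
    rw [hcv]; split_ifs <;> positivity)
  have hα0 : α ≠ 0 := fun h0 => hc0 (by rw [h0, map_zero])
  have key : ∀ α : 𝓞 k, α ≠ 0 → (∀ w : HeightOneSpectrum (𝓞 k),
      w.ord (algebraMap (𝓞 k) k α) = H * (if w = v then (e : ℤ) else 0)) →
      ∃ (A B : ℤ), 2 * α = A + B * s ∧ (2 : ℤ) ∣ A - B ∧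
        (A ^ 2 - l * B ^ 2 = 4 * p ^ (H * e) ∨ A ^ 2 - l * B ^ 2 = -(4 * p ^ (H * e))) := by
    intro α hα0 hcv
    obtain ⟨A, B, hAB, h2⟩ := h.exists_coords hτ α
    refine ⟨A, B, hAB, h2, ?_⟩
    obtain ⟨N, hNN⟩ : (4 : ℤ) ∣ A ^ 2 - l * B ^ 2 := by
      obtain ⟨t, ht⟩ := h2
      obtain ⟨l', hl'⟩ : ∃ l' : ℤ, (l : ℤ) = 8 * l' + 1 := ⟨l / 8, by have := h.mod; omega⟩
      rw [show A = B + 2 * t by linarith, hl']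
      exact ⟨t ^ 2 + B * t - 2 * l' * B ^ 2, by ring⟩
    have hNα : ((N : ℤ) : 𝓞 k) = α * τ • α := by
      have h1 := congrArg (fun x : 𝓞 k => τ • x) hAB
      have e1 : τ • (2 * α : 𝓞 k) = 2 * τ • α := by
        rw [smul_mul']; congr 1
        exact map_ofNat (MulSemiringAction.toRingHom Gal(k/ℚ) (𝓞 k) τ) 2
      have e2 : ∀ m : ℤ, τ • (m : 𝓞 k) = m := fun m => map_intCast (MulSemiringAction.toRingHom Gal(k/ℚ) (𝓞 k) τ) m
      simp only [smul_add, smul_mul', e1, e2, h.conj_s' hτ] at h1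
      have h3 : (4 : 𝓞 k) * N = 4 * (α * τ • α) := by
        have : ((A ^ 2 - l * B ^ 2 : ℤ) : 𝓞 k) = ((4 * N : ℤ) : 𝓞 k) := by rw [hNN]
        push_cast at this
        rw [← this, ← h.sq]
        linear_combination (-(τ • α) * 2 : 𝓞 k) * hAB - (A + B * s) * h1
      exact mul_left_cancel₀ (by norm_num) h3
    have hcτ : ∀ w : HeightOneSpectrum (𝓞 k),
        w.ord (τ (algebraMap (𝓞 k) k α)) = (conj τ w).ord (algebraMap (𝓞 k) k α) := fun w => by
      rw [← ord_conj τ w, gal_involutive hτ]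
    have hα0' : algebraMap (𝓞 k) k α ≠ 0 := by simpa using hα0
    have hordN : ∀ w : HeightOneSpectrum (𝓞 k), w.ord (N : k) =
        H * (if w = v then (e : ℤ) else 0) + H * (if conj τ w = v then (e : ℤ) else 0) := by
      intro w
      have h1 : (N : k) = algebraMap (𝓞 k) k α * τ (algebraMap (𝓞 k) k α) := by
        have := congrArg (algebraMap (𝓞 k) k) hNα
        rw [map_mul, map_intCast] at this
        exact this
      rw [h1, ord_mul w hα0' (by simpa using hα0), hcτ, hcv, hcv]
    have hN0 : N ≠ 0 := by
      rintro rfl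
      have := congrArg (algebraMap (𝓞 k) k) hNα
      rw [map_mul, Int.cast_zero, map_zero, zero_eq_mul] at this
      rcases this with h1 | h1
      · exact hα0' h1
      · have : τ (algebraMap (𝓞 k) k α) = 0 := h1
        simp [hα0] at this
    have hpow : N.natAbs = p ^ N.natAbs.primeFactorsList.length := by
      refine Nat.eq_prime_pow_of_unique_prime_dvd (by simpa using hN0) ?_
      intro q hq hqN
      obtain ⟨w, hw⟩ := SqrtPrime.exists_above (k := k) hq
      have h1 : ((N : ℤ) : 𝓞 k) ∈ w.asIdeal := (hw N).2 (Int.natCast_dvd.2 hqN)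
      have h2 := (w.mem_iff_ord (K := k) (by exact_mod_cast hN0)).1 h1
      rw [map_intCast, hordN] at h2
      by_cases hwv : w = v
      · exact Above.unique (hwv ▸ hw) hv
      · by_cases hwv' : conj τ w = v
        · exact Above.unique (hwv' ▸ conj_above hw) hv
        · rw [if_neg hwv, if_neg hwv'] at h2
          omega
    set m := N.natAbs.primeFactorsList.length with hm
    have hmv : (m : ℤ) = H * e := by
      have h1 := hordN v
      rw [if_pos rfl, if_neg hc, mul_zero, add_zero] at h1
      rw [← h1]
      have hpm : v.ord ((p : k) ^ m) = m := by rw [ord_pow, h.ord_prime hp hpl hv, mul_one]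
      rcases Int.natAbs_eq N with h3 | h3
      · rw [h3, hpow]; push_cast; exact hpm.symm
      · rw [h3, hpow]; push_cast; rw [ord_neg]; exact hpm.symm
    have hmv' : m = H * e := by exact_mod_cast hmv
    rw [hmv'] at hpow
    rcases Int.natAbs_eq N with h3 | h3
    · left; rw [hNN, h3, hpow]; push_cast; ring
    · right; rw [hNN, h3, hpow]; push_cast; ring
  have hfin : ∀ α : 𝓞 k, α ≠ 0 → (∀ w : HeightOneSpectrum (𝓞 k),
      w.ord (algebraMap (𝓞 k) k α) = H * (if w = v then (e : ℤ) else 0)) →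
      α ∈ v.asIdeal ^ (H * e) ∧ α ∉ (conj τ v).asIdeal := by
    intro α h0 hcv
    refine ⟨(v.mem_pow_iff_ord (K := k) h0 _).2 ?_, fun hmem => ?_⟩
    · rw [hcv, if_pos rfl]; push_cast; rfl
    · rw [(conj τ v).mem_iff_ord (K := k) h0, hcv, if_neg hc] at hmem
      omega
  obtain ⟨A, B, hAB, h2, h3 | h3⟩ := key α hα0 hcv
  · exact ⟨α, A, B, hAB, h2, h3, hfin α hα0 hcv⟩
  · set ε := h.unit hN
    have hα1 : (ε : 𝓞 k) * α ≠ 0 := mul_ne_zero ε.ne_zero hα0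
    have hcv1 : ∀ w : HeightOneSpectrum (𝓞 k),
        w.ord (algebraMap (𝓞 k) k (ε * α)) = H * (if w = v then (e : ℤ) else 0) := by
      intro w
      rw [map_mul, ord_mul w (by simp) (by simpa using hα0), hcv]
      have : w.ord (algebraMap (𝓞 k) k ε) = 0 := w.ord_unit ε
      rw [this, zero_add]
    refine ⟨ε * α, u * A + w * l * B, u * B + w * A, ?_, ?_, ?_, hfin _ hα1 hcv1⟩
    · rw [h.coe_unit hN]
      push_cast
      rw [← h.sq]
      linear_combination ((u : 𝓞 k) + w * s) * hAB
    · obtain ⟨t, ht⟩ := h2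
      have h4 := hN.four_dvd_u h.mod
      have h5 : (2 : ℤ) ∣ u := (by norm_num : (2 : ℤ) ∣ 4).trans h4
      obtain ⟨l', hl'⟩ : ∃ l' : ℤ, (l : ℤ) = 8 * l' + 1 := ⟨l / 8, by have := h.mod; omega⟩
      rw [show u * A + w * l * B - (u * B + w * A) = (u - w) * (A - B) + w * B * (l - 1) by ring, ht, hl']
      exact ⟨(u - w) * t + w * B * 4 * l', by ring⟩
    · have := hN.eq
      linear_combination (-1 : ℤ) * h3 + (A ^ 2 - l * B ^ 2) * this

include h hτ in
theorem exists_sq_iff {v : HeightOneSpectrum (𝓞 k)} {p : ℕ} (hp : p.Prime) (hp4 : p % 4 = 1) (hpl : p ≠ l)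
    (hv : Above v p) (hc : conj τ v ≠ v) :
    (∃ a : 𝓞 k, (h.unit hN : 𝓞 k) - a ^ 2 ∈ v.asIdeal) ↔ quartSym l p = quartSym p l := by
  have hd := h.isDegOne hp hpl hv hc
  have hpp : Prime (p : ℤ) := Nat.prime_iff_prime_int.1 hp
  obtain ⟨c, hcs⟩ := hd.exists_int s
  have hεc : (h.unit hN : 𝓞 k) - ((u + w * c : ℤ) : 𝓞 k) ∈ v.asIdeal := by
    rw [h.coe_unit hN]
    push_cast
    rw [show (u : 𝓞 k) + w * s - (u + w * c) = w * (s - c) by ring]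
    exact v.asIdeal.mul_mem_left _ hcs
  have hiff : (∃ a : 𝓞 k, (h.unit hN : 𝓞 k) - a ^ 2 ∈ v.asIdeal) ↔ IsSquare ((u + w * c : ℤ) : ZMod p) := by
    constructor
    · rintro ⟨a, ha⟩
      obtain ⟨m, hm⟩ := hd.exists_int a
      refine ⟨(m : ZMod p), ?_⟩
      rw [← sub_eq_zero]
      have h1 : (((u + w * c - m * m : ℤ)) : 𝓞 k) ∈ v.asIdeal := by
        have := sub_mem (add_mem ha (v.asIdeal.mul_mem_left (a + m) hm)) hεc
        convert this using 1
        push_cast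
        ring
      have h2 := (ZMod.intCast_zmod_eq_zero_iff_dvd _ p).2 ((hv _).1 h1)
      exact_mod_cast h2
    · rintro ⟨m, hm⟩
      obtain ⟨m, rfl⟩ := ZMod.intCast_surjective m
      have h2 : ((u + w * c - m * m : ℤ) : ZMod p) = 0 := by
        push_cast
        push_cast at hm
        rw [hm, sub_self]
      have h1 := (hv _).2 ((ZMod.intCast_zmod_eq_zero_iff_dvd _ p).1 h2)
      refine ⟨m, ?_⟩
      convert add_mem hεc h1 using 1
      push_cast
      ring
  rw [hiff]
  obtain ⟨α, A, B, hAB, ⟨t, ht⟩, hnorm, hα, hα'⟩ := h.exists_coords_of_split hτ hN hp hpl hv hc 1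
  rw [mul_one] at hnorm hα
  have hodd := h.odd_classNumber hN
  set H := Nat.card (ClassGroup (𝓞 k))
  have hH0 : H ≠ 0 := hodd.pos.ne'
  obtain ⟨l', hl'⟩ : ∃ l' : ℤ, (l : ℤ) = 8 * l' + 1 := ⟨l / 8, by have := h.mod; omega⟩
  have hA : A = B + 2 * t := by linarith
  have hpow : t * (t + B) - 2 * l' * B ^ 2 = (p : ℤ) ^ H := by
    rw [hA, hl'] at hnorm
    linarith
  have hpo : Odd ((p : ℤ) ^ H) := Odd.pow ((Int.odd_iff).2 (by omega))
  have hB : Even B := by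
    by_contra hB
    rw [Int.not_even_iff_odd] at hB
    rw [← hpow] at hpo
    have : Even (t * (t + B) - 2 * l' * B ^ 2) := by
      refine Even.sub ?_ (by rw [mul_assoc]; exact even_two_mul _)
      rcases Int.even_or_odd t with h1 | h1
      · exact h1.mul_right _
      · exact (h1.add_odd hB).mul_left _
    exact (Int.not_even_iff_odd.2 hpo) this
  obtain ⟨y, hy⟩ := even_iff_exists_two_mul.1 hB
  have hαxy : α = ((y + t : ℤ) : 𝓞 k) + y * s := by
    have : (2 : 𝓞 k) * α = 2 * (((y + t : ℤ) : 𝓞 k) + y * s) := by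
      rw [hAB, hA, hy]; push_cast; ring
    exact mul_left_cancel₀ two_ne_zero this
  have hxy : (y + t) ^ 2 - l * y ^ 2 = (p : ℤ) ^ H := by
    rw [← hpow, hy, hl']; ring
  refine hN.isSquare_iff h.prime h.mod hp hp4 hpl hodd hxy (fun hpy => ?_) ?_
  · have h1 : (p : ℤ) ∣ (y + t) := by
      refine hpp.dvd_of_dvd_pow (n := 2) ?_
      rw [show (y + t) ^ 2 = (p : ℤ) ^ H + l * y ^ 2 by linarith]
      exact dvd_add (dvd_pow_self _ hH0) ((dvd_pow hpy two_ne_zero).mul_left _)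
    refine hα' ?_
    rw [hαxy]
    have hcv := conj_above (τ := τ) hv
    exact add_mem ((hcv _).2 h1) ((conj τ v).asIdeal.mul_mem_right _ ((hcv _).2 hpy))
  · rw [← hv]
    have h1 : α ∈ v.asIdeal := Ideal.pow_le_self hH0 hα
    have h2 := sub_mem h1 (v.asIdeal.mul_mem_left (y : 𝓞 k) hcs)
    rw [hαxy] at h2
    convert h2 using 1
    push_cast
    ring

include h hτ in
theorem mod_eight_iff {v : HeightOneSpectrum (𝓞 k)} (hv : Above v 2) {z : ℤ}
    (hz : ((h.unit hN : 𝓞 k) : k) - z ∈ v.ball 3) :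
    (z % 8 = 1 ∨ z % 8 = 7) ↔ quartSym l 2 = (-1) ^ ((l - 1) / 8) := by
  have hc : conj τ v ≠ v := h.conj_ne_of_two hτ hv
  have h2l : 2 ≠ l := by rintro rfl; have := h.mod; omega
  have hd := h.isDegOne Nat.prime_two h2l hv hc
  have hs0 : (s : k) ∈ v.ball 0 := algebraMap_mem_ball s
  obtain ⟨c, hcs⟩ := hd.exists_int_sub_mem hs0 3
  have hzc : (8 : ℤ) ∣ (u + w * c) - z := by
    have h1 := sub_mem hz (mul_mem_ball_left (intCast_mem_ball w) hcs)
    rw [h.coe_unit' hN, show (u : k) + w * s - z - w * (s - c) = ((u + w * c - z : ℤ) : k) by push_cast; ring] at h1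
    exact (hd.intCast_mem_iff 3).1 h1
  obtain ⟨α, A, B, hAB, ⟨t, ht⟩, hnorm, hα, hα'⟩ := h.exists_coords_of_split hτ hN Nat.prime_two h2l hv hc 3
  obtain ⟨m, hm⟩ := h.odd_classNumber hN
  set H := Nat.card (ClassGroup (𝓞 k))
  obtain ⟨l', hl'⟩ : ∃ l' : ℤ, (l : ℤ) = 8 * l' + 1 := ⟨l / 8, by have := h.mod; omega⟩
  have hA : A = B + 2 * t := by linarith
  have hpow : t * (t + B) - 2 * l' * B ^ 2 = 2 ^ (H * 3) := by
    rw [hA, hl'] at hnorm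
    push_cast at hnorm
    linarith
  have hB : Odd B := by
    by_contra hB
    rw [Int.not_odd_iff_even] at hB
    obtain ⟨y, hy⟩ := even_iff_exists_two_mul.1 hB
    have ht2 : Even t := by
      have h1 : Even (t * (t + B)) := by
        rw [show t * (t + B) = 2 ^ (H * 3) + 2 * (l' * B ^ 2) by rw [← hpow]; ring]
        exact ((even_two).pow_of_ne_zero (by omega)).add (even_two_mul _)
      rcases Int.even_mul.1 h1 with h2 | h2
      · exact h2
      · exact (Int.even_add.1 h2).2 hB
    obtain ⟨t', ht'⟩ := even_iff_exists_two_mul.1 ht2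
    obtain ⟨θ, hθ⟩ := h.exists_half
    have hα2 : α = 2 * (y * θ + t') := by
      have : (2 : 𝓞 k) * α = 2 * (2 * (y * θ + t')) := by
        rw [hAB, hA, hy, ht']; push_cast
        linear_combination (-2 * y : 𝓞 k) * hθ
      exact mul_left_cancel₀ two_ne_zero this
    refine hα' ?_
    rw [hα2]
    refine (conj τ v).asIdeal.mul_mem_right _ ?_
    have := (conj_above (τ := τ) hv 2).2 dvd_rfl
    simpa using this
  have hAo : Odd A := by rw [hA]; exact hB.add_even (even_two_mul _)
  have key := hN.mod_eight_iff h.prime h.mod (m := 3 * m) (x := A) (y := B) (c := c)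
    (Int.odd_iff.1 hAo) (Int.odd_iff.1 hB)
    (by rw [hnorm, hm]; push_cast; ring) ?_
  · rw [← key]
    omega
  · have h1 : algebraMap (𝓞 k) k α ∈ v.ball ((3 : ℕ) : ℤ) :=
      (algebraMap_mem_ball_iff 3).2 (Ideal.pow_le_pow_right (by omega) hα)
    have h3 := sub_mem (mul_mem_ball_left (intCast_mem_ball 2) h1) (mul_mem_ball_left (intCast_mem_ball B) hcs)
    have h4 := congrArg (algebraMap (𝓞 k) k) hAB
    rw [map_mul, map_add, map_mul, map_intCast, map_intCast, map_ofNat] at h4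
    have h5 : ((A + B * c : ℤ) : k) ∈ v.ball ((3 : ℕ) : ℤ) := by
      convert h3 using 1
      push_cast
      rw [h4]
      change _ = (A : k) + B * (s : k) - _
      ring
    exact (hd.intCast_mem_iff 3).1 h5

end SqrtPrime

end

section

theorem NumberField.finrank_quadExt (k F : Type*) [Field k] [NumberField k] [Field F] [NumberField F]
    [Algebra k F] [Algebra.IsQuadraticExtension ℚ k] [Algebra.IsQuadraticExtension k F] :
    Module.finrank ℚ F = 4 := by
  rw [← Module.finrank_mul_finrank ℚ k F, Algebra.IsQuadraticExtension.finrank_eq_two,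
    Algebra.IsQuadraticExtension.finrank_eq_two]

theorem NumberField.Units.two_le_rank {F : Type*} [Field F] [NumberField F]
    (h4 : Module.finrank ℚ F = 4) (φ : F →+* ℂ) (hφ : ∀ x, (starRingEnd ℂ) (φ x) = φ x) :
    2 ≤ NumberField.Units.rank F := by
  have h1 := InfinitePlace.card_add_two_mul_card_eq_rank F
  have h2 := InfinitePlace.card_eq_nrRealPlaces_add_nrComplexPlaces F
  have h3 : 0 < InfinitePlace.nrRealPlaces F := by
    classical
    rw [InfinitePlace.nrRealPlaces, Fintype.card_pos_iff]
    exact ⟨⟨InfinitePlace.mk φ, φ, ComplexEmbedding.isReal_iff.2 (RingHom.ext hφ), rfl⟩⟩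
  rw [NumberField.Units.rank]
  omega

theorem NumberField.Units.one_le_rank {F : Type*} [Field F] [NumberField F]
    (h4 : Module.finrank ℚ F = 4) : 1 ≤ NumberField.Units.rank F := by
  have h1 := InfinitePlace.card_add_two_mul_card_eq_rank F
  have h2 := InfinitePlace.card_eq_nrRealPlaces_add_nrComplexPlaces F
  rw [NumberField.Units.rank]
  omega

namespace QuadExt

theorem squares_le_normUnits (k F : Type*) [Field k] [NumberField k] [Field F] [NumberField F]
    [Algebra k F] [Algebra.IsQuadraticExtension k F] : squares (𝓞 k)ˣ ≤ normUnits k F := by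
  rintro _ ⟨u, rfl⟩
  rw [mem_normUnits]
  refine ⟨algebraMap k F (algebraMap (𝓞 k) k u), ?_⟩
  rw [Algebra.norm_algebraMap, Algebra.IsQuadraticExtension.finrank_eq_two]
  simp

/-- An embedding of the base field with positive value at `d` extends to the square root of `d`. -/
theorem Gen.exists_embedding {k F : Type*} [Field k] [NumberField k] [Field F] [NumberField F]
    [Algebra k F] [Algebra.IsQuadraticExtension k F] {σ : Gal(F/k)} {r : F} {d : 𝓞 k}
    (h : Gen σ r d) {ψ : k →+* ℝ} (hψ : 0 ≤ ψ d) :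
    ∃ φ : F →+* ℂ, ∀ x, (starRingEnd ℂ) (φ x) = φ x := by
  let _ := ((Complex.ofRealHom : ℝ →+* ℂ).comp ψ).toAlgebra
  let φ : F →ₐ[k] ℂ := IsAlgClosed.lift
  have h1 : ∀ a : k, φ (algebraMap k F a) = (ψ a : ℂ) := fun a => φ.commutes a
  refine ⟨φ, fun x => ?_⟩
  obtain ⟨a, b, rfl⟩ := h.exists_coords x
  have hr : (starRingEnd ℂ) (φ r) = φ r :=
    Complex.conj_eq_of_sq_eq hψ (by rw [← map_pow, h.sq, h1])
  show (starRingEnd ℂ) (φ _) = φ _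
  rw [map_add, map_mul, h1, h1, map_add, map_mul, hr, Complex.conj_ofReal, Complex.conj_ofReal]

end QuadExt

variable {k : Type*} [Field k] [NumberField k]

namespace SqrtPrime

variable [Algebra.IsQuadraticExtension ℚ k] {l : ℕ} {s : 𝓞 k} (h : SqrtPrime l s)
  {τ : Gal(k/ℚ)} (hτ : τ ≠ 1)
include h

include hτ in
theorem exists_embedding_pos : ∃ ψ : k →+* ℝ, 0 < ψ s := by
  have ht := h.isTotallyReal
  obtain ⟨w⟩ : Nonempty (InfinitePlace k) := inferInstance
  have hr := ht.isReal w
  let ψ : k →+* ℝ := InfinitePlace.embedding_of_isReal hr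
  have h0 : ψ s ≠ 0 := by rw [map_ne_zero]; exact h.s_ne_zero
  rcases lt_or_gt_of_ne h0 with h1 | h1
  · refine ⟨ψ.comp (τ : k →+* k), ?_⟩
    show 0 < ψ (τ s)
    rw [h.conj_s hτ, map_neg]
    linarith
  · exact ⟨ψ, h1⟩

variable {u w : ℤ} (hN : NegPell l u w)

include hτ in
theorem conj_unit : τ ((h.unit hN : 𝓞 k) : k) = u - w * s := by
  rw [h.coe_unit', map_add, map_mul, h.conj_s hτ, map_intCast, map_intCast]; ring

include hτ in
theorem unit_mul_conj : ((h.unit hN : 𝓞 k) : k) * τ ((h.unit hN : 𝓞 k) : k) = -1 := by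
  rw [h.conj_unit hτ, h.coe_unit']
  have h1 := hN.eq
  have h2 : (u : k) ^ 2 + 1 = l * w ^ 2 := by exact_mod_cast h1
  linear_combination h2 - (w : k) ^ 2 * h.sq'

variable {ψ : k →+* ℝ} (hψ : 0 < ψ s)
include hψ

theorem unit_pos : 0 < ψ (h.unit hN : 𝓞 k) := by
  rw [h.coe_unit', map_add, map_mul, map_intCast, map_intCast]
  have h1 : (0 : ℝ) < u := by exact_mod_cast hN.u_pos
  have h2 : (0 : ℝ) < w := by exact_mod_cast hN.v_pos
  positivity

include hτ in
theorem conj_unit_neg : ψ (τ (h.unit hN : 𝓞 k)) < 0 := by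
  have h1 := congrArg ψ (h.unit_mul_conj hτ hN)
  rw [map_mul, map_neg, map_one] at h1
  have h2 := h.unit_pos hN hψ
  nlinarith

include hτ in
theorem unit_eq_of_conj_pos {x : (𝓞 k)ˣ} (hx : 0 < ψ (τ ((x : 𝓞 k) : k))) :
    ∃ y : (𝓞 k)ˣ, x = y ^ 2 ∨ x = -(h.unit hN * y ^ 2) := by
  have h2 := h.conj_unit_neg hτ hN hψ
  obtain ⟨y, hy | hy | hy | hy⟩ := h.unit_cases hN x
  · exact ⟨y, Or.inl hy⟩
  · exfalso
    have h3 : ((x : 𝓞 k) : k) = -((y : 𝓞 k) : k) ^ 2 := by rw [hy]; simp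
    rw [h3, map_neg, map_pow, map_neg, map_pow] at hx
    nlinarith [sq_nonneg (ψ (τ (y : 𝓞 k)))]
  · exfalso
    have h3 : ((x : 𝓞 k) : k) = (h.unit hN : 𝓞 k) * ((y : 𝓞 k) : k) ^ 2 := by rw [hy]; simp
    rw [h3, map_mul, map_pow, map_mul, map_pow] at hx
    nlinarith [sq_nonneg (ψ (τ (y : 𝓞 k)))]
  · exact ⟨y, Or.inr hy⟩

include hτ hN in
theorem unit_eq_sq_of_pos {x : (𝓞 k)ˣ} (hx' : 0 < ψ ((x : 𝓞 k) : k)) (hx : 0 < ψ (τ ((x : 𝓞 k) : k))) :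
    ∃ y : (𝓞 k)ˣ, x = y ^ 2 := by
  obtain ⟨y, hy | hy⟩ := h.unit_eq_of_conj_pos hτ hN hψ hx
  · exact ⟨y, hy⟩
  · exfalso
    have h2 := h.unit_pos hN hψ
    have h3 : ((x : 𝓞 k) : k) = -((h.unit hN : 𝓞 k) * ((y : 𝓞 k) : k) ^ 2) := by rw [hy]; simp
    rw [h3, map_neg, map_mul, map_pow] at hx'
    nlinarith [sq_nonneg (ψ (y : 𝓞 k))]

end SqrtPrime

end

section

variable {k : Type*} [Field k] [NumberField k]

namespace SqrtPrime

variable [Algebra.IsQuadraticExtension ℚ k] {l : ℕ} {s : 𝓞 k} (h : SqrtPrime l s)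
  {τ : Gal(k/ℚ)} (hτ : τ ≠ 1) {u w : ℤ} (hN : NegPell l u w) {ψ : k →+* ℝ} (hψ : 0 < ψ s)
  {F : Type*} [Field F] [NumberField F] [Algebra k F] [Algebra.IsQuadraticExtension k F]
  {σ : Gal(F/k)} {r : F}
include h

theorem sq_half {θ : 𝓞 k} (hθ : 2 * θ = 1 + s) : ∃ m : ℤ, θ ^ 2 = θ + 2 * m := by
  have h1 := h.mod
  refine ⟨(l / 8 : ℕ), ?_⟩
  have h2 : (l : 𝓞 k) = 8 * ((l / 8 : ℕ) : ℤ) + 1 := by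
    have : l = 8 * (l / 8) + 1 := by omega
    exact_mod_cast congrArg (Nat.cast (R := 𝓞 k)) this
  have h3 : (4 : 𝓞 k) * θ ^ 2 = 4 * (θ + 2 * ((l / 8 : ℕ) : ℤ)) := by
    linear_combination (2 * θ + 1 + s - 2) * hθ + h.sq + h2
  exact mul_left_cancel₀ (by norm_num) h3

theorem ram_sqrt_unit (hG : Gen σ r (h.unit hN : 𝓞 k)) {v : HeightOneSpectrum (𝓞 k)} {θ : 𝓞 k}
    (hθ : 2 * θ = 1 + s) (hv : ram F v = 2) : (2 : 𝓞 k) ∈ v.asIdeal ∧ θ ∈ v.asIdeal := by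
  have hd : (h.unit hN : 𝓞 k) ∉ v.asIdeal := fun hm =>
    v.isPrime.ne_top (Ideal.eq_top_of_isUnit_mem _ hm (h.unit hN).isUnit)
  have h2 : (2 : 𝓞 k) ∈ v.asIdeal := by
    by_contra h2
    rw [hG.ram_eq_one_of_odd hd h2] at hv
    omega
  refine ⟨h2, ?_⟩
  by_contra ht
  obtain ⟨m, hm⟩ := h.sq_half hθ
  obtain ⟨u', rfl⟩ := hN.four_dvd_u h.mod
  obtain ⟨w', hw⟩ : ∃ w', w = 4 * w' + 1 := ⟨w / 4, by have := hN.v_mod h.mod; omega⟩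
  have he : θ ^ 2 * (1 - (h.unit hN : 𝓞 k)) = 4 * (m * θ - 2 * m * θ - θ ^ 2 * (u' + w' * s)) := by
    have hw2 : (w : 𝓞 k) = 4 * w' + 1 := by exact_mod_cast congrArg (Int.cast (R := 𝓞 k)) hw
    rw [h.coe_unit, hw2]
    push_cast
    linear_combination (θ ^ 2) * hθ - 2 * θ * hm
  rw [hG.ram_eq_one_of_quadratic ht hd he] at hv
  omega

include hτ hψ in
theorem card_twoTorsion_sqrt_unit (hG : Gen σ r (h.unit hN : 𝓞 k)) :
    Nat.card {x : ClassGroup (𝓞 F) // x ^ 2 = 1} = 1 := by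
  classical
  obtain ⟨θ, hθ⟩ := h.exists_half
  have huniq : ∀ v v' : HeightOneSpectrum (𝓞 k), ram F v = 2 → ram F v' = 2 → v' = v := by
    intro v v' hv hv'
    obtain ⟨h2, ht⟩ := h.ram_sqrt_unit hN hG hθ hv
    obtain ⟨h2', ht'⟩ := h.ram_sqrt_unit hN hG hθ hv'
    rcases SqrtPrime.eq_or_eq_conj hτ Nat.prime_two (Above.of_two_mem h2) (Above.of_two_mem h2')
      with h3 | h3
    · exact h3
    · exfalso
      have h4 : τ • θ = 1 - θ := by
        apply mul_left_cancel₀ (two_ne_zero : (2 : 𝓞 k) ≠ 0)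
        have h5 : 2 * (τ • θ) = τ • (2 * θ) := by
          rw [two_mul, two_mul, smul_add]
        rw [h5, hθ, smul_add, smul_one, h.conj_s' hτ]
        linear_combination hθ
      have h6 : τ • (τ • θ) ∈ v'.asIdeal := by
        rw [smul_smul]
        have : τ * τ = 1 := AlgEquiv.ext fun x => gal_involutive hτ x
        rwa [this, one_smul]
      rw [h3, h.smul_mem_conj hτ, h4] at h6
      exact v.isPrime.ne_top ((Ideal.eq_top_iff_one _).2 (by simpa using add_mem h6 ht))
  obtain ⟨T, hT, hT1⟩ : ∃ T : Finset (HeightOneSpectrum (𝓞 k)), (∀ v, v ∈ T ↔ ram F v = 2) ∧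
      T.card ≤ 1 := by
    by_cases hex : ∃ v : HeightOneSpectrum (𝓞 k), ram F v = 2
    · obtain ⟨v, hv⟩ := hex
      exact ⟨{v}, fun v' => ⟨fun h' => by rwa [Finset.mem_singleton.1 h'],
        fun h' => Finset.mem_singleton.2 (huniq v v' hv h')⟩, by simp⟩
    · exact ⟨∅, fun v => ⟨fun h' => by simp at h', fun h' => (hex ⟨v, h'⟩).elim⟩, by simp⟩
  have hA := card_twoTorsion_mul hG.ne_one (h.odd_classNumber hN) T hT
  obtain ⟨φ, hφ⟩ := hG.exists_embedding (h.unit_pos hN hψ).le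
  have hr := NumberField.Units.two_le_rank (finrank_quadExt k F) φ hφ
  rw [NumberField.Units.index_squares F, h.index_squares_units] at hA
  have h1 : -1 ∉ normUnits k F := by
    rw [hG.mem_normUnits_iff]
    rintro ⟨a, b, hab⟩
    have h3 := congrArg (fun x => ψ (τ x)) hab
    simp only [map_sub, map_mul, map_pow, Units.val_neg, Units.val_one, map_neg, map_one] at h3
    have h2 := h.conj_unit_neg hτ hN hψ
    nlinarith [sq_nonneg (ψ (τ a)), sq_nonneg (ψ (τ b))]
  have h2 := Subgroup.relIndex_mul_index (squares_le_normUnits k F)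
  rw [h.index_squares_units] at h2
  have h3 : (normUnits k F).index ≠ 1 := fun h' => h1 (by
    rw [Subgroup.index_eq_one.1 h']; trivial)
  have h4 : (squares (𝓞 k)ˣ).relIndex (normUnits k F) ≤ 2 := by
    have : (normUnits k F).index ≠ 0 := fun h' => by rw [h'] at h2; omega
    nlinarith [show 2 ≤ (normUnits k F).index by omega]
  have h5 : 2 ^ T.card ≤ 2 ^ 1 := Nat.pow_le_pow_right (by norm_num) hT1
  have h6 : 2 ^ 3 ≤ 2 ^ (NumberField.Units.rank F + 1) := Nat.pow_le_pow_right (by norm_num) (by omega)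
  have h7 : 0 < Nat.card {x : ClassGroup (𝓞 F) // x ^ 2 = 1} :=
    Nat.card_pos_iff.2 ⟨⟨⟨1, one_pow 2⟩⟩, inferInstance⟩
  have h8 : 4 * 2 ^ T.card * (squares (𝓞 k)ˣ).relIndex (normUnits k F) ≤ 4 * 2 * 2 := by
    gcongr
    simpa using h5
  have h9 := Nat.mul_le_mul_right (Nat.card {x : ClassGroup (𝓞 F) // x ^ 2 = 1}) h6
  omega

end SqrtPrime

end

section

variable {k : Type*} [Field k] [NumberField k]

namespace SqrtPrime

variable [Algebra.IsQuadraticExtension ℚ k] {l : ℕ} {s : 𝓞 k} (h : SqrtPrime l s)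
  {τ : Gal(k/ℚ)} (hτ : τ ≠ 1) {u w : ℤ} (hN : NegPell l u w) {ψ : k →+* ℝ} (hψ : 0 < ψ s)
include h hτ hψ

theorem exists_eq_sq_sub_unit_mul_sq {d : k} (hd : d ≠ 0) (hpos : 0 < ψ (τ d))
    (hloc : ∀ v : HeightOneSpectrum (𝓞 k), Odd (v.ord d) →
      ∃ a : k, Odd (v.ord (a ^ 2 - (h.unit hN : 𝓞 k)))) :
    ∃ x y : k, d = x ^ 2 - (h.unit hN : 𝓞 k) * y ^ 2 := by
  have hneg := h.conj_unit_neg hτ hN hψ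
  obtain ⟨F, _, _, _, _, σ, r, hG⟩ := exists_quadExt (h.unit hN : 𝓞 k) (fun x hx => by
    rw [← hx, map_pow, map_pow] at hneg
    nlinarith [sq_nonneg (ψ (τ x))])
  obtain ⟨x, z, hxz⟩ := exists_eq_unit_mul_norm_of_card_eq_one hG.ne_one (h.odd_classNumber hN)
    (h.card_twoTorsion_sqrt_unit hτ hN hψ hG) hd (fun v hv => by
      obtain ⟨a, ha⟩ := hloc v hv
      obtain ⟨z, hz⟩ := hG.norm_iff.2 ⟨a, 1, show a ^ 2 - ((h.unit hN : 𝓞 k) : k) = _ by ring⟩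
      refine ⟨z, ?_, by rwa [hz]⟩
      rintro rfl
      rw [← hz, Algebra.norm_zero, HeightOneSpectrum.ord_zero] at ha
      exact Int.not_odd_zero ha)
  obtain ⟨a, b, hab⟩ := hG.norm_iff.1 ⟨z, rfl⟩
  rw [hab] at hxz
  have hx : 0 < ψ (τ ((x : 𝓞 k) : k)) := by
    have h1 : 0 ≤ ψ (τ (a ^ 2 - ((h.unit hN : 𝓞 k) : k) * b ^ 2)) := by
      simp only [map_sub, map_mul, map_pow]
      nlinarith [sq_nonneg (ψ (τ a)), sq_nonneg (ψ (τ b))]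
    rw [hxz, map_mul, map_mul] at hpos
    exact pos_of_mul_pos_left hpos h1
  obtain ⟨y, rfl | rfl⟩ := h.unit_eq_of_conj_pos hτ hN hψ hx
  · refine ⟨(y : 𝓞 k) * a, (y : 𝓞 k) * b, ?_⟩
    rw [hxz, Units.val_pow_eq_pow_val, map_pow]
    ring
  · refine ⟨((h.unit hN : 𝓞 k) : k) * (y : 𝓞 k) * b, (y : 𝓞 k) * a, ?_⟩
    rw [hxz, Units.val_neg, Units.val_mul, Units.val_pow_eq_pow_val, map_neg, map_mul, map_pow]
    ring

/-- The unit is a norm from the extension generated by `√d` if `d` is locally a norm from the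
extension generated by the square root of the unit. -/
theorem unit_eq_sq_sub {d : k} (hd : d ≠ 0) (hpos : 0 < ψ (τ d))
    (hloc : ∀ v : HeightOneSpectrum (𝓞 k), Odd (v.ord d) →
      ∃ a : k, Odd (v.ord (a ^ 2 - (h.unit hN : 𝓞 k)))) (hns : ∀ x : k, x ^ 2 ≠ d) :
    ∃ x y : k, ((h.unit hN : 𝓞 k) : k) = x ^ 2 - d * y ^ 2 := by
  obtain ⟨x, y, hxy⟩ := h.exists_eq_sq_sub_unit_mul_sq hτ hN hψ hd hpos hloc
  have hy : y ≠ 0 := by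
    rintro rfl
    exact hns x (by rw [hxy]; ring)
  refine ⟨x / y, 1 / y, ?_⟩
  rw [hxy]
  field_simp
  ring

end SqrtPrime

end

end

section

open IsDedekindDomain nonZeroDivisors NumberField Pointwise
open HeightOneSpectrum (squares evenUnits mem_squares_units ord_mul ord_pow)
set_option linter.unusedSectionVars false
open QuadExt
open HeightOneSpectrum

section

namespace IsDedekindDomain.HeightOneSpectrum

variable {R K : Type*} [CommRing R] [IsDedekindDomain R] [Field K] [Algebra R K] [IsFractionRing R K]
  {v : HeightOneSpectrum R}

theorem ord_eq_of_ball {x : K} {n : ℤ} (h : x ∈ v.ball n) (h' : x ∉ v.ball (n + 1)) : v.ord x = n := by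
  have h0 : x ≠ 0 := fun h0 => h' (Or.inl h0)
  rw [mem_ball' h0] at h h'
  omega

/-- A square root of `e` modulo `v` can be adjusted so that `a ^ 2 - e` is a uniformizer. -/
theorem exists_ord_sq_sub_eq_one (h2 : (2 : R) ∉ v.asIdeal) {π : R} (hπ : v.ord (algebraMap R K π) = 1) {A e : R}
    (he : e ∉ v.asIdeal) (hA : e - A ^ 2 ∈ v.asIdeal) :
    ∃ a : K, v.ord (a ^ 2 - algebraMap R K e) = 1 := by
  have hπ0 : algebraMap R K π ≠ 0 := fun h0 => by rw [h0, ord_zero] at hπ; omega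
  have hπv : π ∈ v.asIdeal := (mem_iff_ord (K := K) v (fun h0 => hπ0 (by rw [h0, map_zero]))).2 hπ.ge
  have hA' : A ∉ v.asIdeal := fun h => he (by
    have := add_mem hA (v.asIdeal.mul_mem_left A h)
    rwa [← pow_two, sub_add_cancel] at this)
  have h1 : algebraMap R K (A ^ 2 - e) ∈ v.ball 1 :=
    algebraMap_mem_ball_one.2 (by rw [← neg_sub]; exact neg_mem hA)
  by_cases h3 : algebraMap R K (A ^ 2 - e) ∈ v.ball 2
  · refine ⟨algebraMap R K (A + π), ?_⟩
    have h4 : 2 * A + π ∉ v.asIdeal := fun h => by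
      have := sub_mem h hπv
      rw [add_sub_cancel_right] at this
      exact (v.isPrime.mem_or_mem this).elim h2 hA'
    have h5 : v.ord (algebraMap R K (π * (2 * A + π))) = 1 := by
      rw [map_mul, ord_mul v hπ0 (by
        rw [Ne, FaithfulSMul.algebraMap_eq_zero_iff]; exact fun h0 => h4 (h0 ▸ zero_mem _)), hπ,
        ord_eq_zero_of_notMem v h4, add_zero]
    have h50 : algebraMap R K (π * (2 * A + π)) ≠ 0 := fun h0 => by rw [h0, ord_zero] at h5; omega
    have h6 : algebraMap R K (A + π) ^ 2 - algebraMap R K e =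
        algebraMap R K (A ^ 2 - e) + algebraMap R K (π * (2 * A + π)) := by
      rw [← map_pow, ← map_sub, ← map_add]; congr 1; ring
    rw [h6]
    apply ord_eq_of_ball
    · exact add_mem h1 ((mem_ball' h50).2 h5.ge)
    · intro h7
      have h8 := sub_mem h7 h3
      rw [add_sub_cancel_left, mem_ball' h50] at h8
      omega
  · refine ⟨algebraMap R K A, ?_⟩
    rw [← map_pow, ← map_sub]
    exact ord_eq_of_ball h1 h3

end IsDedekindDomain.HeightOneSpectrum

theorem ZMod.exists_int_of_isSquare {p : ℕ} {m : ℤ} (h : IsSquare (m : ZMod p)) : ∃ t : ℤ, (p : ℤ) ∣ m - t ^ 2 := by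
  obtain ⟨x, hx⟩ := h
  obtain ⟨t, rfl⟩ := ZMod.intCast_surjective x
  refine ⟨t, (ZMod.intCast_zmod_eq_zero_iff_dvd _ _).1 ?_ |> fun h => h⟩
  push_cast
  rw [hx]; ring

theorem ZMod.isSquare_mul_of_not_isSquare {p : ℕ} (hp : p.Prime) {a b : ZMod p} (ha : ¬ IsSquare a)
    (hb : ¬ IsSquare b) : IsSquare (a * b) := by
  have := Fact.mk hp
  have ha0 : a ≠ 0 := fun h => ha (h ▸ IsSquare.zero)
  have hb0 : b ≠ 0 := fun h => hb (h ▸ IsSquare.zero)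
  have ha' := (quadraticChar_one_iff_isSquare ha0).not.2 ha
  have hb' := (quadraticChar_one_iff_isSquare hb0).not.2 hb
  rw [← quadraticChar_one_iff_isSquare (mul_ne_zero ha0 hb0), map_mul,
    (quadraticChar_dichotomy ha0).resolve_left ha', (quadraticChar_dichotomy hb0).resolve_left hb']
  norm_num

variable {k : Type*} [Field k] [NumberField k]

theorem Above.two_notMem {v : HeightOneSpectrum (𝓞 k)} {p : ℕ} (hv : Above v p) (hp2 : p ≠ 2) :
    (2 : 𝓞 k) ∉ v.asIdeal := fun h => hp2 (hv.unique (Above.of_two_mem h))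

namespace SqrtPrime

variable [Algebra.IsQuadraticExtension ℚ k] {l : ℕ} {s : 𝓞 k} (h : SqrtPrime l s)
  {τ : Gal(k/ℚ)} (hτ : τ ≠ 1) {u w : ℤ} (hN : NegPell l u w)
include h

theorem unit_notMem (v : HeightOneSpectrum (𝓞 k)) : (h.unit hN : 𝓞 k) ∉ v.asIdeal := fun hm =>
  v.isPrime.ne_top (Ideal.eq_top_of_isUnit_mem _ hm (h.unit hN).isUnit)

/-- Rational integers are squares modulo an inert prime. -/
theorem exists_sq_sub_intCast_mem {v : HeightOneSpectrum (𝓞 k)} {p : ℕ} (hp : p.Prime)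
    (hv : Above v p) (hl : ¬ IsSquare (l : ZMod p)) (m : ℤ) : ∃ B : 𝓞 k, B ^ 2 - m ∈ v.asIdeal := by
  by_cases hm : IsSquare (m : ZMod p)
  · obtain ⟨t, ht⟩ := ZMod.exists_int_of_isSquare hm
    refine ⟨t, ?_⟩
    rw [← neg_mem_iff, neg_sub]
    exact_mod_cast (hv _).2 ht
  · have := Fact.mk hp
    have hl0 : (l : ZMod p) ≠ 0 := fun h => hl (h ▸ IsSquare.zero)
    obtain ⟨x, hx⟩ := ZMod.isSquare_mul_of_not_isSquare hp hm hl
    obtain ⟨t, ht⟩ := ZMod.intCast_surjective (x * (l : ZMod p)⁻¹)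
    refine ⟨t * s, ?_⟩
    have h1 : (p : ℤ) ∣ t ^ 2 * l - m := by
      rw [← ZMod.intCast_zmod_eq_zero_iff_dvd]
      push_cast
      rw [ht, mul_pow, pow_two x, ← hx]
      field_simp
      ring
    have h2 := (hv _).2 h1
    push_cast at h2
    rwa [mul_pow, h.sq]

theorem exists_unit_sub_sq_of_inert {v : HeightOneSpectrum (𝓞 k)} {p : ℕ} (hp : p.Prime) (hp4 : p % 4 = 1)
    (hv : Above v p) (hl : ¬ IsSquare (l : ZMod p)) : ∃ A : 𝓞 k, (h.unit hN : 𝓞 k) - A ^ 2 ∈ v.asIdeal := by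
  have := Fact.mk hp
  have hp2 : p ≠ 2 := by rintro rfl; omega
  obtain ⟨i₀, hi₀⟩ := ZMod.exists_int_of_isSquare (p := p) (m := -1) (by
    push_cast
    exact ZMod.exists_sq_eq_neg_one_iff.2 (by omega))
  have hpi : Prime (p : ℤ) := Nat.prime_iff_prime_int.1 hp
  have hp2' : ¬ (p : ℤ) ∣ 2 := fun hd => by
    have := Int.le_of_dvd (by norm_num) hd
    have := hp.two_le
    omega
  have hi₀' : ¬ (p : ℤ) ∣ i₀ := fun hd => by
    have h1 := dvd_add hi₀ (dvd_pow hd two_ne_zero)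
    rw [sub_add_cancel] at h1
    exact hpi.not_isUnit (isUnit_of_dvd_unit h1 (by norm_num))
  obtain ⟨i, hi, hiu⟩ : ∃ i : ℤ, (p : ℤ) ∣ -1 - i ^ 2 ∧ ¬ (p : ℤ) ∣ i - u := by
    by_cases h1 : (p : ℤ) ∣ i₀ - u
    · refine ⟨-i₀, by rwa [neg_sq], fun h2 => ?_⟩
      have h3 := dvd_sub h1 h2
      rw [show i₀ - u - (-i₀ - u) = 2 * i₀ by ring] at h3
      exact (hpi.dvd_or_dvd h3).elim hp2' hi₀'
    · exact ⟨i₀, hi₀, h1⟩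
  obtain ⟨B, hB⟩ := h.exists_sq_sub_intCast_mem hp hv hl (2 * (i - u))
  have hBv : B ∉ v.asIdeal := fun hb => by
    have h1 := sub_mem (Ideal.pow_mem_of_mem _ hb 2 (by norm_num)) hB
    rw [sub_sub_cancel, hv] at h1
    exact (hpi.dvd_or_dvd h1).elim hp2' hiu
  have hmax := v.isMaximal
  obtain ⟨C, hC⟩ : ∃ C, B * C - 1 ∈ v.asIdeal := by
    obtain ⟨C, hC⟩ := hmax.exists_inv hBv
    obtain ⟨y, hy, hy'⟩ := hC
    refine ⟨C, ?_⟩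
    have : B * C - 1 = -y := by linear_combination hy'
    rw [this]; exact neg_mem hy
  refine ⟨(1 + i * (h.unit hN : 𝓞 k)) * C, ?_⟩
  have he : (h.unit hN : 𝓞 k) ^ 2 = 2 * u * (h.unit hN : 𝓞 k) + 1 := by
    rw [h.coe_unit]
    have h2 : (u : 𝓞 k) ^ 2 + 1 = l * w ^ 2 := by exact_mod_cast hN.eq
    linear_combination (w : 𝓞 k) ^ 2 * h.sq - h2
  have hi' := (hv _).2 hi
  push_cast at hi' hB
  have : (h.unit hN : 𝓞 k) - ((1 + i * (h.unit hN : 𝓞 k)) * C) ^ 2 =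
      (h.unit hN : 𝓞 k) ^ 2 * C ^ 2 * (-1 - (i : 𝓞 k) ^ 2) + (h.unit hN : 𝓞 k) * C ^ 2 * (B ^ 2 - 2 * (i - u))
        - (h.unit hN : 𝓞 k) * (B * C + 1) * (B * C - 1) := by
    linear_combination C ^ 2 * he
  rw [this]
  exact sub_mem (add_mem (Ideal.mul_mem_left _ _ hi') (Ideal.mul_mem_left _ _ hB)) (Ideal.mul_mem_left _ _ hC)

theorem exists_unit_sub_sq_of_above_l {v : HeightOneSpectrum (𝓞 k)} (hv : Above v l) :
    ∃ A : 𝓞 k, (h.unit hN : 𝓞 k) - A ^ 2 ∈ v.asIdeal := by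
  have := Fact.mk h.prime
  have hu2 : (u : ZMod l) ^ 2 = -1 := by
    have h1 := congrArg (Int.cast (R := ZMod l)) hN.eq
    push_cast at h1
    rw [ZMod.natCast_self] at h1
    linear_combination h1
  have hsq : IsSquare (u : ZMod l) := by
    have hu0 : (u : ZMod l) ≠ 0 := fun h0 => by rw [h0] at hu2; simp at hu2
    rw [ZMod.euler_criterion l hu0]
    have h1 := h.mod
    rw [show l / 2 = 4 * (l / 8) by omega, pow_mul, show (u : ZMod l) ^ 4 = (u ^ 2) ^ 2 by ring, hu2]
    simp
  obtain ⟨t, ht⟩ := ZMod.exists_int_of_isSquare hsq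
  refine ⟨t, ?_⟩
  have hs : s ∈ v.asIdeal := v.isPrime.mem_of_pow_mem 2 (by rw [h.sq]; exact hv.self_mem)
  have h1 := (hv _).2 ht
  push_cast at h1
  rw [h.coe_unit, show (u : 𝓞 k) + w * s - t ^ 2 = (u - t ^ 2) + w * s by ring]
  exact add_mem h1 (Ideal.mul_mem_left _ _ hs)

end SqrtPrime

end

section

variable {k : Type*} [Field k] [NumberField k]

namespace SqrtPrime

variable [Algebra.IsQuadraticExtension ℚ k] {l : ℕ} {s : 𝓞 k} (h : SqrtPrime l s)
  {τ : Gal(k/ℚ)} (hτ : τ ≠ 1) {u w : ℤ} (hN : NegPell l u w)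

/-- The element of `k` whose square root generates the cyclic quartic field. -/
noncomputable def radicand (n : ℕ) : 𝓞 k := n * ((h.unit hN : 𝓞 k) * s)

include h

theorem coe_radicand (n : ℕ) : ((h.radicand hN n : 𝓞 k) : k) = n * (((h.unit hN : 𝓞 k) : k) * s) := by
  change algebraMap (𝓞 k) k _ = _
  rw [radicand, map_mul, map_mul, map_natCast]

include hτ in
theorem exists_odd_ord_of_two {v : HeightOneSpectrum (𝓞 k)} (hv : Above v 2)
    (hq : quartSym l 2 = (-1) ^ ((l - 1) / 8)) : ∃ a : k, Odd (v.ord (a ^ 2 - (h.unit hN : 𝓞 k))) := by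
  have hl2 : 2 ≠ l := by have := h.mod; omega
  have hd := h.isDegOne Nat.prime_two hl2 hv (h.conj_ne_of_two hτ hv)
  have hb : ∀ (z : ℤ) (j : ℕ), (z : k) ∈ v.ball (j : ℤ) ↔ (2 : ℤ) ^ j ∣ z := fun z j =>
    intCast_mem_ball_iff Nat.prime_two hv hd.ord j
  obtain ⟨z, hz⟩ := hd.exists_int_sub_mem (algebraMap_mem_ball (h.unit hN : 𝓞 k)) 3
  rcases (h.mod_eight_iff hτ hN hv hz).2 hq with h1 | h1
  · have h2 : (1 : k) - (h.unit hN : 𝓞 k) ∈ v.ball 3 := by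
      have h3 := sub_mem ((hb (1 - z) 3).2 (by omega)) hz
      push_cast at h3
      rwa [sub_sub_sub_cancel_right] at h3
    by_cases h4 : (1 : k) - (h.unit hN : 𝓞 k) ∈ v.ball 4
    · refine ⟨3, ?_⟩
      have h5 : v.ord ((3 : k) ^ 2 - (h.unit hN : 𝓞 k)) = 3 := by
        have h6 : (3 : k) ^ 2 - (h.unit hN : 𝓞 k) = (8 : ℤ) + (1 - (h.unit hN : 𝓞 k)) := by
          push_cast; ring
        rw [h6]
        refine ord_eq_of_ball (add_mem ((hb 8 3).2 (by norm_num)) h2) fun h7 => ?_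
        have h8 := sub_mem h7 h4
        rw [add_sub_cancel_right] at h8
        exact absurd ((hb 8 4).1 h8) (by norm_num)
      rw [h5]; decide
    · refine ⟨1, ?_⟩
      rw [one_pow, ord_eq_of_ball h2 h4]; decide
  · refine ⟨1, ?_⟩
    have h6 : (1 : k) ^ 2 - (h.unit hN : 𝓞 k) = ((1 - z : ℤ) : k) - ((h.unit hN : 𝓞 k) - z) := by
      push_cast; ring
    have h5 : v.ord ((1 : k) ^ 2 - (h.unit hN : 𝓞 k)) = 1 := by
      rw [h6]
      refine ord_eq_of_ball (sub_mem ((hb _ 1).2 (by omega)) (ball_mono (by norm_num) hz)) fun h7 => ?_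
      have h8 := add_mem h7 (ball_mono (by norm_num) hz : _ ∈ v.ball (1 + 1))
      rw [sub_add_cancel] at h8
      have := (hb (1 - z) 2).1 h8
      omega
    rw [h5]; decide

section
variable {n : ℕ} (hn : n ≠ 0)
include hn

theorem ord_radicand (v : HeightOneSpectrum (𝓞 k)) :
    v.ord (h.radicand hN n : k) = v.ord (n : k) + v.ord (s : k) := by
  have h1 : ((h.unit hN : 𝓞 k) : k) ≠ 0 := RingOfIntegers.coe_ne_zero_iff.2 (h.unit hN).ne_zero
  rw [h.coe_radicand, ord_mul v (by exact_mod_cast hn) (mul_ne_zero h1 h.s_ne_zero), ord_mul v h1 h.s_ne_zero,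
    show v.ord ((h.unit hN : 𝓞 k) : k) = 0 from v.ord_eq_zero_of_notMem (h.unit_notMem hN v), zero_add]

theorem dvd_of_odd_ord_radicand {v : HeightOneSpectrum (𝓞 k)} {p : ℕ} (hp : p.Prime) (hv : Above v p)
    (ho : v.ord (h.radicand hN n : k) ≠ 0) : p = l ∨ p ∣ n := by
  by_contra! hc
  rw [h.ord_radicand hN hn, h.ord_s_of_ne hp hc.1 hv, add_zero] at ho
  apply ho
  have := v.ord_eq_zero_of_notMem (K := k) (r := (n : 𝓞 k)) (fun hm => hc.2 ((hv.natCast n).1 hm))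
  rwa [map_natCast] at this

theorem ord_radicand_above_l (hnl : n.Coprime l) {v : HeightOneSpectrum (𝓞 k)} (hv : Above v l) :
    v.ord (h.radicand hN n : k) = 1 := by
  rw [h.ord_radicand hN hn, h.ord_s hv]
  have := v.ord_eq_zero_of_notMem (K := k) (r := (n : 𝓞 k)) (fun hm =>
    h.prime.one_lt.ne' (Nat.eq_one_of_dvd_coprimes hnl.symm dvd_rfl ((hv.natCast n).1 hm)))
  rw [map_natCast] at this
  rw [this, zero_add]

theorem ord_radicand_of_dvd (hnl : n.Coprime l) (hsq : Squarefree n) {v : HeightOneSpectrum (𝓞 k)} {p : ℕ}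
    (hp : p.Prime) (hv : Above v p) (hpn : p ∣ n) : v.ord (h.radicand hN n : k) = 1 := by
  have hpl : p ≠ l := by
    rintro rfl
    exact hp.one_lt.ne' (Nat.eq_one_of_dvd_coprimes hnl hpn dvd_rfl)
  obtain ⟨m, rfl⟩ := hpn
  have hm : ¬ p ∣ m := fun hm => hp.one_lt.ne' (Nat.isUnit_iff.1 (hsq p (mul_dvd_mul_left p hm)))
  have := v.ord_eq_zero_of_notMem (K := k) (r := (m : 𝓞 k)) (fun h' => hm ((hv.natCast m).1 h'))
  rw [map_natCast] at this
  rw [h.ord_radicand hN hn, h.ord_s_of_ne hp hpl hv, Nat.cast_mul,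
    ord_mul v (by exact_mod_cast hp.ne_zero) (by exact_mod_cast right_ne_zero_of_mul hn),
    h.ord_prime hp hpl hv, this, add_zero, add_zero]

theorem radicand_not_square (hnl : n.Coprime l) (x : k) : x ^ 2 ≠ h.radicand hN n := by
  intro hx
  obtain ⟨v, hv⟩ := SqrtPrime.exists_above (k := k) h.prime
  have h1 := h.ord_radicand_above_l hN hn hnl hv
  rw [← hx, ord_pow] at h1
  omega

theorem radicand_ne_zero : (h.radicand hN n : k) ≠ 0 := by
  rw [h.coe_radicand]
  exact mul_ne_zero (by exact_mod_cast hn)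
    (mul_ne_zero (RingOfIntegers.coe_ne_zero_iff.2 (h.unit hN).ne_zero) h.s_ne_zero)

theorem radicand_pos {ψ : k →+* ℝ} (hψ : 0 < ψ s) : 0 < ψ (h.radicand hN n) := by
  have := h.unit_pos hN hψ
  have : (0 : ℝ) < n := by exact_mod_cast Nat.pos_of_ne_zero hn
  rw [h.coe_radicand, map_mul, map_mul, map_natCast]
  positivity

include hτ in
theorem conj_radicand_pos {ψ : k →+* ℝ} (hψ : 0 < ψ s) : 0 < ψ (τ (h.radicand hN n)) := by
  have := h.conj_unit_neg hτ hN hψ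
  have : (0 : ℝ) < n := by exact_mod_cast Nat.pos_of_ne_zero hn
  rw [h.coe_radicand, map_mul, map_mul, map_mul, map_mul, map_natCast, map_natCast, h.conj_s hτ, map_neg]
  have : 0 < ψ (τ (h.unit hN : 𝓞 k)) * -ψ s := mul_pos_of_neg_of_neg ‹_› (by linarith)
  positivity

include hτ in
theorem exists_unit_eq_sq_sub_radicand (hnl : n.Coprime l)
    (hodd : ∀ p : ℕ, p.Prime → p ∣ n → p ≠ 2 → p % 4 = 1)
    (hspl : ∀ p : ℕ, p.Prime → p ∣ n → p ≠ 2 → IsSquare (l : ZMod p) → quartSym l p = quartSym p l)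
    (h2 : 2 ∣ n → quartSym l 2 = (-1) ^ ((l - 1) / 8)) :
    ∃ x y : k, ((h.unit hN : 𝓞 k) : k) = x ^ 2 - h.radicand hN n * y ^ 2 := by
  obtain ⟨ψ, hψ⟩ := h.exists_embedding_pos hτ
  refine h.unit_eq_sq_sub hτ hN hψ (h.radicand_ne_zero hN hn) (h.conj_radicand_pos hτ hN hn hψ) ?_
    (h.radicand_not_square hN hn hnl)
  intro v hv
  obtain ⟨p, hp, hvp⟩ := Above.exists_of_prime v
  have aux : ∀ {π A : 𝓞 k}, p ≠ 2 → v.ord (π : k) = 1 → (h.unit hN : 𝓞 k) - A ^ 2 ∈ v.asIdeal →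
      ∃ a : k, Odd (v.ord (a ^ 2 - (h.unit hN : 𝓞 k))) := fun hp2 hπ hA => by
    obtain ⟨a, ha⟩ := exists_ord_sq_sub_eq_one (K := k) (hvp.two_notMem hp2) hπ (h.unit_notMem hN v) hA
    exact ⟨a, ha ▸ odd_one⟩
  rcases h.dvd_of_odd_ord_radicand hN hn hp hvp (fun h0 => by rw [h0] at hv; exact Int.not_odd_zero hv) with
    rfl | hpn
  · obtain ⟨A, hA⟩ := h.exists_unit_sub_sq_of_above_l hN hvp
    exact aux (fun h' => by have := h.mod; omega) (h.ord_s hvp) hA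
  · have hpl : p ≠ l := by
      rintro rfl
      exact hp.one_lt.ne' (Nat.eq_one_of_dvd_coprimes hnl hpn dvd_rfl)
    by_cases hp2 : p = 2
    · subst hp2
      exact h.exists_odd_ord_of_two hτ hN hvp (h2 hpn)
    have hp4 := hodd p hp hpn hp2
    have hord : v.ord (((p : 𝓞 k)) : k) = 1 := by
      change v.ord (algebraMap (𝓞 k) k p) = 1
      rw [map_natCast]; exact h.ord_prime hp hpl hvp
    by_cases hs : IsSquare (l : ZMod p)
    · obtain ⟨A, hA⟩ := (h.exists_sq_iff hτ hN hp hp4 hpl hvp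
        ((h.conj_ne_iff hτ hp hp2 hpl hvp).2 hs)).2 (hspl p hp hpn hp2 hs)
      exact aux hp2 hord hA
    · obtain ⟨A, hA⟩ := h.exists_unit_sub_sq_of_inert hN hp hp4 hvp hs
      exact aux hp2 hord hA

end

end SqrtPrime

end

theorem Int.sq_mod_eight' (x : ℤ) : x % 2 = 1 ∧ x ^ 2 % 8 = 1 ∨ x % 2 = 0 ∧ (x ^ 2 % 8 = 0 ∨ x ^ 2 % 8 = 4) := by
  have h : x % 8 = 0 ∨ x % 8 = 1 ∨ x % 8 = 2 ∨ x % 8 = 3 ∨ x % 8 = 4 ∨ x % 8 = 5 ∨ x % 8 = 6 ∨ x % 8 = 7 := by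
    omega
  rcases h with h | h | h | h | h | h | h | h <;> simp [pow_two, Int.mul_emod, h] <;> omega

theorem not_four_dvd_pow_mul_sub {C D x y : ℤ} {j : ℕ} (hC : C % 4 = 3) (hD : D % 4 = 3)
    (h : (4 : ℤ) ∣ 2 ^ (2 * j) * C - (x ^ 2 - D * y ^ 2)) : ¬(j = 0 ∨ ¬((2 : ℤ) ∣ x ∧ (2 : ℤ) ∣ y)) := by
  have hx := Int.sq_mod_eight' x
  have hy := Int.sq_mod_eight' y
  obtain ⟨e, rfl⟩ : ∃ e, D = 4 * e + 3 := ⟨D / 4, by omega⟩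
  rw [show (4 * e + 3) * y ^ 2 = 4 * (e * y ^ 2) + 3 * y ^ 2 by ring] at h
  generalize e * y ^ 2 = t at h
  rintro (rfl | hxy)
  · rw [mul_zero, pow_zero, one_mul] at h
    omega
  · rcases j with _ | j
    · rw [mul_zero, pow_zero, one_mul] at h
      omega
    · rw [show (2 : ℤ) ^ (2 * (j + 1)) * C = 4 * (2 ^ (2 * j) * C) by ring] at h
      generalize 2 ^ (2 * j) * C = t' at h
      omega

theorem not_eight_dvd_pow_mul_sub {C D x y : ℤ} {j : ℕ}
    (hCD : C % 8 = 7 ∧ D % 8 = 6 ∨ (C % 8 = 3 ∨ C % 8 = 5) ∧ D % 8 = 2)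
    (h : (8 : ℤ) ∣ 2 ^ (2 * j) * C - (x ^ 2 - D * y ^ 2)) : ¬(j = 0 ∨ ¬((2 : ℤ) ∣ x ∧ (2 : ℤ) ∣ y)) := by
  have hx := Int.sq_mod_eight' x
  have hy := Int.sq_mod_eight' y
  obtain ⟨e, f, rfl, hf⟩ : ∃ e f, D = 8 * e + f ∧ (C % 8 = 7 ∧ f = 6 ∨ (C % 8 = 3 ∨ C % 8 = 5) ∧ f = 2) :=
    ⟨D / 8, D % 8, by omega, by omega⟩
  rw [show (8 * e + f) * y ^ 2 = 8 * (e * y ^ 2) + f * y ^ 2 by ring] at h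
  generalize e * y ^ 2 = t at h
  rintro (rfl | hxy)
  · rw [mul_zero, pow_zero, one_mul] at h
    rcases hf with ⟨hf, rfl⟩ | ⟨hf, rfl⟩ <;> omega
  · rcases j with _ | j
    · rw [mul_zero, pow_zero, one_mul] at h
      rcases hf with ⟨hf, rfl⟩ | ⟨hf, rfl⟩ <;> omega
    · rw [show (2 : ℤ) ^ (2 * (j + 1)) * C = 4 * (2 ^ (2 * j) * C) by ring] at h
      generalize 2 ^ (2 * j) * C = t' at h
      rcases hf with ⟨hf, rfl⟩ | ⟨hf, rfl⟩ <;> omega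

namespace IsDedekindDomain.HeightOneSpectrum.IsDegOne

variable {k : Type*} [Field k] [NumberField k] {v : HeightOneSpectrum (𝓞 k)} {p : ℕ}

/-- A representation by the form `x ^ 2 - d y ^ 2` yields a primitive congruence over the integers. -/
theorem exists_int_of_eq_sq_sub (hv : v.IsDegOne p) {a b c d : k} (h : c = a ^ 2 - d * b ^ 2) {C D : ℤ}
    {N : ℕ} (hN : 1 ≤ N) (hC : c - C ∈ v.ball (N : ℤ)) (hD : d - D ∈ v.ball (N : ℤ)) :
    ∃ (j : ℕ) (x y : ℤ), (p : ℤ) ^ N ∣ (p : ℤ) ^ (2 * j) * C - (x ^ 2 - D * y ^ 2) ∧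
      (j = 0 ∨ ¬((p : ℤ) ∣ x ∧ (p : ℤ) ∣ y)) := by
  classical
  have hp0 : (p : k) ≠ 0 := by exact_mod_cast hv.prime.ne_zero
  have hpow : ∀ (j : ℕ) {x : k}, x ≠ 0 → v.ord ((p : k) ^ j * x) = j + v.ord x := fun j x hx => by
    rw [ord_mul v (pow_ne_zero _ hp0) hx, ord_pow, hv.ord, mul_one]
  have hex : ∃ j : ℕ, (p : k) ^ j * a ∈ v.ball 0 ∧ (p : k) ^ j * b ∈ v.ball 0 := by
    refine ⟨(v.ord a).natAbs + (v.ord b).natAbs, ?_, ?_⟩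
    · by_cases ha : a = 0
      · exact Or.inl (by rw [ha, mul_zero])
      · exact Or.inr (by rw [hpow _ ha]; omega)
    · by_cases hb : b = 0
      · exact Or.inl (by rw [hb, mul_zero])
      · exact Or.inr (by rw [hpow _ hb]; omega)
  obtain ⟨hX, hY⟩ := Nat.find_spec hex
  have hmin := fun i => Nat.find_min (m := i) hex
  generalize Nat.find hex = j at hX hY hmin
  obtain ⟨x, hx⟩ := hv.exists_int_sub_mem hX N
  obtain ⟨y, hy⟩ := hv.exists_int_sub_mem hY N
  have hD0 : d ∈ v.ball 0 := by
    have := add_mem (ball_mono (by positivity) hD) (intCast_mem_ball (v := v) D)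
    rwa [sub_add_cancel] at this
  have hp0' : ((p : k) ^ j) ^ 2 ∈ v.ball 0 := by
    have := intCast_mem_ball (v := v) (K := k) (((p : ℤ) ^ j) ^ 2)
    exact_mod_cast this
  refine ⟨j, x, y, ?_, ?_⟩
  · rw [← intCast_mem_ball_iff hv.prime hv.above hv.ord]
    have h1 := mul_mem_ball_left (add_mem hX (intCast_mem_ball x)) hx
    have h2 := mul_mem_ball_left (mul_mem_ball_left hD0 (add_mem hY (intCast_mem_ball y))) hy
    have h2' : (d * ((p : k) ^ j * b + y)) * ((p : k) ^ j * b - y) ∈ v.ball (N : ℤ) := by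
      simpa using h2
    have h3 := mul_mem_ball_left hp0' hC
    have h4 := mul_mem_ball_left (intCast_mem_ball (y ^ 2)) hD
    have h5 := sub_mem (sub_mem (sub_mem h1 h2') h3) h4
    convert h5 using 1
    push_cast
    rw [h]
    ring
  · by_contra! hc
    obtain ⟨hj, hpx, hpy⟩ := hc
    have key : ∀ {a : k} {x : ℤ}, (p : ℤ) ∣ x → (p : k) ^ j * a - x ∈ v.ball (N : ℤ) →
        (p : k) ^ (j - 1) * a ∈ v.ball 0 := fun {a x} hpx hx => by
      by_cases ha : a = 0
      · exact Or.inl (by rw [ha, mul_zero])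
      have h1 : (x : k) ∈ v.ball ((1 : ℕ) : ℤ) :=
        (intCast_mem_ball_iff hv.prime hv.above hv.ord 1).2 (by rwa [pow_one])
      have h2 := add_mem (ball_mono (by exact_mod_cast hN) hx) h1
      rw [sub_add_cancel, mem_ball' (mul_ne_zero (pow_ne_zero _ hp0) ha), hpow _ ha] at h2
      refine Or.inr ?_
      rw [hpow _ ha]
      push_cast at h2
      omega
    exact hmin (j - 1) (by omega) ⟨key hpx hx, key hpy hy⟩

end IsDedekindDomain.HeightOneSpectrum.IsDegOne

section

variable {k : Type*} [Field k] [NumberField k]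

/-- Sums of two squares in a field. -/
def IsSumTwoSq {K : Type*} [Field K] (x : K) : Prop := ∃ a b : K, x = a ^ 2 + b ^ 2

namespace IsSumTwoSq

variable {K : Type*} [Field K] {x y : K}

theorem mul (hx : IsSumTwoSq x) (hy : IsSumTwoSq y) : IsSumTwoSq (x * y) := by
  obtain ⟨a, b, rfl⟩ := hx
  obtain ⟨c, d, rfl⟩ := hy
  exact ⟨a * c - b * d, a * d + b * c, by ring⟩

theorem sq (x : K) : IsSumTwoSq (x ^ 2) := ⟨x, 0, by ring⟩

theorem of_mul (hx : IsSumTwoSq x) (hx0 : x ≠ 0) (hxy : IsSumTwoSq (x * y)) : IsSumTwoSq y := by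
  have := (hx.mul hxy).mul (sq x⁻¹)
  rwa [show x * (x * y) * x⁻¹ ^ 2 = y by field_simp] at this

end IsSumTwoSq

namespace SqrtPrime

variable [Algebra.IsQuadraticExtension ℚ k] {l : ℕ} {s : 𝓞 k} (h : SqrtPrime l s)
  {τ : Gal(k/ℚ)} (hτ : τ ≠ 1) {u w : ℤ} (hN : NegPell l u w)
include h

include hτ in
theorem isDegOne_two {v : HeightOneSpectrum (𝓞 k)} (hv : Above v 2) : v.IsDegOne 2 :=
  h.isDegOne Nat.prime_two (by have := h.mod; omega) hv (h.conj_ne_of_two hτ hv)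

include hτ in
theorem radicand_sub_mem {v : HeightOneSpectrum (𝓞 k)} (hv : Above v 2) {n N : ℕ} (hn : 2 ^ N ∣ 4 * n) :
    (h.radicand hN n : k) - (n : ℤ) ∈ v.ball (N : ℤ) := by
  obtain ⟨u', hu⟩ := hN.four_dvd_u h.mod
  obtain ⟨w', hw⟩ : ∃ w', w * l = 4 * w' + 1 := ⟨w * l / 4, by
    have h1 := hN.v_mod h.mod
    have h2 := h.mod
    have : w * l % 4 = 1 := by
      rw [Int.mul_emod, h1, show (l : ℤ) % 4 = 1 by omega]; rfl
    omega⟩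
  have h1 : (h.radicand hN n : k) - (n : ℤ) = algebraMap (𝓞 k) k (w' + u' * s) * ((4 * n : ℕ) : ℤ) := by
    have hw' : (w : k) * l = 4 * w' + 1 := by exact_mod_cast congrArg (Int.cast (R := k)) hw
    rw [h.coe_radicand, h.coe_unit', hu, map_add, map_mul, map_intCast, map_intCast]
    push_cast
    linear_combination (n : k) * w * h.sq' + (n : k) * hw'
  rw [h1]
  exact mul_mem_ball_left (algebraMap_mem_ball _) ((intCast_mem_ball_iff Nat.prime_two hv
    (h.isDegOne_two hτ hv).ord N).2 (by exact_mod_cast hn))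

include hτ in
/-- At the prime 2, the element `-1` is not a norm if the odd part of `n` is `3` modulo `4`. -/
theorem neg_one_ne_sq_sub_radicand_of_mod {n : ℕ} (hn : n % 4 = 3 ∨ n % 8 = 6) (a b : k) :
    (-1 : k) ≠ a ^ 2 - h.radicand hN n * b ^ 2 := by
  intro hab
  obtain ⟨v, hv⟩ := SqrtPrime.exists_above (k := k) Nat.prime_two
  have hd := h.isDegOne_two hτ hv
  rcases hn with hn | hn
  · obtain ⟨j, x, y, h1, h2⟩ := hd.exists_int_of_eq_sq_sub hab (C := -1) (D := n) (N := 2) (by norm_num)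
      (Or.inl (by simp)) (h.radicand_sub_mem hτ hN hv (by omega))
    simp only [Nat.cast_ofNat] at h1 h2
    exact not_four_dvd_pow_mul_sub (C := -1) (D := n) (by norm_num) (by omega) h1 h2
  · obtain ⟨j, x, y, h1, h2⟩ := hd.exists_int_of_eq_sq_sub hab (C := -1) (D := n) (N := 3) (by norm_num)
      (Or.inl (by simp)) (h.radicand_sub_mem hτ hN hv (by omega))
    simp only [Nat.cast_ofNat] at h1 h2
    exact not_eight_dvd_pow_mul_sub (C := -1) (D := n) (Or.inl ⟨by norm_num, by omega⟩) h1 h2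

include hτ in
theorem unit_ne_sq_sub_radicand_of_mod {n : ℕ} (hn : n % 8 = 2) (hq : quartSym l 2 ≠ (-1) ^ ((l - 1) / 8))
    (a b : k) : ((h.unit hN : 𝓞 k) : k) ≠ a ^ 2 - h.radicand hN n * b ^ 2 := by
  intro hab
  obtain ⟨v, hv⟩ := SqrtPrime.exists_above (k := k) Nat.prime_two
  have hd := h.isDegOne_two hτ hv
  obtain ⟨z, hz⟩ := hd.exists_int_sub_mem (algebraMap_mem_ball (h.unit hN : 𝓞 k)) 3
  have hz8 := (h.mod_eight_iff hτ hN hv hz).not.2 hq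
  have hz2 : ¬ (2 : ℤ) ∣ z := fun h2 => by
    have h3 := (intCast_mem_ball_iff Nat.prime_two hv hd.ord (z := z) 1).2 (by simpa using h2)
    have h4 := add_mem (ball_mono (by norm_num) hz) h3
    rw [sub_add_cancel] at h4
    exact h.unit_notMem hN v (algebraMap_mem_ball_one.1 h4)
  obtain ⟨j, x, y, h1, h2⟩ := hd.exists_int_of_eq_sq_sub hab (D := n) (N := 3) (by norm_num) hz
    (h.radicand_sub_mem hτ hN hv (by omega))
  simp only [Nat.cast_ofNat] at h1 h2
  exact not_eight_dvd_pow_mul_sub (C := z) (D := n) (Or.inr ⟨by omega, by omega⟩) h1 h2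

include hτ in
theorem not_isSumTwoSq_of_mod {q : ℕ} (hq : q % 4 = 3) : ¬ IsSumTwoSq (q : k) := by
  rintro ⟨a, b, hab⟩
  obtain ⟨v, hv⟩ := SqrtPrime.exists_above (k := k) Nat.prime_two
  have hd := h.isDegOne_two hτ hv
  obtain ⟨j, x, y, h1, h2⟩ := hd.exists_int_of_eq_sq_sub (a := a) (b := b) (c := q) (d := -1)
    (by rw [hab]; ring) (C := q) (D := -1) (N := 2) (by norm_num)
    (Or.inl (by simp)) (Or.inl (by simp))
  simp only [Nat.cast_ofNat] at h1 h2
  exact not_four_dvd_pow_mul_sub (C := q) (D := -1) (by omega) (by norm_num) h1 h2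

end SqrtPrime

end

section

variable {k : Type*} [Field k] [NumberField k]

namespace SqrtPrime

variable [Algebra.IsQuadraticExtension ℚ k] {l : ℕ} {s : 𝓞 k} (h : SqrtPrime l s)
  {τ : Gal(k/ℚ)} (hτ : τ ≠ 1) {u w : ℤ} (hN : NegPell l u w) {ψ : k →+* ℝ} (hψ : 0 < ψ s)
include h hτ hN hψ

theorem card_twoTorsion_sqrt_neg_one {F : Type*} [Field F] [NumberField F] [Algebra k F]
    [Algebra.IsQuadraticExtension k F] {σ : Gal(F/k)} {r : F} (hG : Gen σ r (-1 : 𝓞 k)) :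
    Nat.card {x : ClassGroup (𝓞 F) // x ^ 2 = 1} ≤ 2 := by
  classical
  have h2 : ∀ v : HeightOneSpectrum (𝓞 k), ram F v = 2 → Above v 2 := fun v hv => by
    by_contra h2
    have h3 : (2 : 𝓞 k) ∉ v.asIdeal := fun h3 => h2 (Above.of_two_mem h3)
    have := hG.ram_eq_one_of_odd (v := v) (fun h4 => v.isPrime.ne_top
      ((Ideal.eq_top_iff_one _).2 (by simpa using h4))) h3
    omega
  obtain ⟨v₀, hv₀⟩ := SqrtPrime.exists_above (k := k) Nat.prime_two
  set T : Finset (HeightOneSpectrum (𝓞 k)) := {v ∈ {v₀, conj τ v₀} | ram F v = 2} with hT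
  have hT' : ∀ v, v ∈ T ↔ ram F v = 2 := fun v => by
    rw [hT, Finset.mem_filter]
    refine and_iff_right_of_imp fun hv => ?_
    simpa using SqrtPrime.eq_or_eq_conj hτ Nat.prime_two hv₀ (h2 v hv)
  have hT2 : T.card ≤ 2 := (Finset.card_filter_le _ _).trans Finset.card_le_two
  have hA := card_twoTorsion_mul hG.ne_one (h.odd_classNumber hN) T hT'
  have h4 : (squares (𝓞 k)ˣ).relIndex (normUnits k F) = 1 := by
    rw [Subgroup.relIndex_eq_one]
    intro x hx
    obtain ⟨a, b, hab⟩ := hG.mem_normUnits_iff.1 hx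
    have hx0 : ((x : 𝓞 k) : k) ≠ 0 := RingOfIntegers.coe_ne_zero_iff.2 x.ne_zero
    have key : ∀ φ : k →+* ℝ, 0 < φ ((x : 𝓞 k) : k) := fun φ => by
      refine lt_of_le_of_ne ?_ ((map_ne_zero φ).2 hx0).symm
      rw [hab]
      simp only [map_sub, map_mul, map_pow, map_neg, map_one]
      nlinarith [sq_nonneg (φ a), sq_nonneg (φ b)]
    obtain ⟨y, rfl⟩ := h.unit_eq_sq_of_pos hτ hN hψ (key ψ) (key (ψ.comp (τ : k →+* k)))
    exact ⟨y, rfl⟩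
  have hr := NumberField.Units.one_le_rank (finrank_quadExt k F)
  rw [NumberField.Units.index_squares F, h.index_squares_units, h4] at hA
  have h5 : 2 ^ T.card ≤ 2 ^ 2 := Nat.pow_le_pow_right (by norm_num) hT2
  have h6 : 2 ^ 2 ≤ 2 ^ (NumberField.Units.rank F + 1) := Nat.pow_le_pow_right (by norm_num) (by omega)
  have h9 := Nat.mul_le_mul_right (Nat.card {x : ClassGroup (𝓞 F) // x ^ 2 = 1}) h6
  omega

theorem isSumTwoSq_or {α β : k} (hα : α ≠ 0) (hβ : β ≠ 0) (hαψ : 0 < ψ α) (hαψ' : 0 < ψ (τ α))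
    (hβψ : 0 < ψ β) (hβψ' : 0 < ψ (τ β))
    (hlα : ∀ v : HeightOneSpectrum (𝓞 k), Odd (v.ord α) → ∃ a : k, Odd (v.ord (a ^ 2 + 1)))
    (hlβ : ∀ v : HeightOneSpectrum (𝓞 k), Odd (v.ord β) → ∃ a : k, Odd (v.ord (a ^ 2 + 1))) :
    IsSumTwoSq α ∨ IsSumTwoSq β ∨ IsSumTwoSq (α * β) := by
  obtain ⟨F, _, _, _, _, σ, r, hG⟩ := exists_quadExt (-1 : 𝓞 k) (fun x hx => by
    have h1 := congrArg ψ hx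
    rw [map_pow] at h1
    simp only [map_neg, map_one] at h1
    nlinarith [sq_nonneg (ψ x)])
  have hm1 : (((-1 : 𝓞 k)) : k) = -1 := by
    change algebraMap (𝓞 k) k (-1) = -1
    rw [map_neg, map_one]
  have hloc : ∀ {α : k}, (∀ v : HeightOneSpectrum (𝓞 k), Odd (v.ord α) → ∃ a : k, Odd (v.ord (a ^ 2 + 1))) →
      ∀ v : HeightOneSpectrum (𝓞 k), Odd (v.ord α) → ∃ z : F, z ≠ 0 ∧ Odd (v.ord (Algebra.norm k z)) := by
    intro α hα v hv
    obtain ⟨a, ha⟩ := hα v hv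
    obtain ⟨z, hz⟩ := hG.norm_iff.2 ⟨a, 1, show a ^ 2 + 1 = _ by rw [hm1]; ring⟩
    refine ⟨z, ?_, by rwa [hz]⟩
    rintro rfl
    rw [← hz, Algebra.norm_zero, HeightOneSpectrum.ord_zero] at ha
    exact Int.not_odd_zero ha
  have key : ∀ {α : k}, α ≠ 0 → 0 < ψ α → 0 < ψ (τ α) →
      (∃ (u : (𝓞 k)ˣ) (x : F), α = algebraMap (𝓞 k) k u * Algebra.norm k x) → IsSumTwoSq α := by
    rintro α hα hψα hψα' ⟨x, z, hxz⟩
    obtain ⟨a, b, hab⟩ := hG.norm_iff.1 ⟨z, rfl⟩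
    rw [hm1] at hab
    have hpos : ∀ φ : k →+* ℝ, 0 < φ α → 0 < φ ((x : 𝓞 k) : k) := fun φ hφ => by
      have h1 : 0 ≤ φ (a ^ 2 - -1 * b ^ 2) := by
        simp only [map_sub, map_mul, map_pow, map_neg, map_one]
        nlinarith [sq_nonneg (φ a), sq_nonneg (φ b)]
      rw [hxz, map_mul, hab] at hφ
      exact pos_of_mul_pos_left hφ h1
    obtain ⟨y, rfl⟩ := h.unit_eq_sq_of_pos hτ hN hψ (hpos ψ hψα) (hpos (ψ.comp (τ : k →+* k)) hψα')
    refine ⟨(y : 𝓞 k) * a, (y : 𝓞 k) * b, ?_⟩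
    rw [hxz, hab, Units.val_pow_eq_pow_val, map_pow]
    ring
  rcases exists_eq_unit_mul_norm_of_card_le_two hG.ne_one (h.odd_classNumber hN)
    (h.card_twoTorsion_sqrt_neg_one hτ hN hψ hG) hα hβ (hloc hlα) (hloc hlβ) with h1 | h1 | h1
  · exact Or.inl (key hα hαψ hαψ' h1)
  · exact Or.inr (Or.inl (key hβ hβψ hβψ' h1))
  · exact Or.inr (Or.inr (key (mul_ne_zero hα hβ) (by rw [map_mul]; positivity)
      (by rw [map_mul, map_mul]; positivity) h1))

omit hψ in
/-- The product of two inert primes that are `3` modulo `4` is a sum of two squares. -/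
theorem isSumTwoSq_mul {p q : ℕ} (hp : p.Prime) (hq : q.Prime) (hp4 : p % 4 = 3) (hq4 : q % 4 = 3)
    (hpl : ¬ IsSquare (l : ZMod p)) (hql : ¬ IsSquare (l : ZMod q)) : IsSumTwoSq ((p : k) * q) := by
  obtain ⟨ψ, hψ⟩ := h.exists_embedding_pos hτ
  have hloc : ∀ {q : ℕ}, q.Prime → q % 4 = 3 → ¬ IsSquare (l : ZMod q) →
      ∀ v : HeightOneSpectrum (𝓞 k), Odd (v.ord (q : k)) → ∃ a : k, Odd (v.ord (a ^ 2 + 1)) := by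
    intro q hq hq4 hql v hv
    have hqv : Above v q := Above.of_mem hq (by
      by_contra hm
      have := v.ord_eq_zero_of_notMem (K := k) hm
      rw [map_natCast] at this
      rw [this] at hv
      exact Int.not_odd_zero hv)
    have hql' : q ≠ l := by rintro rfl; exact hql (by rw [ZMod.natCast_self]; exact IsSquare.zero)
    obtain ⟨B, hB⟩ := h.exists_sq_sub_intCast_mem hq hqv hql (-1)
    obtain ⟨a, ha⟩ := exists_ord_sq_sub_eq_one (K := k) (hqv.two_notMem (by rintro rfl; omega))
      (π := (q : 𝓞 k)) (A := B) (e := -1) (by rw [map_natCast]; exact h.ord_prime hq hql' hqv)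
      (fun h4 => v.isPrime.ne_top ((Ideal.eq_top_iff_one _).2 (by simpa using h4)))
      (by rw [← neg_mem_iff, neg_sub]; simpa using hB)
    refine ⟨a, ?_⟩
    rw [map_neg, map_one, sub_neg_eq_add] at ha
    rw [ha]; exact odd_one
  have hpos : ∀ {q : ℕ}, q.Prime → ∀ φ : k →+* ℝ, 0 < φ q := fun hq φ => by
    rw [map_natCast]; exact_mod_cast hq.pos
  rcases h.isSumTwoSq_or hτ hN hψ (α := (p : k)) (β := (q : k)) (by exact_mod_cast hp.ne_zero)
    (by exact_mod_cast hq.ne_zero) (hpos hp ψ) (hpos hp (ψ.comp (τ : k →+* k))) (hpos hq ψ)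
    (hpos hq (ψ.comp (τ : k →+* k))) (hloc hp hp4 hpl) (hloc hq hq4 hql) with h1 | h1 | h1
  · exact (h.not_isSumTwoSq_of_mod hτ hp4 h1).elim
  · exact (h.not_isSumTwoSq_of_mod hτ hq4 h1).elim
  · exact h1

omit hψ in
theorem isSumTwoSq_natCast_aux (m : ℕ)
    (hm : ∀ p : ℕ, p.Prime → p ∣ m → p % 4 = 1 ∨ p % 4 = 3 ∧ ¬ IsSquare (l : ZMod p)) :
    (m % 4 = 1 → IsSumTwoSq (m : k)) ∧ (m % 4 = 3 → ∃ q : ℕ, q.Prime ∧ q % 4 = 3 ∧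
      ¬ IsSquare (l : ZMod q) ∧ IsSumTwoSq ((q : k) * m)) := by
  induction m using induction_on_primes with
  | zero => simp
  | one => exact ⟨fun _ => ⟨1, 0, by simp⟩, fun h => by omega⟩
  | prime_mul p a hp ih =>
    obtain ⟨ih1, ih3⟩ := ih fun q hq hqa => hm q hq (hqa.mul_left p)
    rcases hm p hp (dvd_mul_right p a) with hp4 | ⟨hp4, hpl⟩
    · have hpS : IsSumTwoSq (p : k) := by
        have := Fact.mk hp
        obtain ⟨x, y, hxy⟩ := Nat.Prime.sq_add_sq (p := p) (by omega)
        exact ⟨x, y, by exact_mod_cast hxy.symm⟩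
      rw [Nat.mul_mod, hp4, one_mul, Nat.mod_mod]
      push_cast
      refine ⟨fun ha => hpS.mul (ih1 ha), fun ha => ?_⟩
      obtain ⟨q, hq, hq4, hql, hqS⟩ := ih3 ha
      exact ⟨q, hq, hq4, hql, by rw [mul_left_comm]; exact hpS.mul hqS⟩
    · have hpa : p * a % 4 = 3 * (a % 4) % 4 := by rw [Nat.mul_mod, hp4]
      rw [hpa]
      push_cast
      constructor
      · intro ha
        obtain ⟨q, hq, hq4, hql, hqS⟩ := ih3 (by omega)
        have hq0 : (q : k) ≠ 0 := by exact_mod_cast hq.ne_zero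
        refine (IsSumTwoSq.sq (q : k)).of_mul (pow_ne_zero _ hq0) ?_
        rw [show (q : k) ^ 2 * (p * a) = (q * p) * (q * a) by ring]
        exact (h.isSumTwoSq_mul hτ hN hq hp hq4 hp4 hql hpl).mul hqS
      · intro ha
        refine ⟨p, hp, hp4, hpl, ?_⟩
        rw [← mul_assoc, ← pow_two]
        exact (IsSumTwoSq.sq (p : k)).mul (ih1 (by omega))

omit hψ in
theorem exists_neg_one_eq_sq_sub_radicand {n m : ℕ} (hn : n ≠ 0) (hnl : n.Coprime l)
    (hnm : n = m ∨ n = 2 * m) (hm4 : m % 4 = 1)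
    (hm : ∀ p : ℕ, p.Prime → p ∣ m → p % 4 = 1 ∨ p % 4 = 3 ∧ ¬ IsSquare (l : ZMod p)) :
    ∃ x y : k, -1 = x ^ 2 - h.radicand hN n * y ^ 2 := by
  have h1 := (h.isSumTwoSq_natCast_aux hτ hN m hm).1 hm4
  have h2 : IsSumTwoSq (2 : k) := ⟨1, 1, by norm_num⟩
  have h3 : IsSumTwoSq (n : k) := by
    rcases hnm with rfl | rfl
    · exact h1
    · push_cast; exact h2.mul h1
  have h4 : IsSumTwoSq (w : k) := by
    obtain ⟨a, b, hab⟩ := hN.v_eq_sq_add_sq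
    exact ⟨a, b, by exact_mod_cast congrArg (Int.cast (R := k)) hab⟩
  have hw0 : (w : k) ≠ 0 := by exact_mod_cast hN.v_pos.ne'
  have h5 : IsSumTwoSq (((h.unit hN : 𝓞 k) : k) * s) := by
    refine (h2.mul h4).of_mul (mul_ne_zero two_ne_zero hw0) ⟨((h.unit hN : 𝓞 k) : k), 1, ?_⟩
    rw [h.coe_unit']
    have h2 : (u : k) ^ 2 + 1 = l * w ^ 2 := by exact_mod_cast hN.eq
    linear_combination (w : k) ^ 2 * h.sq' - h2
  obtain ⟨x, y, hxy⟩ := h3.mul h5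
  rw [← h.coe_radicand] at hxy
  have hy : y ≠ 0 := by
    rintro rfl
    exact h.radicand_not_square hN hn hnl x (by rw [hxy]; ring)
  refine ⟨x / y, 1 / y, ?_⟩
  rw [hxy]
  field_simp
  ring

end SqrtPrime

end

section

variable {k : Type*} [Field k] [NumberField k]

namespace SqrtPrime

variable [Algebra.IsQuadraticExtension ℚ k] {l : ℕ} {s : 𝓞 k} (h : SqrtPrime l s)
  {τ : Gal(k/ℚ)} (hτ : τ ≠ 1) {u w : ℤ} (hN : NegPell l u w)

include hτ in
theorem smul_mem_iff (v : HeightOneSpectrum (𝓞 k)) (x : 𝓞 k) :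
    τ • x ∈ v.asIdeal ↔ x ∈ (conj τ v).asIdeal := by
  rw [← Ideal.smul_mem_pointwise_smul_iff (a := τ) (S := v.asIdeal)]
  have h1 : τ • τ • x = x := RingOfIntegers.ext (gal_involutive hτ (x : k))
  rw [h1]
  rfl

theorem not_dvd_sq_add_one {q : ℕ} (hq : q.Prime) (hq4 : q % 4 = 3) (m : ℤ) : ¬ (q : ℤ) ∣ m ^ 2 + 1 := by
  intro hm
  have := Fact.mk hq
  refine ZMod.mod_four_ne_three_of_sq_eq_neg_one (p := q) (y := (m : ZMod q)) ?_ hq4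
  rw [← ZMod.intCast_zmod_eq_zero_iff_dvd] at hm
  push_cast at hm
  linear_combination hm

include h hτ in
/-- An element of norm `-1` is not a square modulo both primes above `q ≡ 3 (mod 4)`. -/
theorem not_square_of_mul_conj {η A B : 𝓞 k} (hη : η * τ • η = -1) {q : ℕ} (hq : q.Prime) (hq4 : q % 4 = 3)
    {v : HeightOneSpectrum (𝓞 k)} (hv : Above v q) (hA : η - A ^ 2 ∈ v.asIdeal)
    (hB : η - B ^ 2 ∈ (conj τ v).asIdeal) : False := by
  have key : ∀ B : 𝓞 k, η - B ^ 2 ∈ (conj τ v).asIdeal → ∀ m : ℤ, A * τ • B - m ∈ v.asIdeal → False := by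
    intro B hB m hm
    rw [← smul_mem_iff hτ, smul_sub, smul_pow'] at hB
    refine not_dvd_sq_add_one hq hq4 m ((hv _).1 ?_)
    have e : ((m ^ 2 + 1 : ℤ) : 𝓞 k) = -(η - A ^ 2) * τ • η - A ^ 2 * (τ • η - (τ • B) ^ 2)
        - (A * τ • B - m) * (A * τ • B + m) := by
      push_cast
      linear_combination hη
    rw [e]
    exact Ideal.sub_mem _ (Ideal.sub_mem _ (Ideal.mul_mem_right _ _ (Ideal.neg_mem_iff _ |>.2 hA))
      (Ideal.mul_mem_left _ _ hB)) (Ideal.mul_mem_right _ _ hm)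
  by_cases hc : conj τ v = v
  · obtain ⟨a, ha⟩ := mem_range_of_fixed hτ (x := (A : k) * τ A) (by
      rw [map_mul, gal_involutive hτ, mul_comm])
    obtain ⟨m, hm⟩ := RingOfIntegers.exists_int_of_eq_rat (A * τ • A) a ha.symm
    exact key A (by rwa [hc]) m (by rw [hm, sub_self]; exact Ideal.zero_mem _)
  · obtain ⟨m, hm⟩ := exists_int_of_conj_ne hq hv hc (A * τ • B)
    exact key B hB m hm

section

variable {n : ℕ} (hn : n ≠ 0) (hnl : n.Coprime l) (hsq : Squarefree n)

include h hN hn hnl hsq in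
theorem exists_sq_congr_of_eq {p : ℕ} (hp : p.Prime) (hpn : p ∣ n) {v : HeightOneSpectrum (𝓞 k)}
    (hv : Above v p) {η : 𝓞 k} {a b : k} (hab : (η : k) = a ^ 2 - (h.radicand hN n : k) * b ^ 2) :
    ∃ A : 𝓞 k, η - A ^ 2 ∈ v.asIdeal :=
  exists_sq_congr (h.ord_radicand_of_dvd hN hn hnl hsq hp hv hpn) (h.radicand_ne_zero hN hn) hab

include hτ hn hnl hsq in
/-- If a prime `q ≡ 3 (mod 4)` divides `n`, no unit of norm `-1` is a relative norm. -/
theorem ne_sq_sub_radicand_of_mul_conj {q : ℕ} (hq : q.Prime) (hq4 : q % 4 = 3) (hqn : q ∣ n) {η : 𝓞 k}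
    (hη : η * τ • η = -1) (a b : k) : (η : k) ≠ a ^ 2 - (h.radicand hN n : k) * b ^ 2 := by
  intro hab
  obtain ⟨v, hv⟩ := SqrtPrime.exists_above (k := k) hq
  obtain ⟨A, hA⟩ := h.exists_sq_congr_of_eq hN hn hnl hsq hq hqn hv hab
  obtain ⟨B, hB⟩ := h.exists_sq_congr_of_eq hN hn hnl hsq hq hqn (conj_above (τ := τ) hv) hab
  exact h.not_square_of_mul_conj hτ hη hq hq4 hv hA hB

include hτ hn hnl hsq in
/-- If a split prime `q ≡ 3 (mod 4)` divides `n`, then `-1` is not a relative norm. -/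
theorem neg_one_ne_sq_sub_radicand_of_split {q : ℕ} (hq : q.Prime) (hq4 : q % 4 = 3) (hqn : q ∣ n)
    (hql : IsSquare (l : ZMod q)) (a b : k) : -1 ≠ a ^ 2 - (h.radicand hN n : k) * b ^ 2 := by
  intro hab
  have hql' : q ≠ l := by
    rintro rfl
    exact hq.one_lt.ne' (Nat.eq_one_of_dvd_coprimes hnl hqn dvd_rfl)
  obtain ⟨v, hv⟩ := SqrtPrime.exists_above (k := k) hq
  have hm1 : (((-1 : 𝓞 k)) : k) = -1 := by
    change algebraMap (𝓞 k) k (-1) = -1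
    rw [map_neg, map_one]
  obtain ⟨A, hA⟩ := h.exists_sq_congr_of_eq hN hn hnl hsq hq hqn hv (hm1.trans hab)
  obtain ⟨m, hm⟩ := exists_int_of_conj_ne hq hv ((h.conj_ne_iff hτ hq (by rintro rfl; omega) hql' hv).2 hql) A
  refine not_dvd_sq_add_one hq hq4 m ((hv _).1 ?_)
  have e : ((m ^ 2 + 1 : ℤ) : 𝓞 k) = -(-1 - A ^ 2) - (A - m) * (A + m) := by
    push_cast
    ring
  rw [e]
  exact Ideal.sub_mem _ (Ideal.neg_mem_iff _ |>.2 hA) (Ideal.mul_mem_right _ _ hm)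

include hτ hn hnl hsq in
theorem unit_ne_sq_sub_radicand_of_split {p : ℕ} (hp : p.Prime) (hp4 : p % 4 = 1) (hpn : p ∣ n)
    (hpl : IsSquare (l : ZMod p)) (hq : quartSym l p ≠ quartSym p l) (a b : k) :
    ((h.unit hN : 𝓞 k) : k) ≠ a ^ 2 - (h.radicand hN n : k) * b ^ 2 := by
  intro hab
  have hpl' : p ≠ l := by
    rintro rfl
    exact hp.one_lt.ne' (Nat.eq_one_of_dvd_coprimes hnl hpn dvd_rfl)
  obtain ⟨v, hv⟩ := SqrtPrime.exists_above (k := k) hp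
  exact hq ((h.exists_sq_iff hτ hN hp hp4 hpl' hv
    ((h.conj_ne_iff hτ hp (by rintro rfl; omega) hpl' hv).2 hpl)).1
      (h.exists_sq_congr_of_eq hN hn hnl hsq hp hpn hv hab))

end

end SqrtPrime

end

section

variable {k : Type*} [Field k] [NumberField k]

/-- The rational primes other than `l` that ramify in `ℚ(√(n ε √l))`. -/
def ramPrimes (n : ℕ) : Finset ℕ := if n % 4 = 1 then n.primeFactors else insert 2 n.primeFactors

namespace SqrtPrime

variable [Algebra.IsQuadraticExtension ℚ k] {l : ℕ} {s : 𝓞 k} (h : SqrtPrime l s)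
  {τ : Gal(k/ℚ)} (hτ : τ ≠ 1) {u w : ℤ} (hN : NegPell l u w)

section

variable {n : ℕ} (hn : n ≠ 0) (hnl : n.Coprime l) (hsq : Squarefree n)
  {F : Type*} [Field F] [NumberField F] [Algebra k F] [Algebra.IsQuadraticExtension k F]
  {σ : Gal(F/k)} {r : F} (hG : Gen σ r (h.radicand hN n))

include hτ hn hG in
theorem index_squares_units_quadExt : (squares (𝓞 F)ˣ).index = 16 := by
  have hk := h.isTotallyReal
  have : IsTotallyReal F := isTotallyReal_of_conj fun φ x => by
    have hr := hk.isReal (InfinitePlace.mk (φ.comp (algebraMap k F)))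
    rw [InfinitePlace.isReal_mk_iff] at hr
    have hφ : ∀ a : k, φ (algebraMap k F a) = ((hr.embedding a : ℝ) : ℂ) := fun a =>
      (ComplexEmbedding.IsReal.coe_embedding_apply hr a).symm
    have hd : 0 < hr.embedding (h.radicand hN n : k) := by
      rcases lt_or_gt_of_ne ((map_ne_zero hr.embedding).2 h.s_ne_zero) with h1 | h1
      · have := h.conj_radicand_pos hτ hN hn (ψ := hr.embedding.comp (τ : k →+* k)) (by
          change 0 < hr.embedding (τ s)
          rw [h.conj_s hτ, map_neg]
          linarith)
        change 0 < hr.embedding (τ (τ _)) at this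
        rwa [gal_involutive hτ] at this
      · exact h.radicand_pos hN hn h1
    obtain ⟨a, b, rfl⟩ := hG.exists_coords x
    have h2 : φ r ^ 2 = ((hr.embedding (h.radicand hN n : k) : ℝ) : ℂ) := by rw [← map_pow, hG.sq, hφ]
    simp only [map_add, map_mul, hφ, Complex.conj_ofReal, Complex.conj_eq_of_sq_eq hd.le h2]
  rw [Units.index_squares, Units.rank_of_isTotallyReal, NumberField.finrank_quadExt k F]
  norm_num

include h hN hτ hn hG hnl hsq in
theorem ram_eq_two_iff {v : HeightOneSpectrum (𝓞 k)} {p : ℕ} (hp : p.Prime) (hv : Above v p) :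
    ram F v = 2 ↔ p = l ∨ p ∈ ramPrimes n := by
  have hl2 : 2 ≠ l := by have := h.mod; omega
  have hodd : v.ord (h.radicand hN n : k) = 1 → ram F v = 2 := fun ho =>
    ram_of_odd hG.sq v (by rw [ho]; exact odd_one)
  by_cases hpl : p = l
  · subst hpl
    simp only [true_or, iff_true]
    exact hodd (h.ord_radicand_above_l hN hn hnl hv)
  by_cases hpn : p ∣ n
  · have : p ∈ ramPrimes n := by
      unfold ramPrimes
      split_ifs <;> simp [hp, hpn, hn]
    simp only [this, or_true, iff_true]
    exact hodd (h.ord_radicand_of_dvd hN hn hnl hsq hp hv hpn)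
  have hd : h.radicand hN n ∉ v.asIdeal := fun hm => by
    have h1 := (v.mem_iff_ord (K := k) (r := h.radicand hN n) fun h0 => h.radicand_ne_zero hN hn (by rw [h0]; rfl)).1 hm
    rcases h.dvd_of_odd_ord_radicand hN hn hp hv (fun h0 => by
      change 1 ≤ v.ord (h.radicand hN n : k) at h1
      omega) with h2 | h2
    · exact hpl h2
    · exact hpn h2
  by_cases hp2 : p = 2
  · subst hp2
    simp only [hl2, false_or]
    have hD := h.isDegOne_two hτ hv
    have hsub : ∀ v : HeightOneSpectrum (𝓞 k), Above v 2 →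
        (h.radicand hN n : k) - (n : ℤ) ∈ v.ball 2 := fun v hv => by
      simpa using h.radicand_sub_mem hτ hN hv (N := 2) (n := n) (Dvd.intro _ rfl)
    have hInt : ∀ v : HeightOneSpectrum (𝓞 k), Above v 2 → ∀ (j : ℕ) (z : ℤ),
        ((z : k) ∈ v.ball (j : ℤ) ↔ (2 : ℤ) ^ j ∣ z) := fun v hv j z => by
      have := h.isDegOne_two hτ hv
      exact_mod_cast intCast_mem_ball_iff (z := z) this.prime this.above this.ord j
    have e : (1 - h.radicand hN n : k) = ((1 - n : ℤ) : k) - ((h.radicand hN n : k) - (n : ℤ)) := by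
      push_cast
      ring
    by_cases hn4 : n % 4 = 1
    · have : 2 ∉ ramPrimes n := by
        rw [ramPrimes, if_pos hn4]
        simp [hpn]
      simp only [this, iff_false]
      obtain ⟨x, hx⟩ := exists_algebraMap_eq_of_ord_nonneg (R := 𝓞 k) (x := (1 - h.radicand hN n : k) / 4) (by
        intro v'
        by_cases h0 : (1 - h.radicand hN n : k) = 0
        · rw [h0, zero_div, ord_zero]
        rw [ord_div _ h0 (by norm_num), show (4 : k) = (2 : k) ^ 2 by norm_num, ord_pow]
        by_cases h2 : (2 : 𝓞 k) ∈ v'.asIdeal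
        · have hv' := Above.of_two_mem h2
          have h3 : (1 - h.radicand hN n : k) ∈ v'.ball 2 := by
            rw [e]
            refine AddSubgroup.sub_mem _ ?_ (hsub v' hv')
            exact (hInt v' hv' 2 (1 - n)).2 (by norm_num; omega)
          rw [mem_ball' h0] at h3
          have h4 := (h.isDegOne_two hτ hv').ord
          simp only [Nat.cast_ofNat] at h4
          rw [h4]
          omega
        · have h4 := v'.ord_eq_zero_of_notMem (K := k) h2
          rw [map_ofNat] at h4
          rw [h4]
          have := v'.ord_nonneg (K := k) (1 - h.radicand hN n)
          rw [map_sub, map_one] at this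
          change 0 ≤ v'.ord (1 - h.radicand hN n : k) at this
          omega)
      have := hG.ram_eq_one_of_quadratic (v := v) (t := 1) (e := x)
        (fun h1 => v.isPrime.ne_top (Ideal.eq_top_of_isUnit_mem _ h1 isUnit_one)) hd (by
          apply RingOfIntegers.coe_injective
          rw [map_mul, map_mul, map_pow, map_one, map_ofNat, hx, map_sub, map_one]
          change 1 ^ 2 * (1 - (h.radicand hN n : k)) = _
          ring)
      omega
    · have h2 : 2 ∈ ramPrimes n := by
        rw [ramPrimes, if_neg hn4]
        exact Finset.mem_insert_self _ _
      simp only [h2, iff_true]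
      refine hG.ram_eq_two_of (by simpa using hv.self_mem) (ord_eq_of_ball ?_ fun hm => ?_)
      · rw [e]
        refine AddSubgroup.sub_mem _ ?_ (ball_mono (by norm_num) (hsub v hv))
        exact (hInt v hv 1 (1 - n)).2 (by norm_num; omega)
      · have h3 := AddSubgroup.add_mem _ hm (hsub v hv)
        rw [e, sub_add_cancel] at h3
        have := (hInt v hv 2 (1 - n)).1 h3
        norm_num at this
        omega
  · have h1 := hG.ram_eq_one_of_odd hd (hv.two_notMem hp2)
    have h2 : p ∉ ramPrimes n := by
      unfold ramPrimes
      split_ifs <;> simp [hp, hpn, hn, hp2]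
    simp [h1, h2, hpl]

end

end SqrtPrime

end

section

variable {k : Type*} [Field k] [NumberField k]

open Classical in
/-- The number of primes of `ℚ(√l)` above a rational prime `p ≠ l`. -/
noncomputable def splitCount (l p : ℕ) : ℕ := if IsSquare (l : ZMod p) then 2 else 1

theorem prime_of_mem_ramPrimes {n p : ℕ} (hp : p ∈ ramPrimes n) : p.Prime := by
  unfold ramPrimes at hp
  split_ifs at hp
  · exact Nat.prime_of_mem_primeFactors hp
  · rcases Finset.mem_insert.1 hp with rfl | hp
    · exact Nat.prime_two
    · exact Nat.prime_of_mem_primeFactors hp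

namespace SqrtPrime

variable [Algebra.IsQuadraticExtension ℚ k] {l : ℕ} {s : 𝓞 k} (h : SqrtPrime l s)
  {τ : Gal(k/ℚ)} (hτ : τ ≠ 1) {u w : ℤ} (hN : NegPell l u w)

include h hτ in
theorem exists_finset_above {p : ℕ} (hp : p.Prime) (hpl : p ≠ l) :
    ∃ S : Finset (HeightOneSpectrum (𝓞 k)), (∀ v, v ∈ S ↔ Above v p) ∧ S.card = splitCount l p := by
  classical
  obtain ⟨v, hv⟩ := SqrtPrime.exists_above (k := k) hp
  refine ⟨{v, conj τ v}, fun v' => ?_, ?_⟩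
  · rw [Finset.mem_insert, Finset.mem_singleton]
    refine ⟨?_, SqrtPrime.eq_or_eq_conj hτ hp hv⟩
    rintro (rfl | rfl)
    · exact hv
    · exact conj_above hv
  · have key : conj τ v ≠ v ↔ IsSquare (l : ZMod p) := by
      by_cases hp2 : p = 2
      · subst hp2
        refine ⟨fun _ => ?_, fun _ => h.conj_ne_of_two hτ hv⟩
        have : ∀ x : ZMod 2, IsSquare x := by decide
        exact this _
      · exact h.conj_ne_iff hτ hp hp2 hpl hv
    unfold splitCount
    split_ifs with hs
    · exact Finset.card_pair (key.2 hs).symm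
    · have : conj τ v = v := by
        by_contra hc
        exact hs (key.1 hc)
      rw [this, Finset.pair_eq_singleton, Finset.card_singleton]

section

variable {n : ℕ} (hn : n ≠ 0) (hnl : n.Coprime l) (hsq : Squarefree n)
  {F : Type*} [Field F] [NumberField F] [Algebra k F] [Algebra.IsQuadraticExtension k F]
  {σ : Gal(F/k)} {r : F} (hG : Gen σ r (h.radicand hN n))

include h hn hnl in
theorem ne_of_mem_ramPrimes {p : ℕ} (hp : p ∈ ramPrimes n) : p ≠ l := by
  rintro rfl
  unfold ramPrimes at hp
  have h2 := h.mod
  have h1 : p ∉ n.primeFactors := fun h1 =>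
    h.prime.one_lt.ne' (Nat.eq_one_of_dvd_coprimes hnl (Nat.dvd_of_mem_primeFactors h1) dvd_rfl)
  split_ifs at hp
  · exact h1 hp
  · rcases Finset.mem_insert.1 hp with rfl | hp
    · omega
    · exact h1 hp

include h hN hτ hn hG hnl hsq in
/-- The ambiguous class number formula for `ℚ(√(n ε √l))`. -/
theorem card_twoTorsion_quadExt :
    8 * Nat.card {x : ClassGroup (𝓞 F) // x ^ 2 = 1} =
      2 ^ (1 + ∑ p ∈ ramPrimes n, splitCount l p) * (squares (𝓞 k)ˣ).relIndex (normUnits k F) := by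
  classical
  have hS : ∀ p : ℕ, ∃ S : Finset (HeightOneSpectrum (𝓞 k)), p ∈ ramPrimes n →
      (∀ v, v ∈ S ↔ Above v p) ∧ S.card = splitCount l p := fun p => by
    by_cases hp : p ∈ ramPrimes n
    · obtain ⟨S, hS⟩ := h.exists_finset_above hτ (prime_of_mem_ramPrimes hp) (h.ne_of_mem_ramPrimes hn hnl hp)
      exact ⟨S, fun _ => hS⟩
    · exact ⟨∅, fun h => (hp h).elim⟩
  choose S hS using hS
  obtain ⟨v₀, hv₀⟩ := SqrtPrime.exists_above (k := k) h.prime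
  have hmem : ∀ v, v ∈ (ramPrimes n).biUnion S ↔ ∃ p ∈ ramPrimes n, Above v p := fun v => by
    rw [Finset.mem_biUnion]
    exact exists_congr fun p => and_congr_right fun hp => (hS p hp).1 v
  have hv₀S : v₀ ∉ (ramPrimes n).biUnion S := fun hm => by
    obtain ⟨p, hp, hv⟩ := (hmem v₀).1 hm
    exact h.ne_of_mem_ramPrimes hn hnl hp (hv.unique hv₀)
  have hA := card_twoTorsion_mul hG.ne_one (h.odd_classNumber hN) (insert v₀ ((ramPrimes n).biUnion S)) (fun v => by
    obtain ⟨p, hp, hv⟩ := Above.exists_of_prime v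
    rw [h.ram_eq_two_iff hτ hN hn hnl hsq hG hp hv, Finset.mem_insert, hmem]
    refine or_congr ⟨?_, ?_⟩ ⟨?_, fun hp => ⟨p, hp, hv⟩⟩
    · rintro rfl
      exact hv.unique hv₀
    · rintro rfl
      exact h.eq_of_above_l hv₀ hv
    · rintro ⟨q, hq, hqv⟩
      rwa [hv.unique hqv])
  rw [Finset.card_insert_of_notMem hv₀S, Finset.card_biUnion (fun p hp q hq hpq => by
      refine Finset.disjoint_left.2 fun v hv hv' => hpq ?_
      exact (((hS p hp).1 v).1 hv).unique (((hS q hq).1 v).1 hv')),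
    Finset.sum_congr rfl (fun p hp => (hS p hp).2), h.index_squares_units_quadExt hτ hN hn hG,
    h.index_squares_units, add_comm _ 1, mul_assoc 4] at hA
  linarith

end

end SqrtPrime

end

section

variable {k : Type*} [Field k] [NumberField k]

namespace SqrtPrime

variable [Algebra.IsQuadraticExtension ℚ k] {l : ℕ} {s : 𝓞 k} (h : SqrtPrime l s)
  {τ : Gal(k/ℚ)} (hτ : τ ≠ 1) {u w : ℤ} (hN : NegPell l u w)
  {n m : ℕ} (hn : n ≠ 0) (hnl : n.Coprime l) (hsq : Squarefree n) (hnm : n = m ∨ n = 2 * m)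
  {F : Type*} [Field F] [NumberField F] [Algebra k F] [Algebra.IsQuadraticExtension k F]
  {σ : Gal(F/k)} {r : F} (hG : Gen σ r (h.radicand hN n))

omit [Algebra.IsQuadraticExtension ℚ k] in
theorem coe_neg_one_unit : (((-1 : (𝓞 k)ˣ) : 𝓞 k) : k) = -1 := by
  change algebraMap (𝓞 k) k ((-1 : (𝓞 k)ˣ) : 𝓞 k) = -1
  rw [Units.val_neg, Units.val_one, map_neg, map_one]

include h hτ in
theorem unit_mul_smul_conj : (h.unit hN : 𝓞 k) * τ • (h.unit hN : 𝓞 k) = -1 := by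
  refine RingOfIntegers.ext ((h.unit_mul_conj hτ hN).trans ?_)
  rw [← coe_neg_one_unit, Units.val_neg, Units.val_one]

include hτ hN hn hnl hsq hG in
theorem unit_notMem_normUnits {q : ℕ} (hq : q.Prime) (hq4 : q % 4 = 3) (hqn : q ∣ n) :
    h.unit hN ∉ normUnits k F ∧ -1 * h.unit hN ∉ normUnits k F := by
  have h1 := h.unit_mul_smul_conj hτ hN
  rw [hG.mem_normUnits_iff, hG.mem_normUnits_iff]
  refine ⟨?_, ?_⟩
  · rintro ⟨a, b, hab⟩
    exact h.ne_sq_sub_radicand_of_mul_conj hτ hN hn hnl hsq hq hq4 hqn h1 a b hab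
  · rintro ⟨a, b, hab⟩
    refine h.ne_sq_sub_radicand_of_mul_conj hτ hN hn hnl hsq hq hq4 hqn ?_ a b hab
    rw [Units.val_mul, Units.val_neg, Units.val_one, neg_one_mul, smul_neg, neg_mul_neg, h1]

include hG in
theorem neg_one_mem_normUnits_iff : (-1 : (𝓞 k)ˣ) ∈ normUnits k F ↔
    ∃ a b : k, -1 = a ^ 2 - (h.radicand hN n : k) * b ^ 2 := by
  rw [hG.mem_normUnits_iff, coe_neg_one_unit]

include h hN hτ hn hG hnl hsq in
theorem relIndex_eq_one (hq : ∃ q : ℕ, q.Prime ∧ q % 4 = 3 ∧ q ∣ n)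
    (hq' : n % 4 = 3 ∨ n % 8 = 6 ∨ ∃ q : ℕ, q.Prime ∧ q % 4 = 3 ∧ q ∣ n ∧ IsSquare (l : ZMod q)) :
    (squares (𝓞 k)ˣ).relIndex (normUnits k F) = 1 := by
  obtain ⟨q, hq, hq4, hqn⟩ := hq
  obtain ⟨h1, h2⟩ := h.unit_notMem_normUnits hτ hN hn hnl hsq hG hq hq4 hqn
  refine Subgroup.relIndex_eq_one_of h.index_squares_units h.neg_one_not_square (h.unit_not_square hN)
    (h.neg_unit_not_square hN) ⟨1, by simp⟩ (squares_le_normUnits k F) ?_ h1 h2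
  rw [h.neg_one_mem_normUnits_iff hN hG]
  rintro ⟨a, b, hab⟩
  rcases hq' with hq' | hq' | ⟨q, hq, hq4, hqn, hql⟩
  · exact h.neg_one_ne_sq_sub_radicand_of_mod hτ hN (Or.inl hq') a b hab
  · exact h.neg_one_ne_sq_sub_radicand_of_mod hτ hN (Or.inr hq') a b hab
  · exact h.neg_one_ne_sq_sub_radicand_of_split hτ hN hn hnl hsq hq hq4 hqn hql a b hab

include h hN hτ hn hG hnl hsq hnm in
theorem relIndex_eq_two_of_inert (hm4 : m % 4 = 1)
    (hm : ∀ p : ℕ, p.Prime → p ∣ m → p % 4 = 1 ∨ p % 4 = 3 ∧ ¬ IsSquare (l : ZMod p))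
    (hq : ∃ q : ℕ, q.Prime ∧ q % 4 = 3 ∧ q ∣ n) :
    (squares (𝓞 k)ˣ).relIndex (normUnits k F) = 2 := by
  obtain ⟨q, hq, hq4, hqn⟩ := hq
  exact Subgroup.relIndex_eq_two_of h.index_squares_units (squares_le_normUnits k F)
    ((h.neg_one_mem_normUnits_iff hN hG).2 (h.exists_neg_one_eq_sq_sub_radicand hτ hN hn hnl hnm hm4 hm))
    h.neg_one_not_square (h.unit_notMem_normUnits hτ hN hn hnl hsq hG hq hq4 hqn).1

include h hN hτ hn hG hnl hsq hnm in
open Classical in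
theorem relIndex_of_mod (hm4 : m % 4 = 1) (hm : ∀ p : ℕ, p.Prime → p ∣ m → p % 4 = 1) :
    (squares (𝓞 k)ˣ).relIndex (normUnits k F) =
      if (∀ p : ℕ, p.Prime → p ∣ m → IsSquare (l : ZMod p) → quartSym l p = quartSym p l) ∧
        (2 ∣ n → quartSym l 2 = (-1) ^ ((l - 1) / 8)) then 4 else 2 := by
  have hN1 := (h.neg_one_mem_normUnits_iff hN hG).2
    (h.exists_neg_one_eq_sq_sub_radicand hτ hN hn hnl hnm hm4 (fun p hp hpm => Or.inl (hm p hp hpm)))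
  have hmn : ∀ p, p ∣ m → p ∣ n := fun p hp => by
    rcases hnm with rfl | rfl
    · exact hp
    · exact hp.mul_left 2
  have hnm' : ∀ p : ℕ, p.Prime → p ∣ n → p ≠ 2 → p ∣ m := fun p hp hpn hp2 => by
    rcases hnm with rfl | rfl
    · exact hpn
    · exact (hp.dvd_mul.1 hpn).resolve_left fun hd => hp2 ((Nat.prime_dvd_prime_iff_eq hp Nat.prime_two).1 hd)
  split_ifs with hc
  · refine Subgroup.relIndex_eq_four h.index_squares_units (squares_le_normUnits k F) h.neg_one_not_square
      (h.unit_not_square hN) (h.neg_unit_not_square hN) ⟨1, by simp⟩ hN1 (hG.mem_normUnits_iff.2 ?_)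
    exact h.exists_unit_eq_sq_sub_radicand hτ hN hn hnl (fun p hp hpn hp2 => hm p hp (hnm' p hp hpn hp2))
      (fun p hp hpn hp2 => hc.1 p hp (hnm' p hp hpn hp2)) hc.2
  · refine Subgroup.relIndex_eq_two_of h.index_squares_units (squares_le_normUnits k F) hN1
      h.neg_one_not_square (y := h.unit hN) ?_
    rw [hG.mem_normUnits_iff]
    rintro ⟨a, b, hab⟩
    refine hc ⟨fun p hp hpm hpl => ?_, fun h2 => ?_⟩ <;> by_contra hq
    · exact h.unit_ne_sq_sub_radicand_of_split hτ hN hn hnl hsq hp (hm p hp hpm) (hmn p hpm) hpl hq a b hab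
    · exact h.unit_ne_sq_sub_radicand_of_mod hτ hN (by omega) hq a b hab

end SqrtPrime

end

end

section

open IsDedekindDomain nonZeroDivisors NumberField Pointwise
open HeightOneSpectrum (squares evenUnits mem_squares_units ord_mul ord_pow)
set_option linter.unusedSectionVars false
open QuadExt

section

variable {l : ℕ}

theorem splitCount_of_isSquare {p : ℕ} (h : IsSquare (l : ZMod p)) : splitCount l p = 2 := if_pos h

theorem splitCount_of_not_isSquare {p : ℕ} (h : ¬ IsSquare (l : ZMod p)) : splitCount l p = 1 := if_neg h

theorem splitCount_cases (p : ℕ) :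
    IsSquare (l : ZMod p) ∧ splitCount l p = 2 ∨ ¬ IsSquare (l : ZMod p) ∧ splitCount l p = 1 := by
  by_cases h : IsSquare (l : ZMod p)
  · exact Or.inl ⟨h, splitCount_of_isSquare h⟩
  · exact Or.inr ⟨h, splitCount_of_not_isSquare h⟩

theorem splitCount_pos (p : ℕ) : 1 ≤ splitCount l p := by
  rcases splitCount_cases (l := l) p with h | h <;> omega

theorem splitCount_two : splitCount l 2 = 2 := by
  have : ∀ x : ZMod 2, IsSquare x := by decide
  exact splitCount_of_isSquare (this _)

theorem sum_splitCount_ramPrimes {n m : ℕ} (hm : m % 2 = 1) (hnm : n = m ∨ n = 2 * m) :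
    ∑ p ∈ ramPrimes n, splitCount l p =
      (∑ p ∈ m.primeFactors, splitCount l p) + if n % 4 = 1 then 0 else 2 := by
  have h2 : 2 ∉ m.primeFactors := fun h => by
    have := Nat.dvd_of_mem_primeFactors h
    omega
  unfold ramPrimes
  rcases hnm with rfl | rfl
  · split_ifs
    · rfl
    · rw [Finset.sum_insert h2, splitCount_two, add_comm]
  · rw [if_neg (by omega), if_neg (by omega), Nat.primeFactors_mul (by norm_num) (by omega),
      Nat.prime_two.primeFactors, Finset.singleton_union, Finset.insert_idem,
      Finset.sum_insert h2, splitCount_two, add_comm]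

theorem sum_splitCount_prime {p : ℕ} (hp : p.Prime) :
    ∑ p ∈ p.primeFactors, splitCount l p = splitCount l p := by
  rw [hp.primeFactors, Finset.sum_singleton]

theorem sum_splitCount_mul {a b : ℕ} (hab : a.Coprime b) :
    ∑ p ∈ (a * b).primeFactors, splitCount l p =
      (∑ p ∈ a.primeFactors, splitCount l p) + ∑ p ∈ b.primeFactors, splitCount l p := by
  rw [hab.primeFactors_mul, Finset.sum_union hab.disjoint_primeFactors]

/-- Factorizations of squarefree numbers with few primes of `ℚ(√l)` above them. -/
theorem exists_factorization {m : ℕ} (hm : Squarefree m)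
    (hw : ∑ p ∈ m.primeFactors, splitCount l p ≤ 4) :
    (m = 1 ∧ ∑ p ∈ m.primeFactors, splitCount l p = 0) ∨
    (∃ p, p.Prime ∧ m = p ∧ ∑ p ∈ m.primeFactors, splitCount l p = splitCount l p) ∨
    (∃ p q, p.Prime ∧ q.Prime ∧ p ≠ q ∧ m = p * q ∧
      ∑ p ∈ m.primeFactors, splitCount l p = splitCount l p + splitCount l q) ∨
    (∃ p q r, p.Prime ∧ q.Prime ∧ r.Prime ∧ p ≠ q ∧ p ≠ r ∧ q ≠ r ∧ m = p * (q * r) ∧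
      ∑ p ∈ m.primeFactors, splitCount l p = splitCount l p + (splitCount l q + splitCount l r)) ∨
    (∑ p ∈ m.primeFactors, splitCount l p = 4 ∧ ∀ p, p.Prime → p ∣ m → ¬ IsSquare (l : ZMod p)) := by
  have hcard : m.primeFactors.card ≤ ∑ p ∈ m.primeFactors, splitCount l p := by
    simpa using Finset.card_nsmul_le_sum m.primeFactors (splitCount l) 1 fun p _ => splitCount_pos p
  have hprod := Nat.prod_primeFactors_of_squarefree hm
  have hprime : ∀ p ∈ m.primeFactors, p.Prime := fun p hp => Nat.prime_of_mem_primeFactors hp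
  obtain h | h | h | h | h : m.primeFactors.card = 0 ∨ m.primeFactors.card = 1 ∨ m.primeFactors.card = 2 ∨
    m.primeFactors.card = 3 ∨ m.primeFactors.card = 4 := by omega
  · rw [Finset.card_eq_zero] at h
    rw [h] at hprod ⊢
    exact Or.inl ⟨by simpa using hprod.symm, by simp⟩
  · obtain ⟨p, hp⟩ := Finset.card_eq_one.1 h
    rw [hp] at hprod hprime ⊢
    exact Or.inr (Or.inl ⟨p, hprime p (by simp), by simpa using hprod.symm, by simp⟩)
  · obtain ⟨p, q, hpq, hp⟩ := Finset.card_eq_two.1 h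
    rw [hp] at hprod hprime ⊢
    rw [Finset.prod_pair hpq] at hprod
    exact Or.inr (Or.inr (Or.inl ⟨p, q, hprime p (by simp), hprime q (by simp), hpq, hprod.symm,
      Finset.sum_pair hpq⟩))
  · obtain ⟨p, q, r, hpq, hpr, hqr, hp⟩ := Finset.card_eq_three.1 h
    rw [hp] at hprod hprime ⊢
    rw [Finset.prod_insert (by simp [hpq, hpr]), Finset.prod_pair hqr] at hprod
    refine Or.inr (Or.inr (Or.inr (Or.inl ⟨p, q, r, hprime p (by simp), hprime q (by simp),
      hprime r (by simp), hpq, hpr, hqr, hprod.symm, ?_⟩)))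
    rw [Finset.sum_insert (by simp [hpq, hpr]), Finset.sum_pair hqr]
  · have h4 : ∑ p ∈ m.primeFactors, splitCount l p = 4 := by omega
    refine Or.inr (Or.inr (Or.inr (Or.inr ⟨h4, fun p hp hpm hs => ?_⟩)))
    have hmem : p ∈ m.primeFactors := Nat.mem_primeFactors.2 ⟨hp, hpm, hm.ne_zero⟩
    have h1 := (Finset.sum_eq_sum_iff_of_le (s := m.primeFactors) (f := fun _ => 1) (g := splitCount l)
      (fun p _ => splitCount_pos p)).1 (by simp [h, h4]) p hmem
    rw [splitCount_of_isSquare hs] at h1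
    omega

end

/-- The ambiguous class number formula for `ℚ(√(n ε √l))`, together with the values of the norm index. -/
structure RankData (l n c ρ : ℕ) : Prop where
  formula : 8 * c = 2 ^ (1 + ∑ p ∈ ramPrimes n, splitCount l p) * ρ
  eq_one : (∃ q : ℕ, q.Prime ∧ q % 4 = 3 ∧ q ∣ n) →
    (n % 4 = 3 ∨ n % 8 = 6 ∨ ∃ q : ℕ, q.Prime ∧ q % 4 = 3 ∧ q ∣ n ∧ IsSquare (l : ZMod q)) → ρ = 1
  eq_two : ∀ m : ℕ, (n = m ∨ n = 2 * m) → m % 4 = 1 →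
    (∀ p : ℕ, p.Prime → p ∣ m → p % 4 = 1 ∨ p % 4 = 3 ∧ ¬ IsSquare (l : ZMod p)) →
    (∃ q : ℕ, q.Prime ∧ q % 4 = 3 ∧ q ∣ n) → ρ = 2
  eq_four : ∀ m : ℕ, (n = m ∨ n = 2 * m) → m % 4 = 1 → (∀ p : ℕ, p.Prime → p ∣ m → p % 4 = 1) →
    (∀ p : ℕ, p.Prime → p ∣ m → IsSquare (l : ZMod p) → quartSym l p = quartSym p l) →
    (2 ∣ n → quartSym l 2 = (-1) ^ ((l - 1) / 8)) → ρ = 4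
  eq_two' : ∀ m : ℕ, (n = m ∨ n = 2 * m) → m % 4 = 1 → (∀ p : ℕ, p.Prime → p ∣ m → p % 4 = 1) →
    ¬ ((∀ p : ℕ, p.Prime → p ∣ m → IsSquare (l : ZMod p) → quartSym l p = quartSym p l) ∧
      (2 ∣ n → quartSym l 2 = (-1) ^ ((l - 1) / 8))) → ρ = 2

namespace RankData

variable {l n c ρ : ℕ} (h : RankData l n c ρ)
include h

theorem eq_four_iff : c = 4 ↔ 2 ^ (∑ p ∈ ramPrimes n, splitCount l p) * ρ = 16 := by
  have := h.formula
  rw [add_comm, pow_succ] at this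
  constructor
  · rintro rfl
    linarith
  · intro h1
    linarith

theorem eq_four_iff_of_one (hρ : ρ = 1) : c = 4 ↔ ∑ p ∈ ramPrimes n, splitCount l p = 4 := by
  rw [h.eq_four_iff, hρ, mul_one]
  exact ⟨fun h => Nat.pow_right_injective le_rfl (h.trans (by norm_num : 16 = 2 ^ 4)), fun h => by rw [h]; norm_num⟩

theorem eq_four_iff_of_two (hρ : ρ = 2) : c = 4 ↔ ∑ p ∈ ramPrimes n, splitCount l p = 3 := by
  rw [h.eq_four_iff, hρ]
  exact ⟨fun h => Nat.pow_right_injective le_rfl (show 2 ^ _ = 2 ^ _ by omega), fun h => by rw [h]; norm_num⟩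

theorem eq_four_iff_of_four (hρ : ρ = 4) : c = 4 ↔ ∑ p ∈ ramPrimes n, splitCount l p = 2 := by
  rw [h.eq_four_iff, hρ]
  exact ⟨fun h => Nat.pow_right_injective le_rfl (show 2 ^ _ = 2 ^ _ by omega), fun h => by rw [h]; norm_num⟩

end RankData

/-- The list of radicands in the classification, in terms of quadratic residues. -/
def Listed (l n : ℕ) : Prop :=
  (∃ p₁ p₂ : ℕ, p₁.Prime ∧ p₂.Prime ∧ p₁ % 4 = 1 ∧ p₂ % 4 = 1 ∧ p₁ ≠ p₂ ∧ n = p₁ * p₂ ∧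
    (¬ IsSquare (l : ZMod p₁) ∧ ¬ IsSquare (l : ZMod p₂) ∨
      ¬ IsSquare (l : ZMod p₁) ∧ IsSquare (l : ZMod p₂) ∧ quartSym l p₂ ≠ quartSym p₂ l)) ∨
  (∃ p : ℕ, p.Prime ∧ p % 4 = 1 ∧ n = p ∧ IsSquare (l : ZMod p) ∧ quartSym l p = quartSym p l) ∨
  (∃ p : ℕ, p.Prime ∧ p % 4 = 1 ∧ n = 2 * p ∧ ¬ IsSquare (l : ZMod p) ∧
    quartSym l 2 ≠ (-1 : ℤ) ^ ((l - 1) / 8)) ∨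
  (n = 2 ∧ quartSym l 2 = (-1 : ℤ) ^ ((l - 1) / 8)) ∨
  (∃ δ q : ℕ, (δ = 1 ∨ δ = 2) ∧ q.Prime ∧ q % 4 = 3 ∧ n = δ * q ∧ IsSquare (l : ZMod q)) ∨
  (∃ q₁ q₂ : ℕ, q₁.Prime ∧ q₂.Prime ∧ q₁ % 4 = 3 ∧ q₂ % 4 = 3 ∧ q₁ ≠ q₂ ∧ n = q₁ * q₂ ∧
    IsSquare (l : ZMod q₁) ∧ IsSquare (l : ZMod q₂)) ∨
  (∃ δ p q : ℕ, (δ = 1 ∨ δ = 2) ∧ p.Prime ∧ p % 4 = 1 ∧ q.Prime ∧ q % 4 = 3 ∧ n = δ * (p * q) ∧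
    ¬ IsSquare (l : ZMod p) ∧ ¬ IsSquare (l : ZMod q)) ∨
  (∃ p q₁ q₂ : ℕ, p.Prime ∧ p % 4 = 1 ∧ q₁.Prime ∧ q₂.Prime ∧ q₁ % 4 = 3 ∧ q₂ % 4 = 3 ∧
    q₁ ≠ q₂ ∧ n = p * (q₁ * q₂) ∧ ¬ IsSquare (l : ZMod p) ∧
    (¬ IsSquare (l : ZMod q₁) ∨ ¬ IsSquare (l : ZMod q₂)))

theorem eq_or_eq_of_dvd_mul {p a b : ℕ} (hp : p.Prime) (ha : a.Prime) (hb : b.Prime) (h : p ∣ a * b) :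
    p = a ∨ p = b := by
  rcases (hp.dvd_mul).1 h with h | h
  · exact Or.inl ((Nat.prime_dvd_prime_iff_eq hp ha).1 h)
  · exact Or.inr ((Nat.prime_dvd_prime_iff_eq hp hb).1 h)

theorem eq_or_eq_or_eq_of_dvd_mul {p a b c : ℕ} (hp : p.Prime) (ha : a.Prime) (hb : b.Prime) (hc : c.Prime)
    (h : p ∣ a * (b * c)) : p = a ∨ p = b ∨ p = c := by
  rcases (hp.dvd_mul).1 h with h | h
  · exact Or.inl ((Nat.prime_dvd_prime_iff_eq hp ha).1 h)
  · exact Or.inr (eq_or_eq_of_dvd_mul hp hb hc h)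

theorem mul_mod_four {a b : ℕ} (ha : a % 4 = 1 ∨ a % 4 = 3) (hb : b % 4 = 1 ∨ b % 4 = 3) :
    a * b % 4 = 1 ∧ a % 4 = b % 4 ∨ a * b % 4 = 3 ∧ a % 4 ≠ b % 4 := by
  rcases ha with ha | ha <;> rcases hb with hb | hb <;> simp [Nat.mul_mod, ha, hb]

namespace RankData

variable {l n c ρ : ℕ} (h : RankData l n c ρ)
include h

theorem eq_four_of_listed (hL : Listed l n) : c = 4 := by
  rcases hL with ⟨p₁, p₂, h₁, h₂, h₁4, h₂4, hne, rfl, hs⟩ | ⟨p, hp, hp4, rfl, hs, hq⟩ |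
    ⟨p, hp, hp4, rfl, hs, hq⟩ | ⟨rfl, hq⟩ | ⟨δ, q, hδ, hq, hq4, rfl, hs⟩ |
    ⟨q₁, q₂, h₁, h₂, h₁4, h₂4, hne, rfl, hs₁, hs₂⟩ | ⟨δ, p, q, hδ, hp, hp4, hq, hq4, rfl, hs₁, hs₂⟩ |
    ⟨p, q₁, q₂, hp, hp4, h₁, h₂, h₁4, h₂4, hne, rfl, hs, hs'⟩
  · have hm := mul_mod_four (Or.inl h₁4) (Or.inl h₂4)
    have h4 : p₁ * p₂ % 4 = 1 := by omega
    have hall : ∀ p : ℕ, p.Prime → p ∣ p₁ * p₂ → p % 4 = 1 := fun p hp hd => by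
      rcases eq_or_eq_of_dvd_mul hp h₁ h₂ hd with rfl | rfl <;> assumption
    have hW := sum_splitCount_ramPrimes (l := l) (n := p₁ * p₂) (m := p₁ * p₂) (by omega) (Or.inl rfl)
    rw [if_pos h4, sum_splitCount_mul ((Nat.coprime_primes h₁ h₂).2 hne), sum_splitCount_prime h₁,
      sum_splitCount_prime h₂] at hW
    rcases hs with ⟨hs₁, hs₂⟩ | ⟨hs₁, hs₂, hq⟩
    · rw [splitCount_of_not_isSquare hs₁, splitCount_of_not_isSquare hs₂] at hW
      refine (h.eq_four_iff_of_four (h.eq_four _ (Or.inl rfl) h4 hall (fun p hp hd hs => ?_) fun h2 => by omega)).2 hW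
      rcases eq_or_eq_of_dvd_mul hp h₁ h₂ hd with rfl | rfl <;> contradiction
    · rw [splitCount_of_not_isSquare hs₁, splitCount_of_isSquare hs₂] at hW
      exact (h.eq_four_iff_of_two (h.eq_two' _ (Or.inl rfl) h4 hall fun hc =>
        hq (hc.1 p₂ h₂ (dvd_mul_left _ _) hs₂))).2 hW
  · have hW := sum_splitCount_ramPrimes (l := l) (n := n) (m := n) (by omega) (Or.inl rfl)
    rw [if_pos hp4, sum_splitCount_prime hp, splitCount_of_isSquare hs] at hW
    refine (h.eq_four_iff_of_four (h.eq_four _ (Or.inl rfl) hp4 ?_ ?_ fun h2 => by omega)).2 hW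
    · intro p' hp' hd
      rwa [(Nat.prime_dvd_prime_iff_eq hp' hp).1 hd]
    · intro p' hp' hd _
      rwa [(Nat.prime_dvd_prime_iff_eq hp' hp).1 hd]
  · have hW := sum_splitCount_ramPrimes (l := l) (n := 2 * p) (m := p) (by omega) (Or.inr rfl)
    rw [if_neg (by omega), sum_splitCount_prime hp, splitCount_of_not_isSquare hs] at hW
    refine (h.eq_four_iff_of_two (h.eq_two' p (Or.inr rfl) hp4 ?_ fun hc => hq (hc.2 (dvd_mul_right _ _)))).2 hW
    intro p' hp' hd
    rwa [(Nat.prime_dvd_prime_iff_eq hp' hp).1 hd]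
  · have hW := sum_splitCount_ramPrimes (l := l) (n := 2) (m := 1) (by norm_num) (Or.inr rfl)
    rw [if_neg (by norm_num), Nat.primeFactors_one, Finset.sum_empty] at hW
    refine (h.eq_four_iff_of_four (h.eq_four 1 (Or.inr rfl) rfl ?_ ?_ fun _ => hq)).2 hW
    · intro p hp hd
      exact (hp.one_lt.ne' (Nat.dvd_one.1 hd)).elim
    · intro p hp hd
      exact (hp.one_lt.ne' (Nat.dvd_one.1 hd)).elim
  · have hW := sum_splitCount_ramPrimes (l := l) (n := δ * q) (m := q) (by omega) (by rcases hδ with rfl | rfl <;> simp)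
    rw [if_neg (by rcases hδ with rfl | rfl <;> omega), sum_splitCount_prime hq, splitCount_of_isSquare hs] at hW
    exact (h.eq_four_iff_of_one (h.eq_one ⟨q, hq, hq4, dvd_mul_left _ _⟩
      (Or.inr (Or.inr ⟨q, hq, hq4, dvd_mul_left _ _, hs⟩)))).2 hW
  · have hm := mul_mod_four (Or.inr h₁4) (Or.inr h₂4)
    have hW := sum_splitCount_ramPrimes (l := l) (n := q₁ * q₂) (m := q₁ * q₂) (by omega) (Or.inl rfl)
    rw [if_pos (by omega), sum_splitCount_mul ((Nat.coprime_primes h₁ h₂).2 hne), sum_splitCount_prime h₁,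
      sum_splitCount_prime h₂, splitCount_of_isSquare hs₁, splitCount_of_isSquare hs₂] at hW
    exact (h.eq_four_iff_of_one (h.eq_one ⟨q₁, h₁, h₁4, dvd_mul_right _ _⟩
      (Or.inr (Or.inr ⟨q₁, h₁, h₁4, dvd_mul_right _ _, hs₁⟩)))).2 hW
  · have hm := mul_mod_four (Or.inl hp4) (Or.inr hq4)
    have hW := sum_splitCount_ramPrimes (l := l) (n := δ * (p * q)) (m := p * q) (by omega)
      (by rcases hδ with rfl | rfl <;> simp)
    rw [if_neg (by rcases hδ with rfl | rfl <;> omega), sum_splitCount_mul ((Nat.coprime_primes hp hq).2 (by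
      rintro rfl; omega)), sum_splitCount_prime hp, sum_splitCount_prime hq, splitCount_of_not_isSquare hs₁,
      splitCount_of_not_isSquare hs₂] at hW
    exact (h.eq_four_iff_of_one (h.eq_one ⟨q, hq, hq4, ((dvd_mul_left _ _).mul_left _)⟩
      (by rcases hδ with rfl | rfl <;> omega))).2 hW
  · have hm := mul_mod_four (Or.inr h₁4) (Or.inr h₂4)
    have hm' := mul_mod_four (a := p) (b := q₁ * q₂) (Or.inl hp4) (by omega)
    have h4 : p * (q₁ * q₂) % 4 = 1 := by omega
    have hW := sum_splitCount_ramPrimes (l := l) (n := p * (q₁ * q₂)) (m := p * (q₁ * q₂)) (by omega) (Or.inl rfl)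
    rw [if_pos h4, sum_splitCount_mul (Nat.Coprime.mul_right
      ((Nat.coprime_primes hp h₁).2 (by rintro rfl; omega)) ((Nat.coprime_primes hp h₂).2 (by rintro rfl; omega))),
      sum_splitCount_mul ((Nat.coprime_primes h₁ h₂).2 hne), sum_splitCount_prime hp, sum_splitCount_prime h₁,
      sum_splitCount_prime h₂, splitCount_of_not_isSquare hs] at hW
    have hd₁ : q₁ ∣ p * (q₁ * q₂) := (dvd_mul_right _ _).mul_left _
    have hd₂ : q₂ ∣ p * (q₁ * q₂) := (dvd_mul_left _ _).mul_left _
    rcases splitCount_cases (l := l) q₁ with ⟨hs₁, e₁⟩ | ⟨hs₁, e₁⟩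
    · rw [e₁, splitCount_of_not_isSquare (hs'.resolve_left (not_not_intro hs₁))] at hW
      exact (h.eq_four_iff_of_one (h.eq_one ⟨q₁, h₁, h₁4, hd₁⟩ (Or.inr (Or.inr ⟨q₁, h₁, h₁4, hd₁, hs₁⟩)))).2 hW
    · rcases splitCount_cases (l := l) q₂ with ⟨hs₂, e₂⟩ | ⟨hs₂, e₂⟩
      · rw [e₁, e₂] at hW
        exact (h.eq_four_iff_of_one (h.eq_one ⟨q₂, h₂, h₂4, hd₂⟩ (Or.inr (Or.inr ⟨q₂, h₂, h₂4, hd₂, hs₂⟩)))).2 hW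
      · rw [e₁, e₂] at hW
        refine (h.eq_four_iff_of_two (h.eq_two _ (Or.inl rfl) h4 (fun p' hp' hd => ?_) ⟨q₁, h₁, h₁4, hd₁⟩)).2 hW
        rcases eq_or_eq_or_eq_of_dvd_mul hp' hp h₁ h₂ hd with rfl | rfl | rfl
        · exact Or.inl hp4
        · exact Or.inr ⟨h₁4, hs₁⟩
        · exact Or.inr ⟨h₂4, hs₂⟩

end RankData

theorem mod_four_eq_one_of_primes {m : ℕ} (hm0 : m ≠ 0) (hm : ∀ p : ℕ, p.Prime → p ∣ m → p % 4 = 1) :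
    m % 4 = 1 := by
  induction m using induction_on_primes with
  | zero => exact (hm0 rfl).elim
  | one => rfl
  | prime_mul p a hp ih =>
    have h1 := hm p hp (dvd_mul_right _ _)
    have h2 := ih (right_ne_zero_of_mul hm0) fun q hq hd => hm q hq (hd.mul_left _)
    simp [Nat.mul_mod, h1, h2]

namespace RankData

variable {l n c ρ : ℕ} (h : RankData l n c ρ)
include h

theorem listed_of_forall_mod {m : ℕ} (hm2 : m % 2 = 1) (hm : Squarefree m) (hnm : n = m ∨ n = 2 * m)
    (hall : ∀ p : ℕ, p.Prime → p ∣ m → p % 4 = 1) (hc : c = 4) : Listed l n := by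
  have hm4 := mod_four_eq_one_of_primes hm.ne_zero hall
  have hW := sum_splitCount_ramPrimes (l := l) hm2 hnm
  by_cases hgood : (∀ p : ℕ, p.Prime → p ∣ m → IsSquare (l : ZMod p) → quartSym l p = quartSym p l) ∧
      (2 ∣ n → quartSym l 2 = (-1) ^ ((l - 1) / 8))
  · rw [(h.eq_four_iff_of_four (h.eq_four m hnm hm4 hall hgood.1 hgood.2)).1 hc] at hW
    rcases hnm with rfl | rfl
    · rw [if_pos hm4] at hW
      rcases exists_factorization (l := l) hm (by omega) with ⟨-, h0⟩ | ⟨p, hp, rfl, hs⟩ |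
        ⟨p, q, hp, hq, hpq, rfl, hs⟩ | ⟨p, q, r, hp, hq, hr, -, -, -, rfl, hs⟩ | ⟨hs, -⟩
      · omega
      · rcases splitCount_cases (l := l) n with ⟨hs', e⟩ | ⟨-, e⟩
        · exact Or.inr (Or.inl ⟨n, hp, hm4, rfl, hs', hgood.1 n hp dvd_rfl hs'⟩)
        · omega
      · have h1 := splitCount_cases (l := l) p
        have h2 := splitCount_cases (l := l) q
        exact Or.inl ⟨p, q, hp, hq, hall p hp (dvd_mul_right _ _), hall q hq (dvd_mul_left _ _), hpq, rfl,
          Or.inl ⟨fun hp' => by rw [splitCount_of_isSquare hp'] at hs h1; omega,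
            fun hq' => by rw [splitCount_of_isSquare hq'] at hs h2; omega⟩⟩
      · have h1 := splitCount_pos (l := l) p
        have h2 := splitCount_pos (l := l) q
        have h3 := splitCount_pos (l := l) r
        omega
      · omega
    · rw [if_neg (by omega)] at hW
      rcases exists_factorization (l := l) hm (by omega) with ⟨rfl, -⟩ | ⟨p, hp, rfl, hs⟩ |
        ⟨p, q, hp, hq, hpq, rfl, hs⟩ | ⟨p, q, r, hp, hq, hr, -, -, -, rfl, hs⟩ | ⟨hs, -⟩
      · exact Or.inr (Or.inr (Or.inr (Or.inl ⟨rfl, hgood.2 (dvd_mul_right _ _)⟩)))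
      · have h1 := splitCount_pos (l := l) m
        omega
      · have h1 := splitCount_pos (l := l) p
        omega
      · have h1 := splitCount_pos (l := l) p
        omega
      · omega
  · rw [(h.eq_four_iff_of_two (h.eq_two' m hnm hm4 hall hgood)).1 hc] at hW
    rcases hnm with rfl | rfl
    · have h2 : ¬ 2 ∣ n := by omega
      have hbad : ∃ p : ℕ, p.Prime ∧ p ∣ n ∧ IsSquare (l : ZMod p) ∧ quartSym l p ≠ quartSym p l := by
        by_contra! hb
        exact hgood ⟨hb, fun h => (h2 h).elim⟩
      obtain ⟨t, ht, htn, hts, htq⟩ := hbad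
      have hte := splitCount_of_isSquare hts
      rw [if_pos hm4] at hW
      rcases exists_factorization (l := l) hm (by omega) with ⟨-, h0⟩ | ⟨p, hp, rfl, hs⟩ |
        ⟨p, q, hp, hq, hpq, rfl, hs⟩ | ⟨p, q, r, hp, hq, hr, -, -, -, rfl, hs⟩ | ⟨hs, -⟩
      · omega
      · have h1 := splitCount_cases (l := l) n
        omega
      · rcases eq_or_eq_of_dvd_mul ht hp hq htn with rfl | rfl
        · exact Or.inl ⟨q, t, hq, hp, hall q hq (dvd_mul_left _ _), hall t hp (dvd_mul_right _ _), hpq.symm,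
            mul_comm _ _, Or.inr ⟨fun hs' => by have := splitCount_of_isSquare hs'; omega, hts, htq⟩⟩
        · exact Or.inl ⟨p, t, hp, hq, hall p hp (dvd_mul_right _ _), hall t hq (dvd_mul_left _ _), hpq,
            rfl, Or.inr ⟨fun hs' => by have := splitCount_of_isSquare hs'; omega, hts, htq⟩⟩
      · have h1 := splitCount_pos (l := l) p
        have h2 := splitCount_pos (l := l) q
        have h3 := splitCount_pos (l := l) r
        rcases eq_or_eq_or_eq_of_dvd_mul ht hp hq hr htn with rfl | rfl | rfl <;> omega
      · omega
    · rw [if_neg (by omega)] at hW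
      rcases exists_factorization (l := l) hm (by omega) with ⟨rfl, h0⟩ | ⟨p, hp, rfl, hs⟩ |
        ⟨p, q, hp, hq, hpq, rfl, hs⟩ | ⟨p, q, r, hp, hq, hr, -, -, -, rfl, hs⟩ | ⟨hs, -⟩
      · omega
      · have hns : ¬ IsSquare (l : ZMod m) := fun hs' => by
          have := splitCount_of_isSquare hs'
          omega
        refine Or.inr (Or.inr (Or.inl ⟨m, hp, hm4, rfl, hns, fun hq => hgood ⟨fun p' hp' hd hs' => ?_, fun _ => hq⟩⟩))
        rw [(Nat.prime_dvd_prime_iff_eq hp' hp).1 hd] at hs'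
        exact (hns hs').elim
      · have h1 := splitCount_pos (l := l) p
        have h2 := splitCount_pos (l := l) q
        omega
      · have h1 := splitCount_pos (l := l) p
        have h2 := splitCount_pos (l := l) q
        omega
      · omega

/-- The case `n ≡ 1 (mod 4)` or `n ≡ 2 (mod 8)` with only inert prime divisors `≡ 3 (mod 4)`. -/
theorem listed_of_inert {m : ℕ} (hm2 : m % 2 = 1) (hm : Squarefree m) (hnm : n = m ∨ n = 2 * m) (hm4 : m % 4 = 1)
    {t : ℕ} (ht : t.Prime) (ht4 : t % 4 = 3) (htm : t ∣ m)
    (hi : ∀ q : ℕ, q.Prime → q % 4 = 3 → q ∣ m → ¬ IsSquare (l : ZMod q)) (hc : c = 4) : Listed l n := by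
  have hodd : ∀ p : ℕ, p.Prime → p ∣ m → p % 4 = 1 ∨ p % 4 = 3 := fun p hp hd => by
    have := Nat.odd_iff.1 ((Nat.odd_iff.2 hm2).of_dvd_nat hd)
    omega
  have hW := sum_splitCount_ramPrimes (l := l) hm2 hnm
  rw [(h.eq_four_iff_of_two (h.eq_two m hnm hm4 (fun p hp hd => (hodd p hp hd).imp_right fun h4 => ⟨h4, hi p hp h4 hd⟩)
    ⟨t, ht, ht4, by rcases hnm with rfl | rfl; exacts [htm, htm.mul_left _]⟩)).1 hc] at hW
  rcases exists_factorization (l := l) hm (by omega) with ⟨rfl, -⟩ | ⟨p, hp, rfl, hs⟩ |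
    ⟨p, q, hp, hq, hpq, rfl, hs⟩ | ⟨p, q, r, hp, hq, hr, hpq, hpr, hqr, rfl, hs⟩ | ⟨hs, -⟩
  · exact (ht.one_lt.ne' (Nat.dvd_one.1 htm)).elim
  · rw [(Nat.prime_dvd_prime_iff_eq ht hp).1 htm] at ht4
    omega
  · have hp4 := hodd p hp (dvd_mul_right _ _)
    have hq4 := hodd q hq (dvd_mul_left _ _)
    have hpq4 := mul_mod_four hp4 hq4
    have h3 : p % 4 = 3 ∧ q % 4 = 3 := by
      rcases eq_or_eq_of_dvd_mul ht hp hq htm with rfl | rfl <;> omega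
    rw [splitCount_of_not_isSquare (hi p hp h3.1 (dvd_mul_right _ _)),
      splitCount_of_not_isSquare (hi q hq h3.2 (dvd_mul_left _ _))] at hs
    rcases hnm with rfl | rfl
    · rw [if_pos hm4] at hW
      omega
    · rw [if_neg (by omega)] at hW
      omega
  · have hdp : p ∣ p * (q * r) := dvd_mul_right _ _
    have hdq : q ∣ p * (q * r) := (dvd_mul_right _ _).mul_left _
    have hdr : r ∣ p * (q * r) := (dvd_mul_left _ _).mul_left _
    have hp4 := hodd p hp hdp
    have hq4 := hodd q hq hdq
    have hr4 := hodd r hr hdr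
    have hqr4 := mul_mod_four hq4 hr4
    have hpqr4 := mul_mod_four (a := p) (b := q * r) hp4 (by omega)
    have hp1 := splitCount_cases (l := l) p
    have hq1 := splitCount_cases (l := l) q
    have hr1 := splitCount_cases (l := l) r
    have hn : n = p * (q * r) := by
      rcases hnm with hnm | hnm
      · exact hnm
      · rw [if_neg (by omega)] at hW
        omega
    rw [if_pos (by omega)] at hW
    have hps : ¬ IsSquare (l : ZMod p) := fun hs' => by have := splitCount_of_isSquare hs'; omega
    have hqs : ¬ IsSquare (l : ZMod q) := fun hs' => by have := splitCount_of_isSquare hs'; omega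
    have hrs : ¬ IsSquare (l : ZMod r) := fun hs' => by have := splitCount_of_isSquare hs'; omega
    have ht3 : p % 4 = 3 ∨ q % 4 = 3 ∨ r % 4 = 3 := by
      rcases eq_or_eq_or_eq_of_dvd_mul ht hp hq hr htm with rfl | rfl | rfl <;> omega
    refine Or.inr (Or.inr (Or.inr (Or.inr (Or.inr (Or.inr (Or.inr ?_))))))
    obtain h1 | h1 | h1 : (p % 4 = 1 ∧ q % 4 = 3 ∧ r % 4 = 3) ∨ (q % 4 = 1 ∧ p % 4 = 3 ∧ r % 4 = 3) ∨
      (r % 4 = 1 ∧ p % 4 = 3 ∧ q % 4 = 3) := by omega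
    · exact ⟨p, q, r, hp, h1.1, hq, hr, h1.2.1, h1.2.2, hqr, hn, hps, Or.inl hqs⟩
    · exact ⟨q, p, r, hq, h1.1, hp, hr, h1.2.1, h1.2.2, hpr, by rw [hn]; ring, hqs, Or.inl hps⟩
    · exact ⟨r, p, q, hr, h1.1, hp, hq, h1.2.1, h1.2.2, hpq, by rw [hn]; ring, hrs, Or.inl hps⟩
  · rcases hnm with rfl | rfl
    · rw [if_pos hm4] at hW
      omega
    · rw [if_neg (by omega)] at hW
      omega

/-- The remaining cases, with trivial norm index. -/
theorem listed_of_eq_one {m : ℕ} (hm2 : m % 2 = 1) (hm : Squarefree m) (hnm : n = m ∨ n = 2 * m)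
    {t : ℕ} (ht : t.Prime) (ht4 : t % 4 = 3) (htm : t ∣ m)
    (hst : m % 4 = 3 ∨ IsSquare (l : ZMod t)) (hc : c = 4) : Listed l n := by
  have hodd : ∀ p : ℕ, p.Prime → p ∣ m → p % 4 = 1 ∨ p % 4 = 3 := fun p hp hd => by
    have := Nat.odd_iff.1 ((Nat.odd_iff.2 hm2).of_dvd_nat hd)
    omega
  have hW := sum_splitCount_ramPrimes (l := l) hm2 hnm
  have htn : t ∣ n := by rcases hnm with rfl | rfl; exacts [htm, htm.mul_left _]
  rw [(h.eq_four_iff_of_one (h.eq_one ⟨t, ht, ht4, htn⟩ (by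
    rcases hst with hst | hst
    · omega
    · exact Or.inr (Or.inr ⟨t, ht, ht4, htn, hst⟩)))).1 hc] at hW
  have hδ : ∃ δ, (δ = 1 ∨ δ = 2) ∧ n = δ * m := by
    rcases hnm with rfl | rfl
    · exact ⟨1, Or.inl rfl, (one_mul _).symm⟩
    · exact ⟨2, Or.inr rfl, rfl⟩
  obtain ⟨δ, hδ, hn⟩ := hδ
  rcases exists_factorization (l := l) hm (by omega) with ⟨rfl, -⟩ | ⟨p, hp, hmp, hs⟩ |
    ⟨p, q, hp, hq, hpq, rfl, hs⟩ | ⟨p, q, r, hp, hq, hr, hpq, hpr, hqr, rfl, hs⟩ | ⟨hs, hns⟩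
  · exact (ht.one_lt.ne' (Nat.dvd_one.1 htm)).elim
  · have htm' : t = m := by rw [hmp]; exact (Nat.prime_dvd_prime_iff_eq ht hp).1 (hmp ▸ htm)
    subst htm'
    subst hmp
    have hs1 := splitCount_cases (l := l) t
    rw [if_neg (by omega)] at hW
    exact Or.inr (Or.inr (Or.inr (Or.inr (Or.inl ⟨δ, t, hδ, hp, ht4, hn, by
      rcases hs1 with hs1 | hs1
      · exact hs1.1
      · omega⟩))))
  · have hp4 := hodd p hp (dvd_mul_right _ _)
    have hq4 := hodd q hq (dvd_mul_left _ _)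
    have hpq4 := mul_mod_four hp4 hq4
    have hp1 := splitCount_cases (l := l) p
    have hq1 := splitCount_cases (l := l) q
    rcases hpq4 with ⟨e1, e2⟩ | ⟨e1, e2⟩
    · have hts := splitCount_of_isSquare (hst.resolve_left (by omega))
      have h3 : p % 4 = 3 ∧ q % 4 = 3 ∧ 3 ≤ splitCount l p + splitCount l q := by
        rcases eq_or_eq_of_dvd_mul ht hp hq htm with rfl | rfl <;> omega
      have hn' : n = p * q := by
        rcases hnm with hnm | hnm
        · exact hnm
        · rw [if_neg (by omega)] at hW
          omega
      rw [if_pos (by omega)] at hW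
      refine Or.inr (Or.inr (Or.inr (Or.inr (Or.inr (Or.inl ⟨p, q, hp, hq, h3.1, h3.2.1, hpq, hn', ?_, ?_⟩)))))
      · rcases hp1 with hp1 | hp1
        · exact hp1.1
        · omega
      · rcases hq1 with hq1 | hq1
        · exact hq1.1
        · omega
    · rw [if_neg (by omega)] at hW
      have hps : ¬ IsSquare (l : ZMod p) := fun hs' => by have := splitCount_of_isSquare hs'; omega
      have hqs : ¬ IsSquare (l : ZMod q) := fun hs' => by have := splitCount_of_isSquare hs'; omega
      refine Or.inr (Or.inr (Or.inr (Or.inr (Or.inr (Or.inr (Or.inl ?_))))))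
      rcases hp4 with hp4 | hp4
      · exact ⟨δ, p, q, hδ, hp, hp4, hq, by omega, hn, hps, hqs⟩
      · exact ⟨δ, q, p, hδ, hq, by omega, hp, hp4, by rw [hn, mul_comm p q], hqs, hps⟩
  · have hdp : p ∣ p * (q * r) := dvd_mul_right _ _
    have hdq : q ∣ p * (q * r) := (dvd_mul_right _ _).mul_left _
    have hdr : r ∣ p * (q * r) := (dvd_mul_left _ _).mul_left _
    have hp4 := hodd p hp hdp
    have hq4 := hodd q hq hdq
    have hr4 := hodd r hr hdr
    have hqr4 := mul_mod_four hq4 hr4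
    have hpqr4 := mul_mod_four (a := p) (b := q * r) hp4 (by omega)
    have hp1 := splitCount_pos (l := l) p
    have hq1 := splitCount_pos (l := l) q
    have hr1 := splitCount_pos (l := l) r
    have hm4 : p * (q * r) % 4 = 1 := by
      by_contra hm4
      rw [if_neg (by omega)] at hW
      omega
    have hn' : n = p * (q * r) := by
      rcases hnm with hnm | hnm
      · exact hnm
      · rw [if_neg (by omega)] at hW
        omega
    rw [if_pos (by omega)] at hW
    have hts := splitCount_of_isSquare (hst.resolve_left (by omega))
    have inert : ∀ x : ℕ, splitCount l x = 1 → ¬ IsSquare (l : ZMod x) := fun x hx hs' => by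
      have := splitCount_of_isSquare hs'
      omega
    refine Or.inr (Or.inr (Or.inr (Or.inr (Or.inr (Or.inr (Or.inr ?_))))))
    rcases eq_or_eq_or_eq_of_dvd_mul ht hp hq hr htm with rfl | rfl | rfl
    · rcases hq4 with hq4 | hq4
      · exact ⟨q, t, r, hq, hq4, ht, hr, ht4, by omega, hpr, by rw [hn']; ring, inert _ (by omega),
          Or.inr (inert _ (by omega))⟩
      · exact ⟨r, t, q, hr, by omega, ht, hq, ht4, hq4, hpq, by rw [hn']; ring, inert _ (by omega),
          Or.inr (inert _ (by omega))⟩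
    · rcases hp4 with hp4 | hp4
      · exact ⟨p, t, r, hp, hp4, ht, hr, ht4, by omega, hqr, by rw [hn'], inert _ (by omega),
          Or.inr (inert _ (by omega))⟩
      · exact ⟨r, t, p, hr, by omega, ht, hp, ht4, hp4, hpq.symm, by rw [hn']; ring, inert _ (by omega),
          Or.inr (inert _ (by omega))⟩
    · rcases hp4 with hp4 | hp4
      · exact ⟨p, t, q, hp, hp4, ht, hq, ht4, by omega, hqr.symm, by rw [hn']; ring, inert _ (by omega),
          Or.inr (inert _ (by omega))⟩
      · exact ⟨q, t, p, hq, by omega, ht, hp, ht4, hp4, hpr.symm, by rw [hn']; ring, inert _ (by omega),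
          Or.inr (inert _ (by omega))⟩
  · rcases hst with hst | hst
    · rw [if_neg (by omega)] at hW
      omega
    · exact (hns t ht htm hst).elim

theorem eq_four_iff_listed (hn : Squarefree n) : c = 4 ↔ Listed l n := by
  refine ⟨fun hc => ?_, h.eq_four_of_listed⟩
  obtain ⟨m, hm2, hnm⟩ : ∃ m, m % 2 = 1 ∧ (n = m ∨ n = 2 * m) := by
    rcases Nat.mod_two_eq_zero_or_one n with h0 | h1
    · obtain ⟨m, rfl⟩ := Nat.dvd_of_mod_eq_zero h0
      refine ⟨m, ?_, Or.inr rfl⟩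
      by_contra hm
      obtain ⟨j, rfl⟩ : 2 ∣ m := by omega
      have := hn 2 (by rw [← mul_assoc]; exact dvd_mul_right _ _)
      simp at this
    · exact ⟨n, h1, Or.inl rfl⟩
  have hm : Squarefree m := hn.squarefree_of_dvd (by rcases hnm with rfl | rfl; exacts [dvd_rfl, dvd_mul_left _ _])
  have hodd : ∀ p : ℕ, p.Prime → p ∣ m → p % 4 = 1 ∨ p % 4 = 3 := fun p hp hd => by
    have := Nat.odd_iff.1 ((Nat.odd_iff.2 hm2).of_dvd_nat hd)
    omega
  by_cases hall : ∀ p : ℕ, p.Prime → p ∣ m → p % 4 = 1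
  · exact h.listed_of_forall_mod hm2 hm hnm hall hc
  push Not at hall
  obtain ⟨t, ht, htm, ht1⟩ := hall
  have ht4 := (hodd t ht htm).resolve_left ht1
  by_cases hm4 : m % 4 = 3
  · exact h.listed_of_eq_one hm2 hm hnm ht ht4 htm (Or.inl hm4) hc
  by_cases hi : ∀ q : ℕ, q.Prime → q % 4 = 3 → q ∣ m → ¬ IsSquare (l : ZMod q)
  · exact h.listed_of_inert hm2 hm hnm (by omega) ht ht4 htm hi hc
  · push Not at hi
    obtain ⟨q, hq, hq4, hqm, hqs⟩ := hi
    exact h.listed_of_eq_one hm2 hm hnm hq hq4 hqm (Or.inr hqs) hc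

end RankData

end

section

open IsDedekindDomain nonZeroDivisors NumberField Pointwise
open HeightOneSpectrum (squares evenUnits mem_squares_units ord_mul ord_pow)
set_option linter.unusedSectionVars false
open QuadExt
open HeightOneSpectrum

namespace SqrtPrime

variable {k : Type*} [Field k] [NumberField k] [Algebra.IsQuadraticExtension ℚ k] {l : ℕ} {s : 𝓞 k}
  (h : SqrtPrime l s) {u w : ℤ} (hN : NegPell l u w) {n : ℕ}
  {F : Type*} [Field F] [NumberField F] [Algebra k F] [Algebra.IsQuadraticExtension k F]

theorem rankData {τ : Gal(k/ℚ)} (hτ : τ ≠ 1) (hn : n ≠ 0) (hnl : n.Coprime l) (hsq : Squarefree n)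
    {σ : Gal(F/k)} {r : F} (hG : Gen σ r (h.radicand hN n)) :
    RankData l n (Nat.card {x : ClassGroup (𝓞 F) // x ^ 2 = 1})
      ((squares (𝓞 k)ˣ).relIndex (normUnits k F)) where
  formula := h.card_twoTorsion_quadExt hτ hN hn hnl hsq hG
  eq_one := h.relIndex_eq_one hτ hN hn hnl hsq hG
  eq_two := fun _ hnm hm4 hm hq => h.relIndex_eq_two_of_inert hτ hN hn hnl hsq hnm hG hm4 hm hq
  eq_four := fun _ hnm hm4 hm h₁ h₂ => by
    rw [h.relIndex_of_mod hτ hN hn hnl hsq hnm hG hm4 hm, if_pos ⟨h₁, h₂⟩]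
  eq_two' := fun _ hnm hm4 hm h' => by
    rw [h.relIndex_of_mod hτ hN hn hnl hsq hnm hG hm4 hm, if_neg h']

include h hN in
/-- When the class group of `ℚ(√(n ε √l))` has exactly four elements of order dividing two. -/
theorem card_twoTorsion_eq_four_iff (hn : n ≠ 0) (hnl : n.Coprime l) (hsq : Squarefree n)
    {r : F} (hr : r ^ 2 = algebraMap k F (n * ((u + w * s) * s))) :
    Nat.card {x : ClassGroup (𝓞 F) // x ^ 2 = 1} = 4 ↔ Listed l n := by
  obtain ⟨τ, hτ⟩ := QuadExt.exists_gal (k := ℚ) (F := k)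
  obtain ⟨σ, hG⟩ := Gen.exists_of_not_isSquare (d := h.radicand hN n)
    (by rw [hr, h.coe_radicand hN, h.coe_unit' hN]) (h.radicand_not_square hN hn hnl)
  exact (h.rankData hN hτ hn hnl hsq hG).eq_four_iff_listed hsq

end SqrtPrime

end

section

open IsDedekindDomain nonZeroDivisors NumberField Pointwise
open HeightOneSpectrum (squares evenUnits mem_squares_units ord_mul ord_pow)
set_option linter.unusedSectionVars false
open QuadExt

theorem legSym_mod_four {l p : ℕ} (hl : l.Prime) (hl8 : l % 8 = 1) (hp : p.Prime) (hp2 : p % 4 = 1 ∨ p % 4 = 3)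
    {n : ℕ} (hnl : n.Coprime l) (hpn : p ∣ n) :
    p ≠ l ∧ (legSym l p = 1 ↔ IsSquare (l : ZMod p)) ∧ (legSym l p = -1 ↔ ¬ IsSquare (l : ZMod p)) := by
  have hpl : p ≠ l := by
    rintro rfl
    exact hp.one_lt.ne' (Nat.dvd_one.1 (hnl ▸ Nat.dvd_gcd hpn dvd_rfl))
  have hp2 : p ≠ 2 := by omega
  exact ⟨hpl, legSym_eq_one_iff hl hl8 hp hp2 hpl, legSym_eq_neg_one_iff hl hl8 hp hp2 hpl⟩

theorem listed_iff {l n : ℕ} (hl : l.Prime) (hl8 : l % 8 = 1) (hnl : n.Coprime l) : Listed l n ↔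
      ((∃ p₁ p₂ : ℕ, p₁.Prime ∧ p₂.Prime ∧ p₁ % 4 = 1 ∧ p₂ % 4 = 1 ∧
          p₁ ≠ l ∧ p₂ ≠ l ∧ p₁ ≠ p₂ ∧ n = p₁ * p₂ ∧
          ((legSym l p₁ = -1 ∧ legSym l p₂ = -1) ∨
            (legSym l p₁ = -1 ∧ legSym l p₂ = 1 ∧ quartSym l p₂ ≠ quartSym p₂ l))) ∨
        (∃ p : ℕ, p.Prime ∧ p % 4 = 1 ∧ p ≠ l ∧ n = p ∧
          legSym l p = 1 ∧ quartSym l p = quartSym p l) ∨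
        (∃ p : ℕ, p.Prime ∧ p % 4 = 1 ∧ p ≠ l ∧ n = 2 * p ∧
          legSym l p = -1 ∧ quartSym l 2 ≠ (-1 : ℤ) ^ ((l - 1) / 8)) ∨
        (n = 2 ∧ quartSym l 2 = (-1 : ℤ) ^ ((l - 1) / 8)) ∨
        (∃ δ q : ℕ, (δ = 1 ∨ δ = 2) ∧ q.Prime ∧ q % 4 = 3 ∧ q ≠ l ∧ n = δ * q ∧
          legSym l q = 1) ∨
        (∃ q₁ q₂ : ℕ, q₁.Prime ∧ q₂.Prime ∧ q₁ % 4 = 3 ∧ q₂ % 4 = 3 ∧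
          q₁ ≠ l ∧ q₂ ≠ l ∧ q₁ ≠ q₂ ∧ n = q₁ * q₂ ∧
          legSym l q₁ = 1 ∧ legSym l q₂ = 1) ∨
        (∃ δ p q : ℕ, (δ = 1 ∨ δ = 2) ∧ p.Prime ∧ p % 4 = 1 ∧ p ≠ l ∧
          q.Prime ∧ q % 4 = 3 ∧ q ≠ l ∧ n = δ * (p * q) ∧
          legSym l p = -1 ∧ legSym l q = -1) ∨
        (∃ p q₁ q₂ : ℕ, p.Prime ∧ p % 4 = 1 ∧ p ≠ l ∧
          q₁.Prime ∧ q₂.Prime ∧ q₁ % 4 = 3 ∧ q₂ % 4 = 3 ∧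
          q₁ ≠ l ∧ q₂ ≠ l ∧ q₁ ≠ q₂ ∧ n = p * (q₁ * q₂) ∧
          legSym l p = -1 ∧ (legSym l q₁ = -1 ∨ legSym l q₂ = -1))) := by
  unfold Listed
  refine or_congr ?_ <| or_congr ?_ <| or_congr ?_ <| or_congr Iff.rfl <| or_congr ?_ <|
    or_congr ?_ <| or_congr ?_ ?_
  · refine exists₂_congr fun p₁ p₂ => and_congr_right fun hp₁ => and_congr_right fun hp₂ =>
      and_congr_right fun h₁ => and_congr_right fun h₂ => ?_
    by_cases hn : n = p₁ * p₂
    · obtain ⟨n₁, -, m₁⟩ := legSym_mod_four hl hl8 hp₁ (Or.inl h₁) hnl (hn ▸ dvd_mul_right _ _)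
      obtain ⟨n₂, k₂, m₂⟩ := legSym_mod_four hl hl8 hp₂ (Or.inl h₂) hnl (hn ▸ dvd_mul_left _ _)
      rw [m₁, m₂, k₂]
      tauto
    · simp only [hn, false_and, and_false]
  · refine exists_congr fun p => and_congr_right fun hp => and_congr_right fun hp4 => ?_
    by_cases hn : n = p
    · obtain ⟨n₁, k₁, -⟩ := legSym_mod_four hl hl8 hp (Or.inl hp4) hnl (hn ▸ dvd_rfl)
      rw [k₁]
      tauto
    · simp only [hn, false_and, and_false]
  · refine exists_congr fun p => and_congr_right fun hp => and_congr_right fun hp4 => ?_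
    by_cases hn : n = 2 * p
    · obtain ⟨n₁, -, m₁⟩ := legSym_mod_four hl hl8 hp (Or.inl hp4) hnl (hn ▸ dvd_mul_left _ _)
      rw [m₁]
      tauto
    · simp only [hn, false_and, and_false]
  · refine exists₂_congr fun δ q => and_congr_right fun _ => and_congr_right fun hq =>
      and_congr_right fun hq4 => ?_
    by_cases hn : n = δ * q
    · obtain ⟨n₁, k₁, -⟩ := legSym_mod_four hl hl8 hq (Or.inr hq4) hnl (hn ▸ dvd_mul_left _ _)
      rw [k₁]
      tauto
    · simp only [hn, false_and, and_false]
  · refine exists₂_congr fun q₁ q₂ => and_congr_right fun hq₁ => and_congr_right fun hq₂ =>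
      and_congr_right fun h₁ => and_congr_right fun h₂ => ?_
    by_cases hn : n = q₁ * q₂
    · obtain ⟨n₁, k₁, -⟩ := legSym_mod_four hl hl8 hq₁ (Or.inr h₁) hnl (hn ▸ dvd_mul_right _ _)
      obtain ⟨n₂, k₂, -⟩ := legSym_mod_four hl hl8 hq₂ (Or.inr h₂) hnl (hn ▸ dvd_mul_left _ _)
      rw [k₁, k₂]
      tauto
    · simp only [hn, false_and, and_false]
  · refine exists_congr fun δ => exists₂_congr fun p q => and_congr_right fun _ =>
      and_congr_right fun hp => and_congr_right fun hp4 => ?_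
    by_cases hn : n = δ * (p * q)
    · by_cases hq : q.Prime ∧ q % 4 = 3
      · obtain ⟨n₁, -, m₁⟩ := legSym_mod_four hl hl8 hp (Or.inl hp4) hnl
          (hn ▸ (dvd_mul_right _ _).mul_left _)
        obtain ⟨n₂, -, m₂⟩ := legSym_mod_four hl hl8 hq.1 (Or.inr hq.2) hnl
          (hn ▸ (dvd_mul_left _ _).mul_left _)
        rw [m₁, m₂]
        tauto
      · tauto
    · simp only [hn, false_and, and_false]
  · refine exists_congr fun p => exists₂_congr fun q₁ q₂ =>
      and_congr_right fun hp => and_congr_right fun hp4 => ?_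
    by_cases hn : n = p * (q₁ * q₂)
    · by_cases hq : (q₁.Prime ∧ q₁ % 4 = 3) ∧ q₂.Prime ∧ q₂ % 4 = 3
      · obtain ⟨n₀, -, m₀⟩ := legSym_mod_four hl hl8 hp (Or.inl hp4) hnl (hn ▸ dvd_mul_right _ _)
        obtain ⟨n₁, -, m₁⟩ := legSym_mod_four hl hl8 hq.1.1 (Or.inr hq.1.2) hnl
          (hn ▸ (dvd_mul_right _ _).mul_left _)
        obtain ⟨n₂, -, m₂⟩ := legSym_mod_four hl hl8 hq.2.1 (Or.inr hq.2.2) hnl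
          (hn ▸ (dvd_mul_left _ _).mul_left _)
        rw [m₀, m₁, m₂]
        tauto
      · tauto
    · simp only [hn, false_and, and_false]

section

theorem IsIntegral.exists_int_of_rat {x : ℝ} (hx : IsIntegral ℤ x) {q : ℚ} (hq : x = q) : ∃ a : ℤ, q = a := by
  have h : IsIntegral ℤ q := by
    rw [hq] at hx
    exact (isIntegral_algebraMap_iff (algebraMap ℚ ℝ).injective).1 hx
  obtain ⟨a, ha⟩ := IsIntegrallyClosed.isIntegral_iff.1 h
  exact ⟨a, by rw [← ha]; rfl⟩

/-- A unit `u + v√l > 1` of norm `-1` has positive integral coordinates if `l ≡ 1 (mod 8)`. -/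
theorem exists_negPell {l : ℕ} (hl : l.Prime) (hl8 : l % 8 = 1) {ε : ℝ} (h1 : 1 < ε) (hε : IsIntegral ℤ ε)
    (hε' : IsIntegral ℤ ε⁻¹) {u v : ℚ} (huv : ε = u + v * √l) (hN : (u : ℝ) ^ 2 - (v : ℝ) ^ 2 * l = -1) :
    ∃ a b : ℤ, NegPell l a b ∧ ε = a + b * √l := by
  have hs : √(l : ℝ) ^ 2 = l := Real.sq_sqrt (Nat.cast_nonneg l)
  have hs0 : 0 < √(l : ℝ) := Real.sqrt_pos.2 (by exact_mod_cast hl.pos)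
  have hinv : ε⁻¹ = -u + v * √l := by
    refine inv_eq_of_mul_eq_one_right ?_
    rw [huv]
    linear_combination (v : ℝ) ^ 2 * hs - hN
  obtain ⟨A, hA⟩ := (hε.sub hε').exists_int_of_rat (q := 2 * u) (by rw [hinv, huv]; push_cast; ring)
  have hInt : IsIntegral ℤ ((ε + ε⁻¹) * √l) := by
    refine (hε.add hε').mul (IsIntegral.of_pow two_pos ?_)
    rw [hs]
    exact isIntegral_algebraMap (R := ℤ) (x := (l : ℤ))
  obtain ⟨C, hC⟩ := hInt.exists_int_of_rat (q := 2 * v * l) (by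
    rw [hinv, huv]
    push_cast
    linear_combination 2 * (v : ℝ) * hs)
  have hNq : u ^ 2 - v ^ 2 * l = -1 := by exact_mod_cast hN
  have hCA : C ^ 2 = l * (A ^ 2 + 4) := by
    have : (C : ℚ) ^ 2 = l * (A ^ 2 + 4) := by
      rw [← hC, ← hA]
      linear_combination -4 * (l : ℚ) * hNq
    exact_mod_cast this
  obtain ⟨B, rfl⟩ := (Nat.prime_iff_prime_int.1 hl).dvd_of_dvd_pow (Dvd.intro _ hCA.symm)
  have hl0 : (l : ℤ) ≠ 0 := by exact_mod_cast hl.ne_zero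
  have hAB : A ^ 2 + 4 = l * B ^ 2 := mul_left_cancel₀ hl0 (by linear_combination -hCA)
  have hB : 2 * v = B := by
    refine mul_right_cancel₀ (b := (l : ℚ)) (by exact_mod_cast hl.ne_zero) ?_
    rw [hC]
    push_cast
    ring
  have heven : B % 2 = 0 ∧ A % 2 = 0 := by
    have hl8' : (l : ℤ) % 8 = 1 := by omega
    have h8 : (A ^ 2 + 4) % 8 = B ^ 2 % 8 := by
      rw [hAB, Int.mul_emod, hl8', one_mul, Int.emod_emod]
    have hA8 : A % 8 = 0 ∨ A % 8 = 1 ∨ A % 8 = 2 ∨ A % 8 = 3 ∨ A % 8 = 4 ∨ A % 8 = 5 ∨ A % 8 = 6 ∨ A % 8 = 7 := by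
      omega
    have hB8 : B % 8 = 0 ∨ B % 8 = 1 ∨ B % 8 = 2 ∨ B % 8 = 3 ∨ B % 8 = 4 ∨ B % 8 = 5 ∨ B % 8 = 6 ∨ B % 8 = 7 := by
      omega
    rw [Int.add_emod, pow_two, pow_two, Int.mul_emod, Int.mul_emod B] at h8
    rcases hA8 with h | h | h | h | h | h | h | h <;> rcases hB8 with h' | h' | h' | h' | h' | h' | h' | h' <;>
      rw [h, h'] at h8 <;> omega
  obtain ⟨b, rfl⟩ : ∃ b, B = 2 * b := ⟨B / 2, by omega⟩
  obtain ⟨a, rfl⟩ : ∃ a, A = 2 * a := ⟨A / 2, by omega⟩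
  have hu : u = a := by push_cast at hA; linarith
  have hv : v = b := by push_cast at hB; linarith
  subst hu hv
  push_cast at huv hinv
  have hlt : ε⁻¹ < 1 := inv_lt_one_of_one_lt₀ h1
  have hpos : 0 < ε⁻¹ := by positivity
  have ha : (0 : ℝ) < a := by linarith
  have hb : (0 : ℝ) < b := by
    refine (pos_iff_pos_of_mul_pos (b := √(l : ℝ)) ?_).2 hs0
    linarith
  exact ⟨a, b, ⟨by exact_mod_cast ha, by exact_mod_cast hb, by linarith⟩, huv⟩

open IntermediateField in
theorem finrank_adjoin_sqrt {F E : Type*} [Field F] [Field E] [Algebra F E] {x : E} {a : F}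
    (hx : x ^ 2 = algebraMap F E a) (hx' : x ∉ (⊥ : IntermediateField F E)) :
    Module.finrank F F⟮x⟯ = 2 := by
  have hp : Polynomial.aeval x (Polynomial.X ^ 2 - Polynomial.C a) = 0 := by simp [hx]
  have hm : (Polynomial.X ^ 2 - Polynomial.C a).Monic := Polynomial.monic_X_pow_sub_C a two_ne_zero
  have hi : IsIntegral F x := ⟨_, hm, hp⟩
  have h2 : (minpoly F x).natDegree ≤ 2 := by
    simpa using Polynomial.natDegree_le_of_dvd (minpoly.dvd F x hp) hm.ne_zero
  have h0 : 0 < (minpoly F x).natDegree := minpoly.natDegree_pos hi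
  have h1 : Module.finrank F F⟮x⟯ ≠ 1 := fun h => hx' (finrank_adjoin_simple_eq_one_iff.1 h)
  rw [adjoin.finrank hi] at h1 ⊢
  omega

end

open IntermediateField in
theorem twoTorsCard_eq_four_iff {l : ℕ} (hl : l.Prime) (hl8 : l % 8 = 1) {u w : ℤ} (hN : NegPell l u w) {n : ℕ}
    (hn : n ≠ 0) (hnl : n.Coprime l) (hsq : Squarefree n) {θ : ℝ} (hθ : θ ^ 2 = n * ((u + w * √l) * √l))
    (K : IntermediateField ℚ ℝ) (hK : K = ℚ⟮θ⟯) [NumberField K] : twoTorsCard K = 4 ↔ Listed l n := by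
  have hs : √(l : ℝ) ^ 2 = l := Real.sq_sqrt (Nat.cast_nonneg l)
  have hsℚ : √(l : ℝ) ∉ (⊥ : IntermediateField ℚ ℝ) := fun h => by
    obtain ⟨q, hq⟩ := IntermediateField.mem_bot.1 h
    exact hl.irrational_sqrt ⟨q, hq⟩
  have hk2 : Module.finrank ℚ ℚ⟮√(l : ℝ)⟯ = 2 := finrank_adjoin_sqrt (a := (l : ℚ)) (by simp) hsℚ
  have hθK : θ ∈ K := hK ▸ mem_adjoin_simple_self ℚ θ
  have hle : ℚ⟮√(l : ℝ)⟯ ≤ K := by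
    rw [adjoin_simple_le_iff]
    have h1 : √(l : ℝ) = (θ ^ 2 / n - w * l) / u := by
      have := hN.u_pos
      rw [hθ]
      field_simp
      linear_combination -(w : ℝ) * hs
    rw [h1]
    exact div_mem (sub_mem (div_mem (pow_mem hθK 2) (_root_.natCast_mem K n))
      (mul_mem (intCast_mem K w) (_root_.natCast_mem K l))) (intCast_mem K u)
  set k : IntermediateField ℚ ℝ := ℚ⟮√(l : ℝ)⟯ with hk
  have : FiniteDimensional ℚ k := FiniteDimensional.of_finrank_pos (by omega)
  have : NumberField k := {}
  have : Algebra.IsQuadraticExtension ℚ k := ⟨hk2⟩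
  let s : 𝓞 k := ⟨⟨√l, mem_adjoin_simple_self ℚ _⟩, IsIntegral.of_pow two_pos <| by
    have : (⟨√l, mem_adjoin_simple_self ℚ _⟩ : k) ^ 2 = algebraMap ℤ k l := Subtype.ext (by simp)
    rw [this]
    exact isIntegral_algebraMap⟩
  have hs' : (((s : k) : ℝ)) = √l := rfl
  have h : SqrtPrime l s := ⟨hl, hl8, RingOfIntegers.ext (Subtype.ext hs)⟩
  let _ : Algebra k K := (inclusion hle).toAlgebra
  have hmap : ∀ x : k, ((algebraMap k K x : K) : ℝ) = x := fun x => rfl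
  let t : K := ⟨θ, hθK⟩
  have ht : t ^ 2 = algebraMap k K (n * ((u + w * (s : k)) * (s : k))) := Subtype.ext (by
    rw [hmap]
    exact hθ)
  have htop : (adjoin k {t} : IntermediateField k K) = ⊤ := by
    have : IsScalarTower ℚ k K := IsScalarTower.of_algebraMap_eq fun _ => rfl
    refine eq_top_iff.2 fun x _ => ?_
    have h1 : K ≤ lift ((adjoin k {t}).restrictScalars ℚ) := by
      conv_lhs => rw [hK]
      rw [adjoin_simple_le_iff]
      exact (mem_lift t).2 (mem_adjoin_simple_self k t)
    exact (mem_lift x).1 (h1 x.2)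
  have hbot : t ∉ (⊥ : IntermediateField k K) := by
    intro hmem
    obtain ⟨x, hx⟩ := IntermediateField.mem_bot.1 hmem
    refine h.radicand_not_square hN hn hnl x ((algebraMap k K).injective ?_)
    rw [map_pow, hx, ht, h.coe_radicand hN, h.coe_unit' hN]
  have : Algebra.IsQuadraticExtension k K := ⟨by
    rw [← finrank_top', ← htop]
    exact finrank_adjoin_sqrt ht hbot⟩
  exact h.card_twoTorsion_eq_four_iff hN hn hnl hsq ht

end

/-- `l ≡ 1 (mod 8)` prime, `n` squarefree positive coprime to `l`,
`𝕂 = ℚ(√(n·ε₀·√l))`.  One has `r₂(H) = 2` (i.e. the 2-torsion of the class group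
has exactly `2² = 4` elements) iff `n` has one of the listed forms (`p, p₁, p₂`
distinct primes `≡ 1 (mod 4)`, `q, q₁, q₂` distinct primes `≡ 3 (mod 4)`, all
coprime to `l`, `δ ∈ {1,2}`; in case (1) the "ordering" of `{p₁, p₂}` is absorbed
by the symmetric existential quantifier). -/
theorem stmt_14 (l : ℕ) (hl : l.Prime) (hl8 : l % 8 = 1)
    (ε₀ : ℝ) (hε : IsFundamentalUnit l ε₀)
    (hεnorm : ∃ u v : ℚ, ε₀ = (u : ℝ) + (v : ℝ) * Real.sqrt (l : ℝ) ∧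
      (u : ℝ) ^ 2 - (v : ℝ) ^ 2 * (l : ℝ) = -1)
    (n : ℕ) (hn0 : 0 < n) (hnsq : Squarefree n) (hnl : n.Coprime l)
    (K : IntermediateField ℚ ℝ)
    (hK : K = IntermediateField.adjoin ℚ
      ({Real.sqrt ((n : ℝ) * ε₀ * Real.sqrt (l : ℝ))} : Set ℝ))
    [NumberField K] :
    twoTorsCard K = 2 ^ 2 ↔
      ((∃ p₁ p₂ : ℕ, p₁.Prime ∧ p₂.Prime ∧ p₁ % 4 = 1 ∧ p₂ % 4 = 1 ∧
          p₁ ≠ l ∧ p₂ ≠ l ∧ p₁ ≠ p₂ ∧ n = p₁ * p₂ ∧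
          ((legSym l p₁ = -1 ∧ legSym l p₂ = -1) ∨
            (legSym l p₁ = -1 ∧ legSym l p₂ = 1 ∧ quartSym l p₂ ≠ quartSym p₂ l))) ∨
        (∃ p : ℕ, p.Prime ∧ p % 4 = 1 ∧ p ≠ l ∧ n = p ∧
          legSym l p = 1 ∧ quartSym l p = quartSym p l) ∨
        (∃ p : ℕ, p.Prime ∧ p % 4 = 1 ∧ p ≠ l ∧ n = 2 * p ∧
          legSym l p = -1 ∧ quartSym l 2 ≠ (-1 : ℤ) ^ ((l - 1) / 8)) ∨
        (n = 2 ∧ quartSym l 2 = (-1 : ℤ) ^ ((l - 1) / 8)) ∨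
        (∃ δ q : ℕ, (δ = 1 ∨ δ = 2) ∧ q.Prime ∧ q % 4 = 3 ∧ q ≠ l ∧ n = δ * q ∧
          legSym l q = 1) ∨
        (∃ q₁ q₂ : ℕ, q₁.Prime ∧ q₂.Prime ∧ q₁ % 4 = 3 ∧ q₂ % 4 = 3 ∧
          q₁ ≠ l ∧ q₂ ≠ l ∧ q₁ ≠ q₂ ∧ n = q₁ * q₂ ∧
          legSym l q₁ = 1 ∧ legSym l q₂ = 1) ∨
        (∃ δ p q : ℕ, (δ = 1 ∨ δ = 2) ∧ p.Prime ∧ p % 4 = 1 ∧ p ≠ l ∧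
          q.Prime ∧ q % 4 = 3 ∧ q ≠ l ∧ n = δ * (p * q) ∧
          legSym l p = -1 ∧ legSym l q = -1) ∨
        (∃ p q₁ q₂ : ℕ, p.Prime ∧ p % 4 = 1 ∧ p ≠ l ∧
          q₁.Prime ∧ q₂.Prime ∧ q₁ % 4 = 3 ∧ q₂ % 4 = 3 ∧
          q₁ ≠ l ∧ q₂ ≠ l ∧ q₁ ≠ q₂ ∧ n = p * (q₁ * q₂) ∧
          legSym l p = -1 ∧ (legSym l q₁ = -1 ∨ legSym l q₂ = -1))) := by
  obtain ⟨u, v, huv, hN⟩ := hεnorm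
  obtain ⟨a, b, hab, rfl⟩ := exists_negPell hl hl8 hε.1 hε.2.2.1 hε.2.2.2.1 huv hN
  rw [← listed_iff hl hl8 hnl]
  refine twoTorsCard_eq_four_iff hl hl8 hab hn0.ne' hnl hnsq ?_ K hK
  have ha : (0 : ℝ) < a := by exact_mod_cast hab.u_pos
  have hb : (0 : ℝ) < b := by exact_mod_cast hab.v_pos
  rw [Real.sq_sqrt (by positivity), mul_assoc]
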